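/- Let M and N be indecomposable left Λ-modules over the Gelfand order Λ, each nonzero and finite-dimensional over k (indecomposable meaning M admits no decomposition as a direct sum of two nonzero submodules, and likewise N). Then the Euler characteristic satisfies |Σ_{i=0}^{2} (−1)^i dim_k Ext^i_Λ(M,N)| ≤ 2. -/

import Mathlib

set_option maxHeartbeats 1600000
set_option synthInstance.maxHeartbeats 400000

noncomputable section

variable (k : Type) [Field k]

/-- The maximal ideal `m = (t)` of `R = k⟦t⟧`. -/
def mIdeal : Ideal (PowerSeries k) :=
  Ideal.span {PowerSeries.X}

lemma X_mem_mIdeal : (PowerSeries.X : PowerSeries k) ∈ mIdeal k :=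
  Ideal.subset_span rfl

/-- The Gelfand order `Λ ⊆ M₃(k⟦t⟧)`: all matrices `A` with
`A₁₂, A₁₃, A₂₃, A₃₂ ∈ m`. -/
def gelfandOrder : Subalgebra k (Matrix (Fin 3) (Fin 3) (PowerSeries k)) where
  carrier := {A | A 0 1 ∈ mIdeal k ∧ A 0 2 ∈ mIdeal k ∧ A 1 2 ∈ mIdeal k ∧ A 2 1 ∈ mIdeal k}
  zero_mem' := ⟨zero_mem _, zero_mem _, zero_mem _, zero_mem _⟩
  one_mem' := by
    refine ⟨?_, ?_, ?_, ?_⟩ <;>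
    · rw [Matrix.one_apply_ne (by decide)]
      exact zero_mem _
  add_mem' := by
    rintro a b ⟨ha1, ha2, ha3, ha4⟩ ⟨hb1, hb2, hb3, hb4⟩
    exact ⟨add_mem ha1 hb1, add_mem ha2 hb2, add_mem ha3 hb3, add_mem ha4 hb4⟩
  mul_mem' := by
    rintro a b ⟨ha1, ha2, ha3, ha4⟩ ⟨hb1, hb2, hb3, hb4⟩
    refine ⟨?_, ?_, ?_, ?_⟩ <;>
      simp only [Set.mem_setOf_eq, Matrix.mul_apply, Fin.sum_univ_three]
    · exact add_mem (add_mem (Ideal.mul_mem_left _ _ hb1) (Ideal.mul_mem_right _ _ ha1))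
        (Ideal.mul_mem_left _ _ hb4)
    · exact add_mem (add_mem (Ideal.mul_mem_left _ _ hb2) (Ideal.mul_mem_left _ _ hb3))
        (Ideal.mul_mem_right _ _ ha2)
    · exact add_mem (add_mem (Ideal.mul_mem_left _ _ hb2) (Ideal.mul_mem_left _ _ hb3))
        (Ideal.mul_mem_right _ _ ha3)
    · exact add_mem (add_mem (Ideal.mul_mem_left _ _ hb1) (Ideal.mul_mem_right _ _ ha4))
        (Ideal.mul_mem_left _ _ hb4)
  algebraMap_mem' := by
    intro r
    refine ⟨?_, ?_, ?_, ?_⟩ <;>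
    · rw [Matrix.algebraMap_matrix_apply, if_neg (by decide)]
      exact zero_mem _

set_option linter.unusedSimpArgs false
set_option linter.unusedVariables false

namespace GelfandRed

open Module

/-- A filtered space with an idempotent and a matching of the strata. -/
structure Obj (k W : Type) [Field k] [AddCommGroup W] [Module k W] where
  e : W →ₗ[k] W
  F : ℕ → Submodule k W
  N : ℕ
  σ : ℕ → ℕ
  θ : ℕ → W →ₗ[k] W
  he : ∀ w, e (e w) = e w
  mono : Monotone F
  F0 : F 0 = ⊥
  FN : F N = ⊤
  invol : ∀ m, σ (σ m) = m
  θmem : ∀ m w, w ∈ F (m+1) → θ m w ∈ F (σ m + 1)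
  θlow : ∀ m w, w ∈ F m → θ m w ∈ F (σ m)
  θinv : ∀ m w, w ∈ F (m+1) → θ (σ m) (θ m w) - w ∈ F m
  θfix : ∀ m, σ m = m → θ m = LinearMap.id

variable {k W : Type} [Field k] [AddCommGroup W] [Module k W]

namespace Obj

variable (O : Obj k W)

/-- Compatibility at one stratum. -/
def Compat (g : W →ₗ[k] W) (m : ℕ) : Prop :=
  ∀ w ∈ O.F (m+1), O.θ m (g w) - g (O.θ m w) ∈ O.F (O.σ m)

/-- Endomorphisms of an object. -/
structure IsEndo (g : W →ₗ[k] W) : Prop where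
  comm : ∀ w, g (O.e w) = O.e (g w)
  filt : ∀ m w, w ∈ O.F m → g w ∈ O.F m
  compat : ∀ m, O.σ m ≠ m → O.Compat g m

/-- Every endomorphism is nilpotent or injective. -/
def Loc : Prop := ∀ g : W →ₗ[k] W, O.IsEndo g → IsNilpotent g ∨ Function.Injective g

/-- dimension of a stratum -/
def d (m : ℕ) : ℕ := finrank k (O.F (m+1)) - finrank k (O.F m)

/-- total dimension of unmatched strata -/
def u : ℕ := ∑ m ∈ Finset.range O.N, if O.σ m = m then O.d m else 0

/-- measure -/
def μ : ℕ := ∑ m ∈ Finset.range O.N, (O.d m)^2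

lemma le_succ (m : ℕ) : O.F m ≤ O.F (m+1) := O.mono (Nat.le_succ m)

lemma compat_symm {g : W →ₗ[k] W} (hf : ∀ m w, w ∈ O.F m → g w ∈ O.F m) {p q : ℕ}
    (hpq : O.σ p = q) (h : O.Compat g p) : O.Compat g q := by
  have hqp : O.σ q = p := by rw [← hpq, O.invol]
  intro w hw
  rw [hqp]
  have hv : O.θ q w ∈ O.F (p+1) := by have := O.θmem q w hw; rwa [hqp] at this
  have c1 : O.θ p (O.θ q w) - w ∈ O.F q := by have := O.θinv q w hw; rwa [hqp] at this
  have c2 := h _ hv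
  rw [hpq] at c2
  have c3 := O.θlow q _ c2
  have c4 := O.θinv p _ (hf _ _ hv)
  rw [hpq] at c4
  have c5 := O.θlow q _ (hf _ _ c1)
  rw [hqp] at c3 c5
  have := sub_mem (sub_mem c4 c3) c5
  simp only [map_sub] at this
  convert this using 1
  abel

/-- Compatibility when both sides act as zero on the graded pieces -/
lemma compat_zero {g : W →ₗ[k] W} {m : ℕ} (h1 : ∀ w ∈ O.F (m+1), g w ∈ O.F m)
    (h2 : ∀ w ∈ O.F (O.σ m + 1), g w ∈ O.F (O.σ m)) : O.Compat g m := by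
  intro w hw
  exact sub_mem (O.θlow _ _ (h1 w hw)) (h2 _ (O.θmem _ _ hw))

lemma compat_one {g : W →ₗ[k] W} {m : ℕ} (h1 : ∀ w ∈ O.F (m+1), g w - w ∈ O.F m)
    (h2 : ∀ w ∈ O.F (O.σ m + 1), g w - w ∈ O.F (O.σ m)) : O.Compat g m := by
  intro w hw
  have := sub_mem (O.θlow _ _ (h1 w hw)) (h2 _ (O.θmem _ _ hw))
  simpa using this

lemma compat_triv {g : W →ₗ[k] W} (hf : ∀ m w, w ∈ O.F m → g w ∈ O.F m) {m : ℕ}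
    (h : O.F (m+1) ≤ O.F m) : O.Compat g m := by
  intro w hw
  exact sub_mem (O.θlow _ _ (hf _ _ (h hw))) (hf _ _ (O.θlow _ _ (h hw)))

lemma compat_add {g g' : W →ₗ[k] W} {m : ℕ} (h : O.Compat g m) (h' : O.Compat g' m) :
    O.Compat (g + g') m := by
  intro w hw
  have := add_mem (h w hw) (h' w hw)
  convert this using 1
  simp only [LinearMap.add_apply, map_add]
  abel

lemma pow_filt {g : W →ₗ[k] W} {S : Submodule k W} (hf : ∀ w ∈ S, g w ∈ S) (n : ℕ) :
    ∀ w ∈ S, (g ^ n) w ∈ S := by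
  induction n with
  | zero => intro w hw; simpa using hw
  | succ n ih => intro w hw; rw [pow_succ']; exact hf _ (ih w hw)

/-- nilpotent or injective only depends on the graded action -/
lemma nilp_of_graded {g g' : W →ₗ[k] W} (hf : ∀ m w, w ∈ O.F m → g w ∈ O.F m)
    (h : ∀ m w, w ∈ O.F (m+1) → g' w - g w ∈ O.F m) (hn : IsNilpotent g) : IsNilpotent g' := by
  have hf' : ∀ m w, w ∈ O.F m → g' w ∈ O.F m := by
    intro m w hw
    cases m with
    | zero =>
      rw [O.F0] at hw ⊢
      simp only [Submodule.mem_bot] at hw ⊢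
      simp [hw]
    | succ m =>
      have := add_mem (O.le_succ m (h m w hw)) (hf _ _ hw)
      simpa using this
  obtain ⟨r, hr⟩ := hn
  have key : ∀ n m w, w ∈ O.F (m+1) → (g' ^ n) w - (g ^ n) w ∈ O.F m := by
    intro n
    induction n with
    | zero => intro m w _; simp
    | succ n ih =>
      intro m w hw
      rw [pow_succ', pow_succ', Module.End.mul_apply, Module.End.mul_apply]
      have h1 := hf' _ _ (ih m w hw)
      have h2 := h m _ (pow_filt (hf (m+1)) n w hw)
      have := add_mem h1 h2
      simpa using this
  have key2 : ∀ m w, w ∈ O.F m → ((g' ^ r) ^ m) w = 0 := by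
    intro m
    induction m with
    | zero => intro w hw; rw [O.F0] at hw; simp only [Submodule.mem_bot] at hw; simp [hw]
    | succ m ih =>
      intro w hw
      rw [pow_succ, Module.End.mul_apply]
      apply ih
      have := key r m w hw
      rw [hr] at this
      simpa using this
  refine ⟨r * O.N, ?_⟩
  ext w
  rw [pow_mul, key2 O.N w (by rw [O.FN]; trivial)]
  rfl

lemma inj_of_graded [FiniteDimensional k W] {g g' : W →ₗ[k] W}
    (hf : ∀ m w, w ∈ O.F m → g w ∈ O.F m)
    (h : ∀ m w, w ∈ O.F (m+1) → g' w - g w ∈ O.F m) (hn : Function.Injective g) :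
    Function.Injective g' := by
  rw [← LinearMap.ker_eq_bot, LinearMap.ker_eq_bot']
  have key : ∀ m w, w ∈ O.F m → g' w = 0 → w = 0 := by
    intro m
    induction m with
    | zero => intro w hw _; rw [O.F0] at hw; simpa using hw
    | succ m ih =>
      intro w hw h0
      apply ih w _ h0
      have h1 : g w ∈ O.F m := by
        have := h m w hw
        rw [h0] at this
        simpa using this
      have hsurj : Function.Surjective (g.restrict (hf m)) := by
        rw [← LinearMap.injective_iff_surjective]
        intro a b hab
        apply Subtype.ext
        apply hn
        simpa using congrArg Subtype.val hab
      obtain ⟨a, ha⟩ := hsurj ⟨g w, h1⟩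
      have := congrArg Subtype.val ha
      simp only [LinearMap.coe_restrict_apply] at this
      rw [← hn this]
      exact a.2
  intro w h0
  exact key O.N w (by rw [O.FN]; trivial) h0

/-- if g lowers a stratum and is injective then the stratum is trivial -/
lemma triv_of_lower [FiniteDimensional k W] {g : W →ₗ[k] W} (hn : Function.Injective g) {m : ℕ}
    (h : ∀ w ∈ O.F (m+1), g w ∈ O.F m) : O.F (m+1) = O.F m := by
  symm
  apply Submodule.eq_of_le_of_finrank_le (O.le_succ m)
  have : (O.F (m+1)).map g ≤ O.F m := by
    rintro _ ⟨w, hw, rfl⟩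
    exact h w hw
  calc finrank k (O.F (m+1)) = finrank k ((O.F (m+1)).map g) :=
        (Submodule.equivMapOfInjective g hn _).finrank_eq
    _ ≤ _ := Submodule.finrank_mono this

/-- Refinement -/
def refine (Mid : ℕ → Submodule k W) (h1 : ∀ m, O.F m ≤ Mid m) (h2 : ∀ m, Mid m ≤ O.F (m+1))
    (h3 : ∀ m w, w ∈ Mid m → O.θ m w ∈ Mid (O.σ m)) : Obj k W where
  e := O.e
  F := fun n => if n % 2 = 0 then O.F (n/2) else Mid (n/2)
  N := 2 * O.N
  σ := fun n => 2 * O.σ (n/2) + n % 2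
  θ := fun n => O.θ (n/2)
  he := O.he
  mono := by
    apply monotone_nat_of_le_succ
    intro n
    rcases Nat.even_or_odd' n with ⟨m, rfl | rfl⟩
    · rw [if_pos (by omega), if_neg (by omega), show 2*m/2 = m by omega,
        show (2*m+1)/2 = m by omega]
      exact h1 m
    · rw [if_neg (by omega), if_pos (by omega), show (2*m+1)/2 = m by omega,
        show (2*m+1+1)/2 = m+1 by omega]
      exact h2 m
  F0 := by simpa using O.F0
  FN := by simpa using O.FN
  invol := by
    intro n
    rw [show (2 * O.σ (n/2) + n % 2)/2 = O.σ (n/2) by omega, O.invol]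
    omega
  θmem := by
    intro n w
    rcases Nat.even_or_odd' n with ⟨m, rfl | rfl⟩
    · rw [if_neg (by omega), if_neg (by omega), show 2*m/2 = m by omega,
        show (2*m+1)/2 = m by omega, show (2*O.σ m + 2*m%2+1)/2 = O.σ m by omega]
      exact h3 m w
    · rw [if_pos (by omega), if_pos (by omega), show (2*m+1)/2 = m by omega,
        show (2*m+1+1)/2 = m+1 by omega, show (2*O.σ m + (2*m+1)%2+1)/2 = O.σ m+1 by omega]
      exact O.θmem m w
  θlow := by
    intro n w
    rcases Nat.even_or_odd' n with ⟨m, rfl | rfl⟩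
    · rw [if_pos (by omega), if_pos (by omega), show 2*m/2 = m by omega,
         show (2*O.σ m + 2*m%2)/2 = O.σ m by omega]
      exact O.θlow m w
    · rw [if_neg (by omega), if_neg (by omega), show (2*m+1)/2 = m by omega,
        show (2*O.σ m + (2*m+1)%2)/2 = O.σ m by omega]
      exact h3 m w
  θinv := by
    intro n w
    rcases Nat.even_or_odd' n with ⟨m, rfl | rfl⟩
    · rw [if_neg (by omega), if_pos (by omega), show 2*m/2 = m by omega,
        show (2*m+1)/2 = m by omega, show (2*O.σ m + 2*m%2)/2 = O.σ m by omega]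
      intro hw
      exact O.θinv m w (h2 m hw)
    · rw [if_pos (by omega), if_neg (by omega), show (2*m+1)/2 = m by omega,
        show (2*m+1+1)/2 = m+1 by omega, show (2*O.σ m + (2*m+1)%2)/2 = O.σ m by omega]
      intro hw
      exact h1 m (O.θinv m w hw)
  θfix := by
    intro n hn
    exact O.θfix _ (by omega)

section refine
variable (Mid : ℕ → Submodule k W) (h1 : ∀ m, O.F m ≤ Mid m) (h2 : ∀ m, Mid m ≤ O.F (m+1))
    (h3 : ∀ m w, w ∈ Mid m → O.θ m w ∈ Mid (O.σ m))

lemma refine_F_even (m : ℕ) : (O.refine Mid h1 h2 h3).F (2*m) = O.F m := by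
  simp [refine]
lemma refine_F_odd (m : ℕ) : (O.refine Mid h1 h2 h3).F (2*m+1) = Mid m := by
  show (if (2*m+1) % 2 = 0 then O.F ((2*m+1)/2) else Mid ((2*m+1)/2)) = _
  rw [if_neg (by omega), show (2*m+1)/2 = m by omega]
lemma refine_σ_even (m : ℕ) : (O.refine Mid h1 h2 h3).σ (2*m) = 2 * O.σ m := by
  simp [refine]
lemma refine_σ_odd (m : ℕ) : (O.refine Mid h1 h2 h3).σ (2*m+1) = 2 * O.σ m + 1 := by
  show 2 * O.σ ((2*m+1)/2) + (2*m+1)%2 = _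
  rw [show (2*m+1)/2 = m by omega]; omega
lemma refine_θ_even (m : ℕ) : (O.refine Mid h1 h2 h3).θ (2*m) = O.θ m := by
  simp [refine]
lemma refine_θ_odd (m : ℕ) : (O.refine Mid h1 h2 h3).θ (2*m+1) = O.θ m := by
  show O.θ ((2*m+1)/2) = _
  rw [show (2*m+1)/2 = m by omega]
lemma refine_F_even' (m : ℕ) : (O.refine Mid h1 h2 h3).F (2*m+1+1) = O.F (m+1) :=
  O.refine_F_even Mid h1 h2 h3 (m+1)

lemma sum_range_two_mul (f : ℕ → ℕ) (N : ℕ) :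
    ∑ m ∈ Finset.range (2*N), f m = ∑ m ∈ Finset.range N, (f (2*m) + f (2*m+1)) := by
  induction N with
  | zero => simp
  | succ n ih =>
    rw [show 2*(n+1) = 2*n+1+1 by ring, Finset.sum_range_succ, Finset.sum_range_succ, ih,
      Finset.sum_range_succ]
    ring

lemma refine_u [FiniteDimensional k W] : (O.refine Mid h1 h2 h3).u = O.u := by
  unfold u
  rw [show (O.refine Mid h1 h2 h3).N = 2 * O.N from rfl, sum_range_two_mul]
  apply Finset.sum_congr rfl
  intro m _
  rw [refine_σ_even, refine_σ_odd]
  unfold d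
  rw [refine_F_even, refine_F_odd, refine_F_even']
  have := Submodule.finrank_mono (h1 m)
  have := Submodule.finrank_mono (h2 m)
  by_cases h : O.σ m = m
  · rw [if_pos (by omega), if_pos (by omega), if_pos h]; omega
  · rw [if_neg (by omega), if_neg (by omega), if_neg h]

lemma refine_μ [FiniteDimensional k W] {p : ℕ} (hp1 : O.F p < Mid p) (hp2 : Mid p < O.F (p+1)) :
    (O.refine Mid h1 h2 h3).μ < O.μ := by
  unfold μ
  rw [show (O.refine Mid h1 h2 h3).N = 2 * O.N from rfl, sum_range_two_mul]
  have hpN : p < O.N := by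
    by_contra hc
    have : O.F p = ⊤ := top_le_iff.1 (O.FN ▸ O.mono (not_lt.1 hc))
    rw [this] at hp1
    exact absurd hp1 not_top_lt
  apply Finset.sum_lt_sum
  · intro m _
    unfold d
    rw [refine_F_even, refine_F_odd, refine_F_even']
    have a1 := Submodule.finrank_mono (h1 m)
    have a2 := Submodule.finrank_mono (h2 m)
    generalize finrank k (O.F m) = a at *
    generalize finrank k (Mid m) = b at *
    generalize finrank k (O.F (m+1)) = c at *
    obtain ⟨x, rfl⟩ := Nat.exists_eq_add_of_le a1
    obtain ⟨y, rfl⟩ := Nat.exists_eq_add_of_le a2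
    rw [show a + x - a = x by omega, show a + x + y - (a+x) = y by omega,
      show a + x + y - a = x + y by omega]
    nlinarith [Nat.zero_le (x*y)]
  · refine ⟨p, Finset.mem_range.2 hpN, ?_⟩
    unfold d
    rw [refine_F_even, refine_F_odd, refine_F_even']
    have a1 := Submodule.finrank_lt_finrank_of_lt hp1
    have a2 := Submodule.finrank_lt_finrank_of_lt hp2
    generalize finrank k (O.F p) = a at *
    generalize finrank k (Mid p) = b at *
    generalize finrank k (O.F (p+1)) = c at *
    obtain ⟨x, rfl⟩ := Nat.exists_eq_add_of_lt a1
    obtain ⟨y, rfl⟩ := Nat.exists_eq_add_of_lt a2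
    rw [show a + x + 1 - a = x + 1 by omega, show a + x + 1 + y + 1 - (a+x+1) = y + 1 by omega,
      show a + x + 1 + y + 1 - a = x + y + 2 by omega]
    nlinarith [Nat.zero_le (x*y)]

end refine

/-- There is enough freedom to refine at stratum `p` by `X`. -/
def Free (p : ℕ) (X : Submodule k W) : Prop :=
  ∀ f : W →ₗ[k] W, (∀ w ∈ O.F (p+1), f w ∈ X) → (∀ w ∈ X, f w ∈ O.F p) →
    ∃ τ : W →ₗ[k] W, (∀ w, τ (O.e w) = O.e (τ w)) ∧
      (∀ m, m ≠ p → ∀ w ∈ O.F (m+1), τ w ∈ O.F m) ∧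
      (∀ w ∈ O.F (p+1), τ w - f w ∈ O.F p)

/-- Refining at a stratum with enough freedom preserves locality. -/
theorem exists_refine [FiniteDimensional k W] (hloc : O.Loc) {p : ℕ} {X : Submodule k W}
    (hX1 : O.F p < X) (hX2 : X < O.F (p+1)) (hfree : O.Free p X) :
    ∃ O' : Obj k W, O'.e = O.e ∧ O'.u = O.u ∧ O'.μ < O.μ ∧ O'.Loc := by
  classical
  set q := O.σ p with hq
  have hqp : O.σ q = p := O.invol p
  let Mid : ℕ → Submodule k W := fun m =>
    if m = p then X else if m = q then O.F q ⊔ X.map (O.θ p) else O.F m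
  have Mp : Mid p = X := if_pos rfl
  have Mq : q ≠ p → Mid q = O.F q ⊔ X.map (O.θ p) := fun h => by
    simp [Mid, h]
  have Mo : ∀ m, m ≠ p → m ≠ q → Mid m = O.F m := fun m h h' => by
    simp only [Mid]; rw [if_neg h, if_neg h']
  have h1 : ∀ m, O.F m ≤ Mid m := by
    intro m
    by_cases hm : m = p
    · rw [hm, Mp]; exact hX1.le
    by_cases hm' : m = q
    · subst hm'; rw [Mq hm]; exact le_sup_left
    · rw [Mo m hm hm']
  have h2 : ∀ m, Mid m ≤ O.F (m+1) := by
    intro m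
    by_cases hm : m = p
    · rw [hm, Mp]; exact hX2.le
    by_cases hm' : m = q
    · subst hm'; rw [Mq hm]
      apply sup_le (O.le_succ _)
      rintro _ ⟨w, hw, rfl⟩
      exact O.θmem p w (hX2.le hw)
    · rw [Mo m hm hm']; exact O.le_succ m
  have h3 : ∀ m w, w ∈ Mid m → O.θ m w ∈ Mid (O.σ m) := by
    intro m w hw
    by_cases hqp' : q = p
    · by_cases hm : m = p
      · rw [hm] at hw ⊢
        rw [O.θfix p (by rw [← hq]; exact hqp'), ← hq, hqp']
        exact hw
      · rw [Mo m hm (by rw [hqp']; exact hm)] at hw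
        exact h1 _ (O.θlow m w hw)
    by_cases hm : m = p
    · rw [hm] at hw ⊢
      rw [Mp] at hw
      rw [← hq, Mq hqp']
      exact Submodule.mem_sup_right ⟨w, hw, rfl⟩
    by_cases hm' : m = q
    · rw [hm'] at hw ⊢
      rw [Mq hqp'] at hw
      rw [hqp, Mp]
      obtain ⟨a, ha, b, ⟨x, hx, rfl⟩, rfl⟩ := Submodule.mem_sup.1 hw
      rw [map_add]
      apply add_mem
      · have := O.θlow q a ha
        rw [hqp] at this
        exact hX1.le this
      · have := O.θinv p x (hX2.le hx)
        have := add_mem (hX1.le this) hx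
        simpa using this
    · rw [Mo m hm hm'] at hw
      exact h1 _ (O.θlow m w hw)
  refine ⟨O.refine Mid h1 h2 h3, rfl, O.refine_u Mid h1 h2 h3,
    O.refine_μ Mid h1 h2 h3 (p := p) (by rwa [Mp]) (by rwa [Mp]), ?_⟩
  intro g hg
  have gcomm : ∀ w, g (O.e w) = O.e (g w) := hg.comm
  have gF : ∀ m w, w ∈ O.F m → g w ∈ O.F m := by
    intro m w hw
    have := hg.filt (2*m) w (by rwa [refine_F_even])
    rwa [refine_F_even] at this
  have gM : ∀ m w, w ∈ Mid m → g w ∈ Mid m := by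
    intro m w hw
    have := hg.filt (2*m+1) w (by rwa [refine_F_odd])
    rwa [refine_F_odd] at this
  have gc1 : ∀ m, O.σ m ≠ m → ∀ w ∈ Mid m, O.θ m (g w) - g (O.θ m w) ∈ O.F (O.σ m) := by
    intro m hm w hw
    have := hg.compat (2*m) (by rw [refine_σ_even]; omega) w (by rwa [refine_F_odd])
    rwa [refine_σ_even, refine_F_even, refine_θ_even] at this
  have gc2 : ∀ m, O.σ m ≠ m → ∀ w ∈ O.F (m+1), O.θ m (g w) - g (O.θ m w) ∈ Mid (O.σ m) := by
    intro m hm w hw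
    have := hg.compat (2*m+1) (by rw [refine_σ_odd]; omega) w (by rwa [refine_F_even'])
    rwa [refine_σ_odd, refine_F_odd, refine_θ_odd] at this
  have gco : ∀ m, O.σ m ≠ m → m ≠ p → m ≠ q → O.Compat g m := by
    intro m hm hmp hmq w hw
    have := gc2 m hm w hw
    rwa [Mo] at this
    · intro h; apply hmq; rw [hq, ← h, O.invol]
    · intro h; apply hmp; rw [← hqp, ← h, O.invol]
  by_cases hqp' : q = p
  · apply hloc g ⟨gcomm, gF, ?_⟩
    intro m hm
    have : m ≠ p := by rintro rfl; exact hm hqp'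
    exact gco m hm this (by rw [hqp']; exact this)
  obtain ⟨τ, τc, τl, τp⟩ := hfree (-(O.θ q ∘ₗ (O.θ p ∘ₗ g - g ∘ₗ O.θ p)))
    (by
      intro w hw
      have := h3 q _ (gc2 p hqp' w hw)
      rw [hqp, Mp] at this
      simpa using neg_mem this)
    (by
      intro w hw
      have := O.θlow q _ (gc1 p hqp' w (by rwa [Mp]))
      rw [hqp] at this
      simpa using neg_mem this)
  have τlow : ∀ n w, w ∈ (O.refine Mid h1 h2 h3).F (n+1) → τ w ∈ (O.refine Mid h1 h2 h3).F n := by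
    intro n w hw
    rcases Nat.even_or_odd' n with ⟨m, rfl | rfl⟩
    · rw [refine_F_odd] at hw
      rw [refine_F_even]
      by_cases hm : m = p
      · subst hm
        have a1 := τp w (h2 _ hw)
        have a2 := O.θlow q _ (gc1 m hqp' w hw)
        rw [hqp] at a2
        have := sub_mem a1 a2
        convert this using 1
        simp only [LinearMap.neg_apply, LinearMap.comp_apply, LinearMap.sub_apply, map_sub]
        abel
      · exact τl m hm w (h2 _ hw)
    · rw [refine_F_even'] at hw
      rw [refine_F_odd]
      by_cases hm : m = p
      · subst hm
        have a1 := h1 _ (τp w hw)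
        have a2 := h3 q _ (gc2 m hqp' w hw)
        rw [hqp] at a2
        have := sub_mem a1 a2
        convert this using 1
        simp only [LinearMap.neg_apply, LinearMap.comp_apply, LinearMap.sub_apply, map_sub]
        abel
      · exact h1 _ (τl m hm w hw)
  have τf' : ∀ n w, w ∈ (O.refine Mid h1 h2 h3).F n → τ w ∈ (O.refine Mid h1 h2 h3).F n := by
    intro n w hw
    cases n with
    | zero =>
      rw [Obj.F0] at hw ⊢
      simp only [Submodule.mem_bot] at hw ⊢
      simp [hw]
    | succ n => exact Obj.le_succ _ n (τlow n w hw)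
  have τf : ∀ m w, w ∈ O.F m → τ w ∈ O.F m := by
    intro m w hw
    have := τf' (2*m) w (by rwa [refine_F_even])
    rwa [refine_F_even] at this
  have gτF : ∀ m w, w ∈ O.F m → (g + τ) w ∈ O.F m :=
    fun m w hw => add_mem (gF m w hw) (τf m w hw)
  have cp : O.Compat (g + τ) p := by
    intro w hw
    rw [← hq]
    have a1 : τ (O.θ p w) ∈ O.F q := τl q hqp' _ (O.θmem p w hw)
    have a2 := O.θlow p _ (τp w hw)
    have a3 := O.θinv q _ (h2 _ (gc2 p hqp' w hw))
    rw [hqp] at a3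
    have := sub_mem (sub_mem a2 a3) a1
    convert this using 1
    simp only [LinearMap.add_apply, LinearMap.neg_apply, LinearMap.comp_apply,
      LinearMap.sub_apply, map_add, map_sub, map_neg]
    abel
  have hE : O.IsEndo (g + τ) := by
    refine ⟨fun w => by simp [gcomm, τc], gτF, ?_⟩
    intro m hm
    by_cases hmp : m = p
    · rw [hmp]; exact cp
    by_cases hmq : m = q
    · exact O.compat_symm gτF (by rw [← hq, hmq]) cp
    · apply O.compat_add (gco m hm hmp hmq)
      apply O.compat_zero (τl m hmp)
      apply τl
      intro h; apply hmq; rw [hq, ← h, O.invol]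
  have hf2 : ∀ n w, w ∈ (O.refine Mid h1 h2 h3).F n → (g + τ) w ∈ (O.refine Mid h1 h2 h3).F n :=
    fun n w hw => add_mem (hg.filt n w hw) (τf' n w hw)
  have hd : ∀ n w, w ∈ (O.refine Mid h1 h2 h3).F (n+1) →
      g w - (g + τ) w ∈ (O.refine Mid h1 h2 h3).F n := by
    intro n w hw
    have := neg_mem (τlow n w hw)
    simpa using this
  rcases hloc _ hE with h | h
  · exact Or.inl (nilp_of_graded _ hf2 hd h)
  · exact Or.inr (inj_of_graded _ hf2 hd h)

end Obj
end GelfandRed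

namespace GelfandRed
open Module
variable {k W : Type} [Field k] [AddCommGroup W] [Module k W]

lemma exists_proj (A : Submodule k W) :
    ∃ P : W →ₗ[k] W, (∀ w, P w ∈ A) ∧ ∀ w ∈ A, P w = w := by
  obtain ⟨P, hP⟩ := A.subtype.exists_leftInverse_of_injective A.ker_subtype
  refine ⟨A.subtype ∘ₗ P, fun w => Subtype.coe_prop _, fun w hw => ?_⟩
  exact congrArg Subtype.val (LinearMap.congr_fun hP ⟨w, hw⟩)

lemma exists_sec (φ : W →ₗ[k] W) (A B Z : Submodule k W)
    (h : ∀ z ∈ Z, ∃ a ∈ A, φ a - z ∈ B) :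
    ∃ s : W →ₗ[k] W, (∀ w, s w ∈ A) ∧ ∀ z ∈ Z, φ (s z) - z ∈ B := by
  obtain ⟨P, hP1, hP2⟩ := exists_proj Z
  let ψ : A →ₗ[k] (W ⧸ B) := B.mkQ ∘ₗ φ ∘ₗ A.subtype
  obtain ⟨r, hr⟩ := ψ.rangeRestrict.exists_rightInverse_of_surjective ψ.range_rangeRestrict
  have hm : ∀ w, (B.mkQ ∘ₗ P) w ∈ LinearMap.range ψ := by
    intro w
    obtain ⟨a, ha, hab⟩ := h _ (hP1 w)
    exact ⟨⟨a, ha⟩, (Submodule.Quotient.eq B).2 hab⟩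
  refine ⟨A.subtype ∘ₗ r ∘ₗ (B.mkQ ∘ₗ P).codRestrict _ hm, fun w => Subtype.coe_prop _, ?_⟩
  intro z hz
  rw [← Submodule.Quotient.eq]
  have := congrArg Subtype.val (LinearMap.congr_fun hr ((B.mkQ ∘ₗ P).codRestrict _ hm z))
  simp only [LinearMap.comp_apply, LinearMap.id_apply, LinearMap.codRestrict_apply, hP2 z hz] at this
  exact this

namespace Obj
variable (O : Obj k W)

/-- the operator commuting with e -/
def T (δ : W →ₗ[k] W) : W →ₗ[k] W := O.e ∘ₗ δ - δ + δ ∘ₗ O.e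

lemma T_apply (δ : W →ₗ[k] W) (w : W) : O.T δ w = O.e (δ w) - δ w + δ (O.e w) := rfl

lemma T_comm (δ : W →ₗ[k] W) (w : W) : O.T δ (O.e w) = O.e (O.T δ w) := by
  simp only [T_apply, map_add, map_sub, O.he]
  abel

/-- first refinement freedom -/
lemma free_first {p i : ℕ} (hpi : p ≤ i) (hst : ∀ w ∈ O.F p, O.e w ∈ O.F p)
    {X : Submodule k W} (hX : ∀ w, w ∈ X ↔ w ∈ O.F (p+1) ∧ O.e w ∈ O.F (i+1)) :
    O.Free p X := by
  intro f hf1 hf2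
  obtain ⟨P, hP1, hP2⟩ := exists_proj (O.F (i+1))
  obtain ⟨s, hs1, hs2⟩ := exists_sec O.e (O.F (p+1)) (O.F (i+1))
    (O.F (i+1) ⊔ (O.F (p+1)).map O.e) (by
      intro z hz
      obtain ⟨a, ha, _, ⟨x, hx, rfl⟩, rfl⟩ := Submodule.mem_sup.1 hz
      exact ⟨x, hx, by simpa using ha⟩)
  let δ : W →ₗ[k] W := f ∘ₗ s ∘ₗ (LinearMap.id - P)
  have d1 : ∀ w, δ w ∈ X := fun w => hf1 _ (hs1 _)
  have d2 : ∀ w ∈ O.F (i+1), δ w = 0 := by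
    intro w hw
    simp [δ, hP2 w hw]
  have d3 : ∀ w ∈ O.F (p+1), δ (O.e w) - f w ∈ O.F p := by
    intro w hw
    have hz : O.e w - P (O.e w) ∈ O.F (i+1) ⊔ (O.F (p+1)).map O.e :=
      sub_mem (Submodule.mem_sup_right ⟨w, hw, rfl⟩) (Submodule.mem_sup_left (hP1 _))
    have h1 := sub_mem (hs2 _ hz) (hP1 (O.e w))
    have h2 : s (O.e w - P (O.e w)) - w ∈ X := by
      rw [hX]
      refine ⟨sub_mem (hs1 _) hw, ?_⟩
      convert h1 using 1
      rw [map_sub]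
      abel
    have := hf2 _ h2
    rw [map_sub] at this
    exact this
  have hX1 : X ≤ O.F (p+1) := fun w hw => ((hX w).1 hw).1
  have hp1 : O.F (p+1) ≤ O.F (i+1) := O.mono (by omega)
  refine ⟨O.T δ, O.T_comm δ, ?_, ?_⟩
  · intro m hm w hw
    rw [T_apply]
    rcases lt_trichotomy m p with h | h | h
    · have hw' : w ∈ O.F p := O.mono (by omega) hw
      rw [d2 w (O.mono (by omega) hw'), d2 _ (O.mono (by omega) (hst w hw'))]
      simp
    · exact absurd h hm
    · have hm1 : O.F (p+1) ≤ O.F m := O.mono (by omega)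
      have h1 := hm1 (hX1 (d1 (O.e w)))
      have h2 := hm1 (hX1 (d1 w))
      by_cases hmi : m ≤ i
      · rw [d2 w (O.mono (by omega) hw)]
        simpa using h1
      · exact add_mem (sub_mem (O.mono (by omega) ((hX _).1 (d1 w)).2) h2) h1
  · intro w hw
    rw [T_apply, d2 w (hp1 hw)]
    simpa using d3 w hw

/-- second refinement freedom -/
lemma free_second {p i : ℕ} (hpi : p < i) (hst : ∀ w ∈ O.F p, O.e w ∈ O.F p)
    (ha : ∀ w ∈ O.F (p+1), O.e w ∈ O.F (i+1)) :
    O.Free i (O.F i ⊔ (O.F (p+1)).map O.e) := by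
  intro f hf1 hf2
  set Z := O.F i ⊔ (O.F (p+1)).map O.e with hZ
  have hZ1 : Z ≤ O.F (i+1) := by
    apply sup_le (O.le_succ i)
    rintro _ ⟨w, hw, rfl⟩
    exact ha w hw
  obtain ⟨P, hP1, hP2⟩ := exists_proj (O.F (i+1))
  obtain ⟨Q, hQ1, hQ2⟩ := exists_proj Z
  obtain ⟨s, hs1, hs2⟩ := exists_sec O.e (O.F (p+1)) (O.F i) Z (by
      intro z hz
      obtain ⟨a, ha, _, ⟨x, hx, rfl⟩, rfl⟩ := Submodule.mem_sup.1 hz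
      exact ⟨x, hx, by simpa using ha⟩)
  let δ : W →ₗ[k] W := s ∘ₗ f ∘ₗ (LinearMap.id - Q) ∘ₗ P
  have d1 : ∀ w, δ w ∈ O.F (p+1) := fun w => hs1 _
  have d2 : ∀ w ∈ Z, δ w = 0 := by
    intro w hw
    simp [δ, hP2 w (hZ1 hw), hQ2 w hw]
  have d3 : ∀ w ∈ O.F (i+1), O.e (δ w) - f w ∈ O.F i := by
    intro w hw
    have h0 : w - Q w ∈ O.F (i+1) := sub_mem hw (hZ1 (hQ1 w))
    have h1 := hs2 _ (hf1 _ h0)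
    have h2 := hf2 _ (hQ1 w)
    have := sub_mem h1 h2
    convert this using 1
    simp only [δ, LinearMap.comp_apply, LinearMap.sub_apply, LinearMap.id_apply, hP2 w hw, map_sub]
    abel
  have hp1 : O.F (p+1) ≤ O.F i := O.mono (by omega)
  refine ⟨O.T δ, O.T_comm δ, ?_, ?_⟩
  · intro m hm w hw
    rw [T_apply]
    rcases lt_trichotomy m i with h | h | h
    · have hwi : w ∈ O.F i := O.mono (by omega) hw
      rw [d2 w (Submodule.mem_sup_left hwi)]
      rcases lt_trichotomy m p with h' | h' | h'
      · have hw' : w ∈ O.F p := O.mono (by omega) hw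
        rw [d2 _ (Submodule.mem_sup_left (O.mono (by omega) (hst w hw')))]
        simp
      · subst h'
        rw [d2 _ (Submodule.mem_sup_right ⟨w, hw, rfl⟩)]
        simp
      · simpa using O.mono (show p+1 ≤ m by omega) (d1 (O.e w))
    · exact absurd h hm
    · have hm1 : O.F (p+1) ≤ O.F m := O.mono (by omega)
      exact add_mem (sub_mem (O.mono (by omega) (ha _ (d1 w))) (hm1 (d1 w))) (hm1 (d1 _))
  · intro w hw
    rw [T_apply]
    have := add_mem (sub_mem (d3 w hw) (hp1 (d1 w))) (hp1 (d1 (O.e w)))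
    convert this using 1
    abel

end Obj
end GelfandRed

namespace GelfandRed
open Module
variable {k W : Type} [Field k] [AddCommGroup W] [Module k W]

lemma finrank_inf_ker_add [FiniteDimensional k W] (g : W →ₗ[k] W) (A : Submodule k W) :
    finrank k (A.map g) + finrank k ↥(A ⊓ LinearMap.ker g) = finrank k A := by
  have h := LinearMap.finrank_range_add_finrank_ker (g.domRestrict A)
  rw [← h]
  congr 1
  · rw [LinearMap.range_domRestrict]
  · rw [LinearMap.ker_domRestrict]
    have : (Submodule.comap A.subtype (LinearMap.ker g)).map A.subtype = A ⊓ LinearMap.ker g := by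
      rw [Submodule.map_comap_subtype]
    rw [← this]
    exact (Submodule.equivMapOfInjective A.subtype A.subtype_injective _).finrank_eq.symm

lemma finrank_map_of_inj [FiniteDimensional k W] (g : W →ₗ[k] W) (A : Submodule k W)
    (h : ∀ w ∈ A, g w = 0 → w = 0) : finrank k (A.map g) = finrank k A := by
  have := finrank_inf_ker_add g A
  have h0 : A ⊓ LinearMap.ker g = ⊥ := by
    rw [eq_bot_iff]
    rintro w ⟨hw, hw0⟩
    exact h w hw hw0
  rw [h0, finrank_bot] at this
  simpa using this

namespace Obj
variable (O : Obj k W)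

lemma d_le_of_maps [FiniteDimensional k W] {m n : ℕ} (α β : W →ₗ[k] W)
    (h1 : ∀ w ∈ O.F (m+1), α w ∈ O.F (n+1))
    (h3 : ∀ w ∈ O.F n, β w ∈ O.F m) (h4 : ∀ w ∈ O.F (m+1), β (α w) - w ∈ O.F m) :
    O.d m ≤ O.d n := by
  obtain ⟨P, hP1, hP2⟩ := exists_proj (O.F n)
  have hk : ∀ w, (LinearMap.id - P : W →ₗ[k] W) w = 0 ↔ w ∈ O.F n := by
    intro w
    simp only [LinearMap.sub_apply, LinearMap.id_apply, sub_eq_zero]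
    exact ⟨fun h => h ▸ hP1 w, fun h => (hP2 w h).symm⟩
  have e1 := finrank_inf_ker_add ((LinearMap.id - P) ∘ₗ α) (O.F (m+1))
  have e2 := finrank_inf_ker_add (LinearMap.id - P) (O.F (n+1))
  have i1 : finrank k ↥(O.F (m+1) ⊓ LinearMap.ker ((LinearMap.id - P) ∘ₗ α)) ≤ finrank k (O.F m) := by
    apply Submodule.finrank_mono
    rintro w ⟨hw, hw0⟩
    have : α w ∈ O.F n := (hk _).1 hw0
    have := sub_mem (h3 _ this) (h4 w hw)
    simpa using this
  have i2 : finrank k (O.F n) ≤ finrank k ↥(O.F (n+1) ⊓ LinearMap.ker (LinearMap.id - P)) := by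
    apply Submodule.finrank_mono
    intro w hw
    exact ⟨O.le_succ n hw, (hk w).2 hw⟩
  have i2' : finrank k ↥(O.F (n+1) ⊓ LinearMap.ker (LinearMap.id - P)) ≤ finrank k (O.F n) := by
    apply Submodule.finrank_mono
    rintro w ⟨_, hw⟩
    exact (hk w).1 hw
  have i3 : finrank k ((O.F (m+1)).map ((LinearMap.id - P) ∘ₗ α)) ≤
      finrank k ((O.F (n+1)).map (LinearMap.id - P)) := by
    apply Submodule.finrank_mono
    rintro _ ⟨w, hw, rfl⟩
    exact ⟨α w, h1 w hw, rfl⟩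
  unfold d
  have := Submodule.finrank_mono (O.le_succ m)
  omega

lemma d_σ [FiniteDimensional k W] (m : ℕ) : O.d (O.σ m) = O.d m := by
  have key : ∀ m, O.d m ≤ O.d (O.σ m) := by
    intro m
    apply O.d_le_of_maps (O.θ m) (O.θ (O.σ m)) (O.θmem m) _ (O.θinv m)
    intro w hw
    have := O.θlow _ w hw
    rwa [O.invol] at this
  apply le_antisymm _ (key m)
  have := key (O.σ m)
  rwa [O.invol] at this

lemma sum_d [FiniteDimensional k W] : ∑ m ∈ Finset.range O.N, O.d m = finrank k W := by
  have : ∀ n, ∑ m ∈ Finset.range n, O.d m = finrank k (O.F n) := by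
    intro n
    induction n with
    | zero => rw [O.F0, finrank_bot]; rfl
    | succ n ih =>
      rw [Finset.sum_range_succ, ih]
      unfold d
      have := Submodule.finrank_mono (O.le_succ n)
      omega
  rw [this, O.FN, finrank_top]

lemma u_le [FiniteDimensional k W] : O.u ≤ finrank k W := by
  rw [← O.sum_d]
  apply Finset.sum_le_sum
  intro m _
  split_ifs <;> omega

lemma lt_N_of_ne {m : ℕ} (h : O.F (m+1) ≠ O.F m) : m < O.N := by
  by_contra hc
  have h1 : O.F m = ⊤ := top_le_iff.1 (O.FN ▸ O.mono (not_lt.1 hc))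
  have h2 : O.F (m+1) = ⊤ := top_le_iff.1 (h1 ▸ O.le_succ m)
  exact h (h2.trans h1.symm)

lemma d_eq_zero {m : ℕ} (h : O.F (m+1) = O.F m) : O.d m = 0 := by
  unfold d; rw [h]; omega

lemma d_pos [FiniteDimensional k W] {m : ℕ} (h : O.F (m+1) ≠ O.F m) : 0 < O.d m := by
  have := Submodule.finrank_lt_finrank_of_lt (lt_of_le_of_ne (O.le_succ m) (Ne.symm h))
  unfold d
  omega

/-- Data for deletion -/
structure Del (p i : ℕ) where
  X0 : Submodule k W
  δ : W →ₗ[k] W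
  hpi : p < i
  hst : ∀ w ∈ O.F p, O.e w ∈ O.F p
  ha : ∀ w ∈ O.F (p+1), O.e w ∈ O.F (i+1)
  ne : O.F (p+1) ≠ O.F p
  X0le : ∀ w ∈ X0, w ∈ O.F (p+1)
  X0z : ∀ w ∈ X0, w ∈ O.F p → w = 0
  D1 : ∀ w, δ w ∈ X0
  D2 : ∀ w ∈ O.F i, δ w = 0
  D3 : ∀ x ∈ X0, δ (O.e x) = x
  D4 : ∀ w ∈ O.F (i+1), O.e (δ w) - w ∈ O.F i
  D5 : ∀ w ∈ O.F (p+1), δ (O.e w) - w ∈ O.F p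

lemma exists_del {p i : ℕ} (hpi : p < i) (hst : ∀ w ∈ O.F p, O.e w ∈ O.F p)
    (ha : ∀ w ∈ O.F (p+1), O.e w ∈ O.F (i+1)) (hb : ∀ w ∈ O.F (p+1), O.e w ∈ O.F i → w ∈ O.F p)
    (hc : O.F (i+1) ≤ O.F i ⊔ (O.F (p+1)).map O.e) (ne : O.F (p+1) ≠ O.F p) :
    Nonempty (O.Del p i) := by
  obtain ⟨R, hR1, hR2⟩ := exists_proj (O.F p)
  let X0 : Submodule k W := O.F (p+1) ⊓ LinearMap.ker R
  have hX0 : ∀ w ∈ O.F (p+1), w - R w ∈ X0 := by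
    intro w hw
    refine ⟨sub_mem hw (O.le_succ p (hR1 w)), ?_⟩
    show R (w - R w) = 0
    rw [map_sub, hR2 _ (hR1 w), sub_self]
  have hX0z : ∀ w ∈ X0, w ∈ O.F p → w = 0 := by
    intro w hw hw'
    rw [← hR2 w hw']
    exact hw.2
  have hpi' : O.F p ≤ O.F i := O.mono hpi.le
  obtain ⟨s, hs1, hs2⟩ := exists_sec O.e X0 (O.F i) (O.F (i+1)) (by
    intro z hz
    obtain ⟨a, ha', _, ⟨x, hx, rfl⟩, rfl⟩ := Submodule.mem_sup.1 (hc hz)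
    refine ⟨x - R x, hX0 x hx, ?_⟩
    have := neg_mem (add_mem ha' (hpi' (hst _ (hR1 x))))
    convert this using 1
    rw [map_sub]
    abel)
  have D3 : ∀ x ∈ X0, s (O.e x) = x := by
    intro x hx
    have h1 := hs2 _ (ha x hx.1)
    rw [← map_sub] at h1
    exact sub_eq_zero.1 (hX0z _ (sub_mem (hs1 _) hx) (hb _ (sub_mem (hs1 _).1 hx.1) h1))
  have D2 : ∀ w ∈ O.F i, s w = 0 := by
    intro w hw
    apply hX0z _ (hs1 w)
    apply hb _ (hs1 w).1
    have := add_mem (hs2 w (O.le_succ i hw)) hw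
    simpa using this
  refine ⟨⟨X0, s, hpi, hst, ha, ne, fun w hw => hw.1, hX0z, hs1, D2, D3, hs2, ?_⟩⟩
  intro w hw
  have h1 := D3 _ (hX0 w hw)
  rw [map_sub, map_sub, D2 _ (hpi' (hst _ (hR1 w))), sub_zero] at h1
  rw [h1]
  simpa using hR1 w

namespace Del
variable {O}
variable {p i : ℕ} (D : O.Del p i)

lemma δX0 {x : W} (hx : x ∈ D.X0) : D.δ x = 0 :=
  D.D2 _ (O.mono (show p+1 ≤ i from D.hpi) (D.X0le x hx))

/-- graded behaviour of T δ' for δ' = h δ -/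
lemma T_low {δ' : W →ₗ[k] W} (h1 : ∀ w, δ' w ∈ D.X0) (h2 : ∀ w ∈ O.F i, δ' w = 0) {m : ℕ}
    (hp : m ≠ p) (hi : m ≠ i) : ∀ w ∈ O.F (m+1), O.T δ' w ∈ O.F m := by
  intro w hw
  have hpi := D.hpi
  rw [T_apply]
  rcases lt_or_gt_of_ne hp with h | h
  · have hw' : w ∈ O.F p := O.mono (by omega) hw
    have : O.F p ≤ O.F i := O.mono (by omega)
    rw [h2 w (this hw'), h2 _ (this (D.hst w hw'))]
    simp
  have hm1 : O.F (p+1) ≤ O.F m := O.mono (by omega)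
  have a1 := hm1 (D.X0le _ (h1 (O.e w)))
  have a2 := hm1 (D.X0le _ (h1 w))
  rcases lt_or_gt_of_ne hi with h' | h'
  · rw [h2 w (O.mono (by omega) hw)]
    simpa using a1
  · exact add_mem (sub_mem (O.mono (by omega) (D.ha _ (D.X0le _ (h1 w)))) a2) a1

lemma T_p (D : O.Del p i) {δ' : W →ₗ[k] W} (h2 : ∀ w ∈ O.F i, δ' w = 0) :
    ∀ w ∈ O.F (p+1), O.T δ' w = δ' (O.e w) := by
  intro w hw
  rw [T_apply, h2 w (O.mono (show p+1 ≤ i from D.hpi) hw)]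
  simp

lemma T_i {δ' : W →ₗ[k] W} (h1 : ∀ w, δ' w ∈ D.X0) :
    ∀ w, O.T δ' w - O.e (δ' w) ∈ O.F i := by
  intro w
  have hm1 : O.F (p+1) ≤ O.F i := O.mono (show p+1 ≤ i from D.hpi)
  have := sub_mem (hm1 (D.X0le _ (h1 (O.e w)))) (hm1 (D.X0le _ (h1 w)))
  convert this using 1
  rw [T_apply]
  abel

lemma T_filt {δ' : W →ₗ[k] W} (h1 : ∀ w, δ' w ∈ D.X0) (h2 : ∀ w ∈ O.F i, δ' w = 0) :
    ∀ m w, w ∈ O.F m → O.T δ' w ∈ O.F m := by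
  intro m w hw
  cases m with
  | zero =>
    rw [O.F0] at hw ⊢
    simp only [Submodule.mem_bot] at hw ⊢
    simp [hw]
  | succ m =>
    by_cases hp : m = p
    · subst hp
      rw [D.T_p h2 w hw]
      exact D.X0le _ (h1 _)
    by_cases hi : m = i
    · subst hi
      have := add_mem (O.le_succ _ (D.T_i h1 w)) (D.ha _ (D.X0le _ (h1 w)))
      simpa using this
    · exact O.le_succ m (D.T_low h1 h2 hp hi w hw)

/-- the projection onto `X0 ⊕ e X0` -/
def p0 : W →ₗ[k] W := O.T D.δ

lemma p0_apply (w : W) : D.p0 w = O.e (D.δ w) - D.δ w + D.δ (O.e w) := rfl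

lemma p0_comm (w : W) : D.p0 (O.e w) = O.e (D.p0 w) := O.T_comm _ w

lemma p0_X0 {x : W} (hx : x ∈ D.X0) : D.p0 x = x := by
  rw [p0_apply, D.δX0 hx, D.D3 x hx]; simp

lemma p0_p0 (w : W) : D.p0 (D.p0 w) = D.p0 w := by
  conv_lhs => rw [p0_apply D w]
  rw [map_add, map_sub, p0_comm, D.p0_X0 (D.D1 w), D.p0_X0 (D.D1 _)]
  rfl

lemma p0_low {m : ℕ} (hp : m ≠ p) (hi : m ≠ i) : ∀ w ∈ O.F (m+1), D.p0 w ∈ O.F m :=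
  D.T_low D.D1 D.D2 hp hi

lemma p0_p : ∀ w ∈ O.F (p+1), D.p0 w - w ∈ O.F p := by
  intro w hw
  rw [p0, D.T_p D.D2 w hw]
  exact D.D5 w hw

lemma p0_i : ∀ w ∈ O.F (i+1), D.p0 w - w ∈ O.F i := by
  intro w hw
  have := add_mem (D.T_i D.D1 w) (D.D4 w hw)
  simpa [p0] using this

lemma p0_filt : ∀ m w, w ∈ O.F m → D.p0 w ∈ O.F m := D.T_filt D.D1 D.D2

lemma exists_X0 : ∃ x ∈ D.X0, x ≠ 0 := by
  by_contra hc
  push Not at hc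
  apply D.ne
  apply le_antisymm _ (O.le_succ p)
  intro w hw
  have := D.D5 w hw
  rw [hc _ (D.D1 _)] at this
  simpa using this

lemma δ_of_ker {w : W} (h : D.p0 w = 0) : D.δ w = 0 := by
  have := congrArg D.δ h
  rw [p0_apply, map_add, map_sub, D.D3 _ (D.D1 w), D.δX0 (D.D1 w), D.δX0 (D.D1 _)] at this
  simpa using this

lemma T_ker (h : W →ₗ[k] W) {w : W} (hw : D.p0 w = 0) : O.T (h ∘ₗ D.δ) w = 0 := by
  have h2 : D.p0 (O.e w) = 0 := by rw [p0_comm, hw, map_zero]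
  rw [T_apply]
  simp [D.δ_of_ker hw, D.δ_of_ker h2]

lemma rank_e [FiniteDimensional k W] : finrank k (LinearMap.range O.e) =
    finrank k D.X0 + finrank k ↥(LinearMap.range O.e ⊓ LinearMap.ker D.p0) := by
  rw [← finrank_inf_ker_add D.p0 (LinearMap.range O.e)]
  congr 1
  rw [← finrank_map_of_inj O.e D.X0]
  · apply congrArg (fun S : Submodule k W => finrank k S)
    apply le_antisymm
    · rintro _ ⟨_, ⟨w, rfl⟩, rfl⟩
      refine ⟨D.δ (O.e w), D.D1 _, ?_⟩
      rw [p0_comm, p0_apply]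
      simp only [map_add, map_sub, O.he]
      simp
    · rintro _ ⟨x, hx, rfl⟩
      exact ⟨O.e x, ⟨x, rfl⟩, by rw [p0_comm, D.p0_X0 hx]⟩
  · intro x hx h
    rw [← D.D3 x hx, h, map_zero]

lemma null_e [FiniteDimensional k W] : finrank k (LinearMap.ker O.e) =
    finrank k D.X0 + finrank k ↥(LinearMap.ker O.e ⊓ LinearMap.ker D.p0) := by
  rw [← finrank_inf_ker_add D.p0 (LinearMap.ker O.e)]
  congr 1
  rw [← finrank_map_of_inj (LinearMap.id - O.e) D.X0]
  · apply congrArg (fun S : Submodule k W => finrank k S)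
    apply le_antisymm
    · rintro _ ⟨w, hw, rfl⟩
      have hw : O.e w = 0 := hw
      refine ⟨-D.δ w, neg_mem (D.D1 _), ?_⟩
      rw [p0_apply, hw]
      simp
      abel
    · rintro _ ⟨x, hx, rfl⟩
      refine ⟨x - O.e x, ?_, ?_⟩
      · show O.e (x - O.e x) = 0
        rw [map_sub, O.he, sub_self]
      · rw [map_sub, p0_comm, D.p0_X0 hx]; rfl
  · intro x hx h
    have h : x - O.e x = 0 := h
    have := congrArg D.δ h
    rw [map_sub, D.D3 x hx, D.δX0 hx] at this
    simpa using this

lemma d_p_eq (D : O.Del p i) [FiniteDimensional k W] : O.d p = O.d i := by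
  apply le_antisymm
  · apply O.d_le_of_maps O.e D.δ D.ha _ D.D5
    intro w hw; rw [D.D2 w hw]; exact zero_mem _
  · apply O.d_le_of_maps D.δ O.e (fun w _ => D.X0le _ (D.D1 w)) _ D.D4
    intro w hw
    exact O.mono D.hpi.le (D.hst w hw)

/-- the conclusions when `p0` is an endomorphism -/
lemma whole [FiniteDimensional k W] (hloc : O.Loc) (hE : O.IsEndo D.p0) :
    (∀ m, m ≠ p → m ≠ i → O.F (m+1) = O.F m) ∧
    finrank k (LinearMap.range O.e) = finrank k (LinearMap.ker O.e) := by
  have hinj : Function.Injective D.p0 := by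
    rcases hloc _ hE with ⟨n, hn⟩ | h
    · exfalso
      obtain ⟨x, hx, hx0⟩ := D.exists_X0
      apply hx0
      have : ∀ n : ℕ, (D.p0 ^ n) x = x := by
        intro n
        induction n with
        | zero => rfl
        | succ n ih => rw [pow_succ, Module.End.mul_apply, D.p0_X0 hx, ih]
      rw [← this n, hn]; rfl
    · exact h
  refine ⟨fun m hp hi => O.triv_of_lower hinj (D.p0_low hp hi), ?_⟩
  rw [D.rank_e, D.null_e, LinearMap.ker_eq_bot.2 hinj, inf_bot_eq, inf_bot_eq]

lemma caseA (D : O.Del p i) [FiniteDimensional k W] (hloc : O.Loc) (hσ : O.σ p = i) :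
    (O.u : ℤ) + |(finrank k (LinearMap.range O.e) : ℤ) - finrank k (LinearMap.ker O.e)| ≤ 2 := by
  have hσi : O.σ i = p := by rw [← hσ, O.invol]
  have hpi := D.hpi
  have hE : O.IsEndo D.p0 := by
    refine ⟨D.p0_comm, D.p0_filt, ?_⟩
    intro m hm
    by_cases hp : m = p
    · subst hp
      apply O.compat_one D.p0_p
      rw [hσ]; exact D.p0_i
    by_cases hi : m = i
    · subst hi
      apply O.compat_one D.p0_i
      rw [hσi]; exact D.p0_p
    · apply O.compat_zero (D.p0_low hp hi)
      apply D.p0_low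
      · intro h; apply hi; rw [← hσ, ← h, O.invol]
      · intro h; apply hp; rw [← hσi, ← h, O.invol]
  obtain ⟨h1, h2⟩ := D.whole hloc hE
  have hu : O.u = 0 := by
    unfold u
    apply Finset.sum_eq_zero
    intro m _
    split_ifs with hm
    · exact O.d_eq_zero (h1 m (by rintro rfl; omega) (by rintro rfl; omega))
    · rfl
  rw [hu, h2]
  simp

lemma caseB (D : O.Del p i) [FiniteDimensional k W] (hloc : O.Loc) (hσ : O.σ p = p) (hσi : O.σ i = i) :
    (O.u : ℤ) + |(finrank k (LinearMap.range O.e) : ℤ) - finrank k (LinearMap.ker O.e)| ≤ 2 := by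
  have hE : ∀ {δ' : W →ₗ[k] W}, (∀ w, δ' w ∈ D.X0) → (∀ w ∈ O.F i, δ' w = 0) →
      O.IsEndo (O.T δ') := by
    intro δ' h1 h2
    refine ⟨O.T_comm _, D.T_filt h1 h2, ?_⟩
    intro m hm
    have hp : m ≠ p := by rintro rfl; exact hm hσ
    have hi : m ≠ i := by rintro rfl; exact hm hσi
    apply O.compat_zero (D.T_low h1 h2 hp hi)
    apply D.T_low h1 h2
    · intro h; apply hp; rw [← hσ, ← h, O.invol]
    · intro h; apply hi; rw [← hσi, ← h, O.invol]
  obtain ⟨h1, h2⟩ := D.whole hloc (hE D.D1 D.D2)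
  obtain ⟨x, hx, hx0⟩ := D.exists_X0
  obtain ⟨l, hl⟩ := Module.Projective.exists_dual_ne_zero k hx0
  let δ' : W →ₗ[k] W := (((l x)⁻¹ • l).smulRight x) ∘ₗ D.δ
  have d1 : ∀ w, δ' w ∈ D.X0 := fun w => D.X0.smul_mem _ hx
  have d2 : ∀ w ∈ O.F i, δ' w = 0 := fun w hw => by simp [δ', D.D2 w hw]
  have hgx : O.T δ' x = x := by
    rw [D.T_p d2 _ (D.X0le _ hx)]
    simp [δ', D.D3 x hx, hl]
  have hinj : Function.Injective (O.T δ') := by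
    rcases hloc _ (hE d1 d2) with ⟨n, hn⟩ | h
    · exfalso
      apply hx0
      have : ∀ n : ℕ, ((O.T δ') ^ n) x = x := by
        intro n
        induction n with
        | zero => rfl
        | succ n ih => rw [pow_succ, Module.End.mul_apply, hgx, ih]
      rw [← this n, hn]; rfl
    · exact h
  have hr : LinearMap.range (O.T δ') ≤ Submodule.span k (Set.range ![x, O.e x]) := by
    rintro _ ⟨w, rfl⟩
    have hs : ∀ w, δ' w ∈ Submodule.span k (Set.range ![x, O.e x]) := fun w =>
      Submodule.smul_mem _ _ (Submodule.subset_span ⟨0, rfl⟩)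
    have hs' : ∀ w, O.e (δ' w) ∈ Submodule.span k (Set.range ![x, O.e x]) := fun w => by
      simp only [δ', LinearMap.comp_apply, LinearMap.smulRight_apply, map_smul]
      exact Submodule.smul_mem _ _ (Submodule.subset_span ⟨1, rfl⟩)
    exact add_mem (sub_mem (hs' w) (hs w)) (hs _)
  have h3 := (LinearMap.finrank_range_of_inj hinj).symm
  have h4 := Submodule.finrank_mono hr
  have h5 : finrank k (Submodule.span k (Set.range ![x, O.e x])) ≤ 2 := by
    exact finrank_range_le_card (R := k) (![x, O.e x])
  have h6 := O.u_le
  rw [h2]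
  simp
  omega

end Del
end Obj
end GelfandRed

namespace GelfandRed
open Module
variable {k W : Type} [Field k] [AddCommGroup W] [Module k W]

/-- the new matching after deletion -/
def delσ (σ : ℕ → ℕ) (p i m : ℕ) : ℕ :=
  if m = p ∨ m = i then m
  else if σ m = p then (if σ i = i then m else σ i)
  else if σ m = i then (if σ p = p then m else σ p)
  else σ m

lemma delσ_invol {σ : ℕ → ℕ} {p i : ℕ} (inv : ∀ m, σ (σ m) = m) (h1 : σ p ≠ i) (hpi : p ≠ i)
    (m : ℕ) : delσ σ p i (delσ σ p i m) = m := by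
  have a1 := inv p
  have a2 := inv i
  have a3 := inv m
  unfold delσ
  grind

lemma delσ_cases {σ : ℕ → ℕ} {p i : ℕ} (inv : ∀ m, σ (σ m) = m) (h1 : σ p ≠ i) (hpi : p ≠ i)
    {m : ℕ} (hm : delσ σ p i m ≠ m) : m ≠ p ∧ m ≠ i ∧
    ((m = σ p ∧ m ≠ σ i ∧ σ p ≠ p ∧ σ i ≠ i ∧ delσ σ p i m = σ i) ∨
     (m = σ i ∧ m ≠ σ p ∧ σ p ≠ p ∧ σ i ≠ i ∧ delσ σ p i m = σ p) ∨
     (m ≠ σ p ∧ m ≠ σ i ∧ σ m ≠ p ∧ σ m ≠ i ∧ σ m ≠ m ∧ delσ σ p i m = σ m)) := by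
  have a1 := inv p
  have a2 := inv i
  have a3 := inv m
  unfold delσ at *
  grind (splits := 30)

namespace Obj
variable {O : Obj k W}
namespace Del
variable {p i : ℕ} (D : O.Del p i)

/-- projection on the kernel of `p0` -/
def q0 : W →ₗ[k] ↥(LinearMap.ker D.p0) :=
  LinearMap.codRestrict _ (LinearMap.id - D.p0) (fun w => by
    show D.p0 (w - D.p0 w) = 0
    rw [map_sub, D.p0_p0, sub_self])

lemma q0_coe (w : W) : (D.q0 w : W) = w - D.p0 w := rfl

lemma q0_ker (w : ↥(LinearMap.ker D.p0)) : D.q0 (w : W) = w := by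
  apply Subtype.ext
  have : D.p0 w = 0 := w.2
  rw [q0_coe, this, sub_zero]

lemma q0_filt {m : ℕ} {w : W} (hw : w ∈ O.F m) : (D.q0 w : W) ∈ O.F m :=
  sub_mem hw (D.p0_filt m w hw)

lemma q0_low {m : ℕ} (hp : m ≠ p) (hi : m ≠ i) {w : W} (hw : w ∈ O.F (m+1)) :
    (D.q0 w : W) - w ∈ O.F m := by
  have := neg_mem (D.p0_low hp hi w hw)
  convert this using 1
  rw [q0_coe]; abel

lemma q0_p {w : W} (hw : w ∈ O.F (p+1)) : (D.q0 w : W) ∈ O.F p := by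
  have := neg_mem (D.p0_p w hw)
  convert this using 1
  rw [q0_coe]; abel

lemma q0_i {w : W} (hw : w ∈ O.F (i+1)) : (D.q0 w : W) ∈ O.F i := by
  have := neg_mem (D.p0_i w hw)
  convert this using 1
  rw [q0_coe]; abel

lemma q0_comm (w : W) : (D.q0 (O.e w) : W) = O.e (D.q0 w) := by
  rw [q0_coe, q0_coe, p0_comm, map_sub]

/-- maps before projecting -/
def Θ (m : ℕ) : W →ₗ[k] W :=
  if delσ O.σ p i m = m then LinearMap.id
  else if m = O.σ p then O.θ i ∘ₗ O.e ∘ₗ O.θ m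
  else if m = O.σ i then O.θ p ∘ₗ D.δ ∘ₗ O.θ m
  else O.θ m

lemma Θ_fix {m : ℕ} (h : delσ O.σ p i m = m) : D.Θ m = LinearMap.id := if_pos h

lemma θκ {m : ℕ} (h : O.σ m = p) {w : W} (hw : w ∈ O.F (m+1)) : O.θ m w ∈ O.F (p+1) := by
  have := O.θmem _ w hw; rwa [h] at this
lemma θκ' {m : ℕ} (h : O.σ m = p) {w : W} (hw : w ∈ O.F m) : O.θ m w ∈ O.F p := by
  have := O.θlow _ w hw; rwa [h] at this
lemma θinv' {m n : ℕ} (h : O.σ m = n) {w : W} (hw : w ∈ O.F (m+1)) :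
    O.θ n (O.θ m w) - w ∈ O.F m := by
  have := O.θinv _ w hw; rwa [h] at this

/-- Chain of congruences used several times. -/
lemma chain_κ (hκ : O.σ (O.σ p) = p) (hι : O.σ (O.σ i) = i) (hi1 : O.σ i ≠ i) (hi2 : O.σ i ≠ p)
    {w : W} (hw : w ∈ O.F (O.σ p + 1)) :
    O.θ p (D.δ (O.θ (O.σ i) (D.q0 (O.θ i (O.e (O.θ (O.σ p) w)))))) - w ∈ O.F (O.σ p) := by
  have a1 := θκ hκ hw
  have a2 := D.ha _ a1
  have a3 := θκ (O := O) (m := i) rfl a2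
  have b1 := θκ' hι (D.q0_low hi2 hi1 a3)
  have b2 := θinv' (O := O) (m := i) rfl a2
  have b3 := D.D2 _ (add_mem b1 b2)
  have b4 : D.δ (O.θ (O.σ i) (D.q0 (O.θ i (O.e (O.θ (O.σ p) w))))) = D.δ (O.e (O.θ (O.σ p) w)) := by
    rw [← sub_eq_zero, ← map_sub, ← b3]
    congr 1
    rw [map_sub]; abel
  rw [b4]
  have c1 := θκ' (O := O) (m := p) rfl (D.D5 _ a1)
  have c2 := θinv' hκ hw
  have := add_mem c1 c2
  convert this using 1
  rw [map_sub]; abel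

lemma chain_ι (hκ : O.σ (O.σ p) = p) (hι : O.σ (O.σ i) = i) (hi1 : O.σ p ≠ i) (hi2 : O.σ p ≠ p)
    {w : W} (hw : w ∈ O.F (O.σ i + 1)) :
    O.θ i (O.e (O.θ (O.σ p) (D.q0 (O.θ p (D.δ (O.θ (O.σ i) w)))))) - w ∈ O.F (O.σ i) := by
  have a1 := θκ hι hw
  have a2 : D.δ (O.θ (O.σ i) w) ∈ O.F (p+1) := D.X0le _ (D.D1 _)
  have a3 := θκ (O := O) (m := p) rfl a2
  have b1 := θκ' hκ (D.q0_low hi2 hi1 a3)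
  have b2 := θinv' (O := O) (m := p) rfl a2
  have b3 := O.mono D.hpi.le (D.hst _ (add_mem b1 b2))
  have b4 := θκ' (O := O) (m := i) rfl (add_mem b3 (D.D4 _ a1))
  have c2 := θinv' hι hw
  have := add_mem b4 c2
  convert this using 1
  simp only [map_sub, map_add]; abel

lemma Θmem (h1 : O.σ p ≠ i) (m : ℕ) (w : W) (hw : w ∈ O.F (m+1)) :
    D.Θ m w ∈ O.F (delσ O.σ p i m + 1) := by
  by_cases hm : delσ O.σ p i m = m
  · rw [D.Θ_fix hm, hm]; exact hw
  obtain ⟨hp, hi, ⟨h2, h3, h4, h5, h6⟩ | ⟨h2, h3, h4, h5, h6⟩ | ⟨h2, h3, h4, h5, h6, h7⟩⟩ :=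
    delσ_cases O.invol h1 D.hpi.ne hm
  · rw [h6, Θ, if_neg hm, if_pos h2]
    rw [h2] at hw ⊢
    exact θκ rfl (D.ha _ (θκ (O.invol p) hw))
  · rw [h6, Θ, if_neg hm, if_neg h3, if_pos h2]
    exact θκ rfl (D.X0le _ (D.D1 _))
  · rw [h7, Θ, if_neg hm, if_neg h2, if_neg h3]
    exact O.θmem m w hw

lemma Θlow (h1 : O.σ p ≠ i) (m : ℕ) (w : W) (hw : w ∈ O.F m) :
    D.Θ m w ∈ O.F (delσ O.σ p i m) := by
  by_cases hm : delσ O.σ p i m = m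
  · rw [D.Θ_fix hm, hm]; exact hw
  obtain ⟨hp, hi, ⟨h2, h3, h4, h5, h6⟩ | ⟨h2, h3, h4, h5, h6⟩ | ⟨h2, h3, h4, h5, h6, h7⟩⟩ :=
    delσ_cases O.invol h1 D.hpi.ne hm
  · rw [h6, Θ, if_neg hm, if_pos h2]
    rw [h2] at hw ⊢
    exact θκ' rfl (O.mono D.hpi.le (D.hst _ (θκ' (O.invol p) hw)))
  · rw [h6, Θ, if_neg hm, if_neg h3, if_pos h2]
    rw [h2] at hw ⊢
    simp only [LinearMap.comp_apply]
    rw [D.D2 _ (θκ' (O.invol i) hw)]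
    simp
  · rw [h7, Θ, if_neg hm, if_neg h2, if_neg h3]
    exact O.θlow m w hw

lemma Θinv (h1 : O.σ p ≠ i) (m : ℕ) (w : W) (hw : w ∈ O.F (m+1)) (hm : delσ O.σ p i m ≠ m) :
    D.Θ (delσ O.σ p i m) (D.q0 (D.Θ m w)) - w ∈ O.F m := by
  have hm2 : delσ O.σ p i (delσ O.σ p i m) ≠ delσ O.σ p i m := by
    rw [delσ_invol O.invol h1 D.hpi.ne]; exact hm.symm
  have hi2 : O.σ i ≠ p := by intro h; apply h1; rw [← h, O.invol]
  have hne : O.σ i ≠ O.σ p := by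
    intro h; have := congrArg O.σ h; rw [O.invol, O.invol] at this; exact D.hpi.ne this.symm
  obtain ⟨hp, hi, ⟨h2, h3, h4, h5, h6⟩ | ⟨h2, h3, h4, h5, h6⟩ | ⟨h2, h3, h4, h5, h6, h7⟩⟩ :=
    delσ_cases O.invol h1 D.hpi.ne hm
  · rw [h6] at hm2 ⊢
    rw [Θ, Θ, if_neg hm, if_neg hm2, if_pos h2, if_neg hne, if_pos rfl]
    rw [h2] at hw ⊢
    exact D.chain_κ (O.invol p) (O.invol i) h5 hi2 hw
  · rw [h6] at hm2 ⊢
    rw [Θ, Θ, if_neg hm, if_neg hm2, if_pos rfl, if_neg h3, if_pos h2]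
    rw [h2] at hw ⊢
    exact D.chain_ι (O.invol p) (O.invol i) h1 h4 hw
  · rw [h7] at hm2 ⊢
    have g1 : O.σ m ≠ O.σ p := by
      intro h; have := congrArg O.σ h; rw [O.invol, O.invol] at this; exact hp this
    have g2 : O.σ m ≠ O.σ i := by
      intro h; have := congrArg O.σ h; rw [O.invol, O.invol] at this; exact hi this
    rw [Θ, Θ, if_neg hm, if_neg hm2, if_neg g1, if_neg g2, if_neg h2, if_neg h3]
    have a1 := θκ (O := O) (m := m) rfl hw
    have a2 := θκ' (O.invol m) (D.q0_low h4 h5 a1)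
    have := add_mem a2 (O.θinv m w hw)
    convert this using 1
    rw [map_sub]; abel

/-- the object after deletion -/
def obj (h1 : O.σ p ≠ i) : Obj k ↥(LinearMap.ker D.p0) where
  e := D.q0 ∘ₗ O.e ∘ₗ Submodule.subtype _
  F := fun m => (O.F m).comap (Submodule.subtype _)
  N := O.N
  σ := delσ O.σ p i
  θ := fun m => D.q0 ∘ₗ D.Θ m ∘ₗ Submodule.subtype _
  he := by
    intro w
    apply Subtype.ext
    simp only [LinearMap.comp_apply, Submodule.subtype_apply, D.q0_comm, O.he, D.q0_ker]
  mono := fun a b hab w hw => O.mono hab hw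
  F0 := by
    rw [O.F0, eq_bot_iff]
    intro w hw
    simpa using hw
  FN := by rw [O.FN]; rfl
  invol := delσ_invol O.invol h1 D.hpi.ne
  θmem := fun m w hw => D.q0_filt (D.Θmem h1 m w hw)
  θlow := fun m w hw => D.q0_filt (D.Θlow h1 m w hw)
  θinv := by
    intro m w hw
    by_cases hm : delσ O.σ p i m = m
    · rw [hm, D.Θ_fix hm]
      simp [D.q0_ker]
    · have := D.q0_filt (D.Θinv h1 m w hw hm)
      rw [map_sub, D.q0_ker] at this
      exact this
  θfix := by
    intro m hm
    rw [D.Θ_fix hm]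
    ext w
    simp [D.q0_ker]

lemma obj_e (h1 : O.σ p ≠ i) (w) : ((D.obj h1).e w : W) = O.e (w : W) := by
  show (D.q0 (O.e w) : W) = _
  rw [D.q0_comm, D.q0_ker]

lemma obj_θ (h1 : O.σ p ≠ i) (m w) : (D.obj h1).θ m w = D.q0 (D.Θ m w) := rfl

lemma obj_finrank_F (h1 : O.σ p ≠ i) [FiniteDimensional k W] (m : ℕ) :
    finrank k ((D.obj h1).F m) + finrank k ((O.F m).map D.p0) = finrank k (O.F m) := by
  rw [← finrank_inf_ker_add D.p0 (O.F m), add_comm]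
  congr 1
  have : ((O.F m).comap (Submodule.subtype (LinearMap.ker D.p0))).map
      (Submodule.subtype (LinearMap.ker D.p0)) = O.F m ⊓ LinearMap.ker D.p0 := by
    rw [Submodule.map_comap_subtype, inf_comm]
  rw [← this]
  exact (Submodule.equivMapOfInjective _ (Submodule.subtype_injective _) _).finrank_eq

lemma obj_d (h1 : O.σ p ≠ i) [FiniteDimensional k W] {m : ℕ} (hp : m ≠ p) (hi : m ≠ i) :
    (D.obj h1).d m = O.d m := by
  have a1 := D.obj_finrank_F h1 m
  have a2 := D.obj_finrank_F h1 (m+1)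
  have a3 : (O.F (m+1)).map D.p0 = (O.F m).map D.p0 := by
    apply le_antisymm
    · rintro _ ⟨w, hw, rfl⟩
      exact ⟨D.p0 w, D.p0_low hp hi w hw, D.p0_p0 w⟩
    · exact Submodule.map_mono (O.le_succ m)
  rw [a3] at a2
  unfold d
  omega

lemma obj_d_p (h1 : O.σ p ≠ i) : (D.obj h1).d p = 0 := by
  apply d_eq_zero
  apply le_antisymm _ ((D.obj h1).le_succ p)
  intro w hw
  have := D.q0_p hw
  rw [Submodule.subtype_apply, D.q0_ker] at this
  exact this

lemma obj_d_i (h1 : O.σ p ≠ i) : (D.obj h1).d i = 0 := by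
  apply d_eq_zero
  apply le_antisymm _ ((D.obj h1).le_succ i)
  intro w hw
  have := D.q0_i hw
  rw [Submodule.subtype_apply, D.q0_ker] at this
  exact this

lemma obj_μ (h1 : O.σ p ≠ i) [FiniteDimensional k W] : (D.obj h1).μ < O.μ := by
  unfold μ
  apply Finset.sum_lt_sum
  · intro m _
    by_cases hp : m = p
    · rw [hp, D.obj_d_p]; simp
    by_cases hi : m = i
    · rw [hi, D.obj_d_i]; simp
    rw [D.obj_d h1 hp hi]
  · refine ⟨p, Finset.mem_range.2 (O.lt_N_of_ne D.ne), ?_⟩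
    rw [D.obj_d_p]
    have := O.d_pos D.ne
    positivity

lemma sum_swap {a b n : ℕ} (ha : a < n) (hb : b < n) (f g : ℕ → ℕ) (h1 : f a = g b)
    (h2 : f b = g a) (h : ∀ m, m ≠ a → m ≠ b → f m = g m) :
    ∑ m ∈ Finset.range n, f m = ∑ m ∈ Finset.range n, g m := by
  apply Finset.sum_equiv (Equiv.swap a b)
  · intro m
    simp only [Finset.mem_range, Equiv.swap_apply_def]
    split_ifs <;> omega
  · intro m _
    rw [Equiv.swap_apply_def]
    split_ifs with h3 h4
    · rw [h3, h1]
    · rw [h4, h2]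
    · exact h m h3 h4

lemma obj_u (h1 : O.σ p ≠ i) (h2 : ¬ (O.σ p = p ∧ O.σ i = i)) [FiniteDimensional k W] :
    (D.obj h1).u = O.u := by
  have hpi := D.hpi.ne
  have i1 := O.invol p
  have i2 := O.invol i
  have hdpi := D.d_p_eq
  have hdp := O.d_pos D.ne
  have hN : ∀ m, 0 < O.d m → m < O.N := by
    intro m hm
    apply O.lt_N_of_ne
    intro h
    rw [O.d_eq_zero h] at hm
    omega
  have e1 := O.d_σ p
  have e2 := O.d_σ i
  have op := D.obj_d_p h1
  have oi := D.obj_d_i h1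
  show ∑ m ∈ Finset.range O.N, (if delσ O.σ p i m = m then (D.obj h1).d m else 0) =
    ∑ m ∈ Finset.range O.N, (if O.σ m = m then O.d m else 0)
  have same : ∀ m, m ≠ p → m ≠ i → m ≠ O.σ p → m ≠ O.σ i → 
      (if delσ O.σ p i m = m then (D.obj h1).d m else 0) = (if O.σ m = m then O.d m else 0) := by
    intro m hp hi hp' hi'
    rw [D.obj_d h1 hp hi]
    have i3 := O.invol m
    have : delσ O.σ p i m = O.σ m := by unfold delσ; grind
    rw [this]
  by_cases hp : O.σ p = p
  · have hi : O.σ i ≠ i := fun h => h2 ⟨hp, h⟩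
    have od := D.obj_d h1 (m := O.σ i) (by grind) hi
    apply sum_swap (a := p) (b := O.σ i) (hN _ hdp) (hN _ (by omega))
    · simp [op, i2, hi.symm]
    · have : delσ O.σ p i (O.σ i) = O.σ i := by unfold delσ; grind
      rw [if_pos this, if_pos hp]; omega
    · intro m hm1 hm2
      by_cases hmi : m = i
      · subst hmi; simp [oi, hi]
      · exact same m hm1 hmi (by rwa [hp]) hm2
  · by_cases hi : O.σ i = i
    · have od := D.obj_d h1 (m := O.σ p) hp h1
      apply sum_swap (a := i) (b := O.σ p) (hN _ (by omega)) (hN _ (by omega))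
      · simp [oi, i1, Ne.symm hp]
      · have : delσ O.σ p i (O.σ p) = O.σ p := by unfold delσ; grind
        rw [if_pos this, if_pos hi]; omega
      · intro m hm1 hm2
        by_cases hmi : m = p
        · subst hmi; simp [op, hp]
        · exact same m hmi hm1 hm2 (by rwa [hi])
    · apply Finset.sum_congr rfl
      intro m _
      by_cases m1 : m = p
      · subst m1; simp [op, hp]
      by_cases m2 : m = i
      · subst m2; simp [oi, hi]
      by_cases m3 : m = O.σ p
      · have : delσ O.σ p i m ≠ m := by unfold delσ; grind
        have h' : O.σ m ≠ m := by grind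
        rw [if_neg this, if_neg h']
      by_cases m4 : m = O.σ i
      · have : delσ O.σ p i m ≠ m := by unfold delσ; grind
        have h' : O.σ m ≠ m := by grind
        rw [if_neg this, if_neg h']
      exact same m m1 m2 m3 m4

lemma obj_s (h1 : O.σ p ≠ i) [FiniteDimensional k W] :
    (finrank k (LinearMap.range (D.obj h1).e) : ℤ) - finrank k (LinearMap.ker (D.obj h1).e) =
    (finrank k (LinearMap.range O.e) : ℤ) - finrank k (LinearMap.ker O.e) := by
  rw [D.rank_e, D.null_e]
  have a1 : finrank k ↥(LinearMap.range O.e ⊓ LinearMap.ker D.p0) =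
      finrank k (LinearMap.range (D.obj h1).e) := by
    have : (LinearMap.range (D.obj h1).e).map (Submodule.subtype (LinearMap.ker D.p0)) =
        LinearMap.range O.e ⊓ LinearMap.ker D.p0 := by
      apply le_antisymm
      · rintro _ ⟨_, ⟨w, rfl⟩, rfl⟩
        refine ⟨⟨w, ?_⟩, Subtype.coe_prop _⟩
        rw [Submodule.subtype_apply, D.obj_e]
      · rintro _ ⟨⟨w, rfl⟩, hw⟩
        refine ⟨⟨O.e w, hw⟩, ⟨⟨O.e w, hw⟩, ?_⟩, rfl⟩
        apply Subtype.ext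
        rw [D.obj_e, O.he]
    rw [← this]
    exact (Submodule.equivMapOfInjective _ (Submodule.subtype_injective _) _).finrank_eq.symm
  have a2 : finrank k ↥(LinearMap.ker O.e ⊓ LinearMap.ker D.p0) =
      finrank k (LinearMap.ker (D.obj h1).e) := by
    have : (LinearMap.ker (D.obj h1).e).map (Submodule.subtype (LinearMap.ker D.p0)) =
        LinearMap.ker O.e ⊓ LinearMap.ker D.p0 := by
      apply le_antisymm
      · rintro _ ⟨w, hw, rfl⟩
        refine ⟨?_, Subtype.coe_prop _⟩
        have hw : (D.obj h1).e w = 0 := hw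
        show O.e w = 0
        rw [← D.obj_e h1, hw]; rfl
      · rintro w ⟨hw', hw⟩
        refine ⟨⟨w, hw⟩, ?_, rfl⟩
        apply Subtype.ext
        rw [D.obj_e]
        exact hw'
    rw [← this]
    exact (Submodule.equivMapOfInjective _ (Submodule.subtype_injective _) _).finrank_eq.symm
  rw [a1, a2]
  push_cast
  ring

end Del
end Obj
end GelfandRed

namespace GelfandRed
open Module
variable {k W : Type} [Field k] [AddCommGroup W] [Module k W]
namespace Obj
variable {O : Obj k W}
namespace Del
variable {p i : ℕ} (D : O.Del p i)

lemma obj_loc (h1 : O.σ p ≠ i) (h2 : ¬ (O.σ p = p ∧ O.σ i = i)) (hloc : O.Loc) :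
    (D.obj h1).Loc := by
  intro g' hg'
  have hpi := D.hpi.ne
  have hple : O.F p ≤ O.F i := O.mono D.hpi.le
  have hi2 : O.σ i ≠ p := by intro h; apply h1; rw [← h, O.invol]
  have hne : O.σ i ≠ O.σ p := by
    intro h; have := congrArg O.σ h; rw [O.invol, O.invol] at this; exact hpi this.symm
  let G : W →ₗ[k] W := Submodule.subtype _ ∘ₗ g' ∘ₗ D.q0
  have hG : ∀ w, G w = (g' (D.q0 w) : W) := fun w => rfl
  have Gf : ∀ m w, w ∈ O.F m → G w ∈ O.F m := fun m w hw => hg'.filt m _ (D.q0_filt hw)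
  have Gc : ∀ w, G (O.e w) = O.e (G w) := by
    intro w
    rw [hG, hG, ← D.obj_e h1, ← hg'.comm]
    congr 2
    apply Subtype.ext
    rw [D.q0_comm, D.obj_e]
  have Gp : ∀ w ∈ O.F (p+1), G w ∈ O.F p := fun w hw => hg'.filt p _ (D.q0_p hw)
  have Gi : ∀ w ∈ O.F (i+1), G w ∈ O.F i := fun w hw => hg'.filt i _ (D.q0_i hw)
  -- the map h
  obtain ⟨h, hX, hh, hκ, hι⟩ : ∃ h : W →ₗ[k] W, (∀ w, h w ∈ D.X0) ∧ (∀ w ∈ O.F p, h w = 0) ∧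
      (O.σ p ≠ p → ∀ w ∈ O.F (p+1), O.θ p (h w) - G (O.θ p w) ∈ O.F (O.σ p)) ∧
      (O.σ i ≠ i → ∀ w ∈ O.F (i+1), O.θ i (O.e (h (D.δ w))) - G (O.θ i w) ∈ O.F (O.σ i)) := by
    -- common end of the argument at `i`
    have key : O.σ i ≠ i → ∀ w ∈ O.F (i+1),
        O.θ i (O.e (D.δ (O.θ (O.σ i) (G (O.θ i w))))) - G (O.θ i w) ∈ O.F (O.σ i) := by
      intro _ w hw
      have a1 := Gf _ _ (O.θmem i w hw)
      have a2 := θκ (O.invol i) a1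
      have a3 := θκ' (O := O) (m := i) rfl (D.D4 _ a2)
      have a4 := θinv' (O.invol i) a1
      have := add_mem a3 a4
      convert this using 1
      rw [map_sub]; abel
    by_cases hp : O.σ p = p
    · have hi : O.σ i ≠ i := fun h => h2 ⟨hp, h⟩
      refine ⟨D.δ ∘ₗ O.θ (O.σ i) ∘ₗ G ∘ₗ O.θ i ∘ₗ O.e, fun w => D.D1 _, ?_, fun h => absurd hp h, ?_⟩
      · intro w hw
        exact D.D2 _ (θκ' (O.invol i) (Gf _ _ (O.θlow i _ (hple (D.hst _ hw)))))
      · intro _ w hw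
        have e1 : D.δ (O.θ (O.σ i) (G (O.θ i (O.e (D.δ w))))) = D.δ (O.θ (O.σ i) (G (O.θ i w))) := by
          rw [← sub_eq_zero]
          simp only [← map_sub]
          exact D.D2 _ (θκ' (O.invol i) (Gf _ _ (O.θlow i _ (D.D4 w hw))))
        have := key hi w hw
        rw [← e1] at this
        exact this
    · have c1 : ∀ w ∈ O.F (p+1), D.δ (O.e (O.θ (O.σ p) (G (O.θ p w)))) - O.θ (O.σ p) (G (O.θ p w))
          ∈ O.F p := fun w hw => D.D5 _ (θκ (O.invol p) (Gf _ _ (O.θmem p w hw)))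
      refine ⟨D.δ ∘ₗ O.e ∘ₗ O.θ (O.σ p) ∘ₗ G ∘ₗ O.θ p, fun w => D.D1 _, ?_, ?_, ?_⟩
      · intro w hw
        exact D.D2 _ (hple (D.hst _ (θκ' (O.invol p) (Gf _ _ (O.θlow p _ hw)))))
      · intro _ w hw
        have a1 := O.θlow p _ (c1 w hw)
        have a2 := θinv' (O.invol p) (Gf _ _ (O.θmem p w hw))
        have := add_mem a1 a2
        convert this using 1
        simp only [LinearMap.comp_apply]
        rw [map_sub]; abel
      · intro hi w hw
        have dι : delσ O.σ p i (O.σ i) = O.σ p := by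
          have := O.invol i
          unfold delσ
          grind
        have dne : delσ O.σ p i (O.σ i) ≠ O.σ i := by rw [dι]; exact hne.symm
        have hΘ : D.Θ (O.σ i) = O.θ p ∘ₗ D.δ ∘ₗ O.θ (O.σ i) := by
          rw [Θ, if_neg dne, if_neg hne, if_pos rfl]
        have cc := hg'.compat (O.σ i) dne (D.q0 (O.θ i w)) (D.q0_filt (O.θmem i w hw))
        rw [show (D.obj h1).σ (O.σ i) = O.σ p from dι, D.obj_θ, D.obj_θ, hΘ] at cc
        have cc : (D.q0 (O.θ p (D.δ (O.θ (O.σ i) (G (O.θ i w))))) : W) -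
          G (O.θ p (D.δ (O.θ (O.σ i) (D.q0 (O.θ i w))))) ∈ O.F (O.σ p) := cc
        have e1 : D.δ (O.θ (O.σ i) (D.q0 (O.θ i w))) = D.δ w := by
          have b1 := θκ' (O.invol i) (D.q0_low hi2 hi (O.θmem i w hw))
          have b2 := O.θinv i w hw
          have b3 := D.D2 _ (add_mem b1 b2)
          rw [← sub_eq_zero, ← map_sub, ← b3]
          congr 1
          rw [map_sub]; abel
        rw [e1] at cc
        set x := D.δ (O.θ (O.σ i) (G (O.θ i w))) with hx
        have hx0 : x ∈ D.X0 := D.D1 _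
        have c2 := D.q0_low hp h1 (O.θmem p x (D.X0le x hx0))
        have c3 := θκ' (O.invol p) (sub_mem c2 cc)
        have c4 := sub_mem c3 (neg_mem (O.θinv p x (D.X0le x hx0)))
        have c5 := D.D2 _ (hple (D.hst _ c4))
        have e2 : D.δ (O.e (O.θ (O.σ p) (G (O.θ p (D.δ w))))) = x := by
          rw [← sub_eq_zero]
          conv_lhs => rw [← D.D3 x hx0]
          rw [← c5]
          simp only [← map_sub]
          congr 2
          simp only [map_sub]; abel
        have := key hi w hw
        rw [← hx, ← e2] at this
        exact this
  have hδX : ∀ w, (h ∘ₗ D.δ) w ∈ D.X0 := fun w => hX _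
  have hδ2 : ∀ w ∈ O.F i, (h ∘ₗ D.δ) w = 0 := fun w hw => by simp [D.D2 w hw]
  have Tl : ∀ {m : ℕ}, m ≠ p → m ≠ i → ∀ w ∈ O.F (m+1), O.T (h ∘ₗ D.δ) w ∈ O.F m :=
    fun hp hi => D.T_low hδX hδ2 hp hi
  have Tf := D.T_filt hδX hδ2
  let g : W →ₗ[k] W := G + O.T (h ∘ₗ D.δ)
  have gf : ∀ m w, w ∈ O.F m → g w ∈ O.F m := fun m w hw => add_mem (Gf m w hw) (Tf m w hw)
  have gp : ∀ w ∈ O.F (p+1), g w - h w ∈ O.F p := by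
    intro w hw
    have e1 : O.T (h ∘ₗ D.δ) w = h w := by
      rw [D.T_p hδ2 w hw, ← sub_eq_zero, LinearMap.comp_apply, ← map_sub]
      exact hh _ (D.D5 w hw)
    have := Gp w hw
    simpa [g, e1] using this
  have gi : ∀ w ∈ O.F (i+1), g w - O.e (h (D.δ w)) ∈ O.F i := by
    intro w hw
    have := add_mem (Gi w hw) (D.T_i hδX w)
    convert this using 1
    simp only [g, LinearMap.add_apply, LinearMap.comp_apply]
    abel
  have cp : O.σ p ≠ p → O.Compat g p := by
    intro hp w hw
    have a1 := O.θlow p _ (gp w hw)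
    have a2 := Tl hp h1 _ (O.θmem p w hw)
    have := sub_mem (add_mem a1 (hκ hp w hw)) a2
    convert this using 1
    simp only [g, LinearMap.add_apply, map_sub, map_add]
    abel
  have ci : O.σ i ≠ i → O.Compat g i := by
    intro hi w hw
    have a1 := O.θlow i _ (gi w hw)
    have a2 := Tl hi2 hi _ (O.θmem i w hw)
    have := sub_mem (add_mem a1 (hι hi w hw)) a2
    convert this using 1
    simp only [g, LinearMap.add_apply, map_sub, map_add]
    abel
  have hE : O.IsEndo g := by
    refine ⟨?_, gf, ?_⟩
    · intro w
      simp only [g, LinearMap.add_apply, map_add, Gc, O.T_comm]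
    · intro m hm
      by_cases m1 : m = p
      · subst m1; exact cp hm
      by_cases m2 : m = i
      · subst m2; exact ci hm
      by_cases m3 : m = O.σ p
      · rw [m3]
        apply O.compat_symm gf rfl (cp _)
        intro h; exact m1 (m3.trans h)
      by_cases m4 : m = O.σ i
      · rw [m4]
        apply O.compat_symm gf rfl (ci _)
        intro h; exact m2 (m4.trans h)
      have s1 : O.σ m ≠ p := by intro h; apply m3; rw [← h, O.invol]
      have s2 : O.σ m ≠ i := by intro h; apply m4; rw [← h, O.invol]
      have ds : delσ O.σ p i m = O.σ m := by unfold delσ; grind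
      have dne : delσ O.σ p i m ≠ m := by rw [ds]; exact hm
      apply O.compat_add _ (O.compat_zero (Tl m1 m2) (Tl s1 s2))
      intro w hw
      have hΘ : D.Θ m = O.θ m := by
        rw [Θ, if_neg dne, if_neg m3, if_neg m4]
      have cc := hg'.compat m dne (D.q0 w) (D.q0_filt hw)
      rw [show (D.obj h1).σ m = O.σ m from ds, D.obj_θ, D.obj_θ, hΘ] at cc
      have cc : (D.q0 (O.θ m (G w)) : W) - G (O.θ m (D.q0 w)) ∈ O.F (O.σ m) := cc
      have c2 := D.q0_low s1 s2 (O.θmem m _ (Gf _ _ hw))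
      have c3 := Gf _ _ (O.θlow m _ (D.q0_low m1 m2 hw))
      have := add_mem (sub_mem cc c2) c3
      convert this using 1
      simp only [map_sub]; abel
  have gK : ∀ w : ↥(LinearMap.ker D.p0), g w = g' w := by
    intro w
    show G w + O.T (h ∘ₗ D.δ) w = _
    rw [D.T_ker h w.2, hG, D.q0_ker, add_zero]
  rcases hloc g hE with ⟨n, hn⟩ | hinj
  · left
    refine ⟨n, ?_⟩
    have : ∀ n : ℕ, ∀ w : ↥(LinearMap.ker D.p0), (g ^ n) w = ((g' ^ n) w : W) := by
      intro n
      induction n with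
      | zero => intro w; rfl
      | succ n ih =>
        intro w
        rw [pow_succ, pow_succ, Module.End.mul_apply, Module.End.mul_apply, gK, ih]
    ext w
    rw [← this, hn]; rfl
  · right
    intro a b hab
    apply Subtype.ext
    apply hinj
    rw [gK, gK, hab]

end Del
end Obj
end GelfandRed

namespace GelfandRed

open Module

variable {k H : Type} [Field k] [AddCommGroup H] [Module k H]

lemma rank_compl [FiniteDimensional k H] (p : End k H) (hp : p * p = p) :
    finrank k (LinearMap.range p) + finrank k (LinearMap.range (1 - p)) = finrank k H := by
  have : LinearMap.range (1 - p) = LinearMap.ker p := by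
    ext w
    constructor
    · rintro ⟨v, rfl⟩
      rw [LinearMap.mem_ker, ← Module.End.mul_apply, mul_sub, hp]; simp
    · intro hw
      exact ⟨w, by simp [LinearMap.mem_ker.1 hw]⟩
  rw [this, LinearMap.finrank_range_add_finrank_ker]

lemma nilp_bound [FiniteDimensional k H] (N : End k H) (hN : IsNilpotent N) :
    N ^ (finrank k H) = 0 := by
  have h := (LinearMap.charpoly_eq_X_pow_iff N).2 (by
    intro m
    obtain ⟨n, hn⟩ := hN
    exact ⟨n, by rw [hn]; rfl⟩)
  have h2 := LinearMap.aeval_self_charpoly N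
  rw [h] at h2
  simpa using h2

section chain
variable (p N : End k H)

/-- alternating projections -/
def alt (p : End k H) (j : ℕ) : End k H := if j % 2 = 0 then p else 1 - p

lemma alt_comm (hpN : p * N + N * p = N) (j i : ℕ) : N ^ i * alt p j = alt p (j + i) * N ^ i := by
  induction i with
  | zero => simp
  | succ i ih =>
    have h1 : ∀ j, N * alt p j = alt p (j+1) * N := by
      intro j
      unfold alt
      rcases Nat.mod_two_eq_zero_or_one j with h | h
      · rw [if_pos h, if_neg (by omega), sub_mul, one_mul]
        nth_rw 2 [← hpN]; abel
      · rw [if_neg (by omega), if_pos (by omega), mul_sub, mul_one]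
        nth_rw 1 [← hpN]; abel
    rw [pow_succ', mul_assoc, ih, ← mul_assoc, h1, mul_assoc, ← add_assoc]

lemma alt_alt (hp : p * p = p) (i j : ℕ) : alt p i * alt p j = if i % 2 = j % 2 then alt p i else 0 := by
  unfold alt
  rcases Nat.mod_two_eq_zero_or_one i with h | h <;>
  rcases Nat.mod_two_eq_zero_or_one j with h' | h' <;>
  simp [h, h', mul_sub, sub_mul, hp]

lemma chain (hp : p * p = p) (hpN : p * N + N * p = N) [FiniteDimensional k H] (hloc : ∀ g : End k H, g * p = p * g → g * N = N * g →
      IsNilpotent g ∨ Function.Injective g) (l : ℕ) (hl : N ^ (l+1) = 0) (x : H)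
    (hx : (N ^ l) x ≠ 0) (hpx : p x = x) :
    |(finrank k (LinearMap.range p) : ℤ) - finrank k (LinearMap.range (1 - p))| ≤ 1 := by
  have ax : ∀ j, alt p j x = if j % 2 = 0 then x else 0 := by
    intro j
    unfold alt
    split_ifs <;> simp [hpx]
  obtain ⟨lam0, hlam0⟩ : ∃ f : H →ₗ[k] k, f ((N^l) x) = 1 := by
    obtain ⟨f, hf⟩ := Module.Projective.exists_dual_ne_zero k hx
    exact ⟨(f ((N^l) x))⁻¹ • f, by simp [hf]⟩
  let lam : H →ₗ[k] k := lam0 ∘ₗ alt p l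
  have hlx : alt p l ((N^l) x) = (N^l) x := by
    have := alt_comm p N hpN 0 l
    rw [zero_add] at this
    rw [← Module.End.mul_apply, ← this, Module.End.mul_apply]
    simp [alt, hpx]
  have hlam : lam ((N^l) x) = 1 := by simp [lam, hlx, hlam0]
  have hlamalt : ∀ j w, lam (alt p j w) = if l % 2 = j % 2 then lam w else 0 := by
    intro j w
    simp only [lam, LinearMap.comp_apply]
    rw [← Module.End.mul_apply, alt_alt p hp]
    split_ifs <;> simp
  let g : End k H := ∑ j ∈ Finset.range (l+1), (lam ∘ₗ (N ^ (l - j))).smulRight ((N^j) x)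
  have g_apply : ∀ w, g w = ∑ j ∈ Finset.range (l+1), lam ((N ^ (l-j)) w) • (N^j) x := by
    intro w; simp [g, LinearMap.sum_apply]
  have pN : ∀ j, p ((N^j) x) = if j % 2 = 0 then (N^j) x else 0 := by
    intro j
    have h1 := alt_comm p N hpN j j
    have : alt p (j+j) = p := by unfold alt; rw [if_pos (by omega)]
    rw [this] at h1
    rw [← Module.End.mul_apply, ← h1, Module.End.mul_apply, ax]
    split_ifs <;> simp
  have c1 : g * p = p * g := by
    ext w
    rw [Module.End.mul_apply, Module.End.mul_apply, g_apply, g_apply, map_sum]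
    apply Finset.sum_congr rfl
    intro j hj
    rw [Finset.mem_range] at hj
    rw [map_smul, pN]
    have h1 := alt_comm p N hpN 0 (l-j)
    have h2 : alt p 0 = p := by simp [alt]
    rw [h2, zero_add] at h1
    rw [← Module.End.mul_apply, h1, Module.End.mul_apply, hlamalt]
    by_cases hj2 : j % 2 = 0
    · rw [if_pos hj2, if_pos (by omega)]
    · rw [if_neg hj2, if_neg (by omega)]; simp
  have c2 : g * N = N * g := by
    ext w
    rw [Module.End.mul_apply, Module.End.mul_apply, g_apply, g_apply, map_sum]
    rw [Finset.sum_range_succ', Finset.sum_range_succ]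
    have z1 : (N ^ (l-0)) (N w) = 0 := by
      rw [← Module.End.mul_apply, ← pow_succ, Nat.sub_zero, hl]; rfl
    have z2 : N ((N ^ l) x) = 0 := by
      rw [← Module.End.mul_apply, ← pow_succ', hl]; rfl
    rw [z1, map_smul, z2]
    simp only [map_zero, zero_smul, smul_zero, add_zero]
    apply Finset.sum_congr rfl
    intro j hj
    rw [Finset.mem_range] at hj
    rw [map_smul, ← Module.End.mul_apply N, ← pow_succ', ← Module.End.mul_apply _ N, ← pow_succ]
    congr 4
    omega
  have fix : g ((N^l) x) = (N^l) x := by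
    rw [g_apply, Finset.sum_range_succ, Finset.sum_eq_zero]
    · simp [hlam]
    · intro j hj
      rw [Finset.mem_range] at hj
      rw [← Module.End.mul_apply, ← pow_add, show l - j + l = (l + 1) + (l - j - 1) by omega,
        pow_add, hl]
      simp
  have fixn : ∀ n, (g^n) ((N^l) x) = (N^l) x := by
    intro n
    induction n with
    | zero => simp
    | succ n ih => rw [pow_succ, Module.End.mul_apply, fix, ih]
  have hinj : Function.Injective g := by
    rcases hloc g c1 c2 with ⟨n, hn⟩ | h
    · exfalso
      have := fixn n
      rw [hn] at this
      exact hx this.symm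
    · exact h
  have hsurj := LinearMap.injective_iff_surjective.1 hinj
  have r1 : finrank k (LinearMap.range p) ≤ (l+2)/2 := by
    have : LinearMap.range p ≤ Submodule.span k
        (Set.range (fun i : Fin ((l+2)/2) => (N^(2*i.1)) x)) := by
      rintro _ ⟨v, rfl⟩
      obtain ⟨w, rfl⟩ := hsurj v
      rw [g_apply, map_sum]
      apply Submodule.sum_mem
      intro j hj
      rw [Finset.mem_range] at hj
      rw [map_smul, pN]
      apply Submodule.smul_mem
      split_ifs with h
      · exact Submodule.subset_span ⟨⟨j/2, by omega⟩, by simp only []; congr 2; omega⟩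
      · exact Submodule.zero_mem _
    have h2 := Submodule.finrank_mono this
    have h3 := finrank_range_le_card (R := k) (fun i : Fin ((l+2)/2) => (N^(2*i.1)) x)
    rw [Fintype.card_fin] at h3
    exact h2.trans h3
  have r2 : finrank k (LinearMap.range (1 - p)) ≤ (l+1)/2 := by
    have : LinearMap.range (1 - p) ≤ Submodule.span k
        (Set.range (fun i : Fin ((l+1)/2) => (N^(2*i.1+1)) x)) := by
      rintro _ ⟨v, rfl⟩
      obtain ⟨w, rfl⟩ := hsurj v
      rw [g_apply, map_sum]
      apply Submodule.sum_mem
      intro j hj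
      rw [Finset.mem_range] at hj
      rw [map_smul, LinearMap.sub_apply, pN]
      apply Submodule.smul_mem
      split_ifs with h
      · simp
      · rw [sub_zero]
        exact Submodule.subset_span ⟨⟨j/2, by omega⟩, by
          simp only [Module.End.one_apply]; congr 2; omega⟩
    have h2 := Submodule.finrank_mono this
    have h3 := finrank_range_le_card (R := k) (fun i : Fin ((l+1)/2) => (N^(2*i.1+1)) x)
    rw [Fintype.card_fin] at h3
    exact h2.trans h3
  have r3 := rank_compl p hp
  have r4 : l + 1 ≤ finrank k H := by
    by_contra hlt
    have := nilp_bound N ⟨_, hl⟩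
    apply hx
    have e : l = finrank k H + (l - finrank k H) := by omega
    rw [e, pow_add, this]; simp
  rw [abs_le]
  omega
end chain

lemma chain' [FiniteDimensional k H] (p N : End k H) (hp : p * p = p) (hpN : p * N + N * p = N)
    (hN : IsNilpotent N)
    (hloc : ∀ g : End k H, g * p = p * g → g * N = N * g →
      IsNilpotent g ∨ Function.Injective g) :
    |(finrank k (LinearMap.range p) : ℤ) - finrank k (LinearMap.range (1 - p))| ≤ 1 := by
  rcases subsingleton_or_nontrivial H with hH | hH
  · have r3 := rank_compl p hp
    have r4 : finrank k H = 0 := finrank_zero_of_subsingleton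
    rw [abs_le]; omega
  · classical
    have h0 : Nat.find hN ≠ 0 := by
      intro h
      have := Nat.find_spec hN
      rw [h, pow_zero] at this
      exact one_ne_zero this
    obtain ⟨l, hl⟩ := Nat.exists_eq_succ_of_ne_zero h0
    have hl1 : N^(l+1) = 0 := by have := Nat.find_spec hN; rwa [hl] at this
    have hl2 : N^l ≠ 0 := Nat.find_min hN (by omega)
    obtain ⟨y, hy⟩ : ∃ y, (N^l) y ≠ 0 := by
      by_contra hcon; push Not at hcon
      exact hl2 (LinearMap.ext hcon)
    by_cases h1 : (N^l) (p y) = 0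
    · have hp' : (1 - p) * (1 - p) = 1 - p := by simp [mul_sub, sub_mul, hp]
      have := chain (1 - p) N hp' (by
        rw [sub_mul, mul_sub, one_mul, mul_one]
        have e : N - p * N + (N - N * p) = N + N - (p * N + N * p) := by abel
        rw [e, hpN]; abel) (fun g hg hg' => hloc g (by
          rw [mul_sub, sub_mul] at hg
          simpa using hg) hg') l hl1 (y - p y) (by rwa [map_sub, h1, sub_zero]) (by
            have := LinearMap.congr_fun hp' y
            simpa using this)
      rw [sub_sub_cancel, abs_sub_comm] at this
      exact this
    · exact chain p N hp hpN hloc l hl1 (p y) h1 (by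
        have := LinearMap.congr_fun hp y
        simpa using this)

lemma eq_zero_of_comm (D z : End k H) (hz : IsNilpotent z) (h : D = D * z + z * D) : D = 0 := by
  obtain ⟨n, hn⟩ := hz
  have hu : IsUnit (1 - z) := IsNilpotent.isUnit_one_sub ⟨n, hn⟩
  obtain ⟨u, hu⟩ := hu
  have h1 : (u : End k H) * D = D * z := by
    rw [hu, sub_mul, one_mul]; nth_rw 1 [h]; abel
  have h2 : D = ↑u⁻¹ * D * z := by
    rw [mul_assoc, ← h1, ← mul_assoc]; simp
  have h3 : ∀ m : ℕ, D = (↑u⁻¹)^m * D * z^m := by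
    intro m
    induction m with
    | zero => simp
    | succ m ih =>
      rw [pow_succ, pow_succ' z]
      calc D = _ := ih
        _ = _ := by nth_rw 1 [h2]; simp only [mul_assoc]
  rw [h3 n, hn, mul_zero]

lemma hlemma [FiniteDimensional k H] (e1 e2 : End k H) (h1 : e1 * e1 = e1) (h2 : e2 * e2 = e2)
    (hloc : ∀ g : End k H, g * e1 = e1 * g → g * e2 = e2 * g →
      IsNilpotent g ∨ Function.Injective g) :
    |(finrank k (LinearMap.range e1) : ℤ) + finrank k (LinearMap.range e2) - finrank k H| ≤ 1 := by
  have a1 : ∀ x, e1 * (e1 * x) = e1 * x := fun x => by rw [← mul_assoc, h1]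
  have a2 : ∀ x, e2 * (e2 * x) = e2 * x := fun x => by rw [← mul_assoc, h2]
  have r1 := rank_compl e1 h1
  have r2 := rank_compl e2 h2
  have conj : ∀ (u a b : End k H), Function.Injective u → u * a = b * u →
      finrank k (LinearMap.range a) = finrank k (LinearMap.range b) := by
    intro u a b hu huab
    have hs := LinearMap.injective_iff_surjective.1 hu
    have : (LinearMap.range a).map u = LinearMap.range b := by
      ext w
      constructor
      · rintro ⟨_, ⟨v, rfl⟩, rfl⟩
        exact ⟨u v, (LinearMap.congr_fun huab v).symm⟩
      · rintro ⟨v, rfl⟩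
        obtain ⟨v', rfl⟩ := hs v
        exact ⟨a v', ⟨v', rfl⟩, LinearMap.congr_fun huab v'⟩
    rw [← this]
    exact (Submodule.equivMapOfInjective u hu _).finrank_eq
  obtain ⟨c, hc⟩ : ∃ c, c = e1 - e2 := ⟨_, rfl⟩
  have zc1 : (c * c) * e1 = e1 * (c * c) := by
    simp only [hc, mul_sub, sub_mul, mul_assoc, h1, h2, a1, a2]; abel
  have zc2 : (c * c) * e2 = e2 * (c * c) := by
    simp only [hc, mul_sub, sub_mul, mul_assoc, h1, h2, a1, a2]; abel
  rcases hloc (c * c) zc1 zc2 with hn | hi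
  · have hq2 : (e1 + e2 - 1) * (e1 + e2 - 1) = 1 - c * c := by
      simp only [hc, mul_sub, sub_mul, mul_add, add_mul, mul_assoc, h1, h2, mul_one, one_mul]; abel
    have hqu : IsUnit ((e1 + e2 - 1) * (e1 + e2 - 1)) := by
      rw [hq2]; exact IsNilpotent.isUnit_one_sub hn
    have hqi : Function.Injective ⇑(e1 + e2 - 1 : End k H) := by
      have := ((Module.End.isUnit_iff _).1 hqu).1
      rw [Module.End.coe_mul] at this
      exact Function.Injective.of_comp this
    have er := conj (e1 + e2 - 1) e1 e2 hqi (by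
      simp only [mul_sub, sub_mul, mul_add, add_mul, h1, h2, mul_one, one_mul]; abel)
    obtain ⟨N, hN⟩ : ∃ N, N = e1 * e2 + e2 * e1 - (e1 * (e2 * e1) + e1 * (e2 * e1)) := ⟨_, rfl⟩
    have hN2 : N * N = c * c - (c * c) * (c * c) := by
      simp only [hN, hc, mul_sub, sub_mul, mul_add, add_mul, mul_assoc, h1, h2, a1, a2]; abel
    have hNn : IsNilpotent N := by
      have : IsNilpotent (N * N) := by
        rw [hN2, show c * c - (c * c) * (c * c) = (c * c) * (1 - c * c) by
          rw [mul_sub, mul_one]]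
        refine Commute.isNilpotent_mul_right ?_ hn
        show (c * c) * (1 - c * c) = (1 - c * c) * (c * c)
        rw [mul_sub, sub_mul, mul_one, one_mul]
      obtain ⟨n, hn⟩ := this
      exact ⟨2 * n, by rw [pow_mul, pow_two, hn]⟩
    have hce : e2 = e1 + N + (c * c) - (e1 * (c * c) + e1 * (c * c)) := by
      simp only [hN, hc, mul_sub, sub_mul, mul_add, add_mul, mul_assoc, h1, h2, a1, a2]; abel
    have := chain' e1 N h1 (by
      simp only [hN, mul_sub, sub_mul, mul_add, add_mul, mul_assoc, h1, h2, a1, a2]; abel) hNn (by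
      intro g hg1 hgN
      have hgz : g * (c * c) = (c * c) * g := by
        rw [← sub_eq_zero]
        apply eq_zero_of_comm _ _ hn
        have h3 : g * (N * N) = (N * N) * g := by rw [← mul_assoc, hgN, mul_assoc, hgN, mul_assoc]
        rw [hN2] at h3
        rw [mul_sub, sub_mul] at h3
        rw [← sub_eq_zero]
        rw [← sub_eq_zero] at h3
        rw [← h3, sub_mul, mul_sub]
        simp only [mul_assoc]
        abel
      apply hloc g hg1
      rw [hce]
      rw [mul_sub, sub_mul, mul_add, mul_add, mul_add, add_mul, add_mul, add_mul, hg1, hgN, hgz]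
      congr 1
      rw [← mul_assoc, hg1, mul_assoc, hgz, ← mul_assoc])
    rw [abs_le] at this ⊢
    omega
  · have hci : Function.Injective c := by
      rw [Module.End.coe_mul] at hi
      exact Function.Injective.of_comp hi
    have := conj c e1 (1 - e2) hci (by
      simp only [hc, mul_sub, sub_mul, h1, h2, one_mul]; abel)
    rw [abs_le]
    omega

end GelfandRed

namespace GelfandRed

open Module

variable {k W : Type} [Field k] [AddCommGroup W] [Module k W]

namespace Obj

variable (O : Obj k W)

lemma finrank_submodule_prod {V V' : Type} [AddCommGroup V] [Module k V] [AddCommGroup V']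
    [Module k V'] [FiniteDimensional k V] [FiniteDimensional k V']
    (A : Submodule k V) (B : Submodule k V') :
    finrank k (A.prod B) = finrank k A + finrank k B := by
  rw [← finrank_prod]
  exact (LinearEquiv.ofLinearMap
    (((LinearMap.fst k V V').restrict (p := A.prod B) (q := A) (fun x hx => hx.1)).prod
      ((LinearMap.snd k V V').restrict (p := A.prod B) (q := B) (fun x hx => hx.2)))
    ((LinearMap.prodMap A.subtype B.subtype).codRestrict (A.prod B) (fun x => ⟨x.1.2, x.2.2⟩))
    (by ext <;> rfl) (by ext <;> rfl)).finrank_eq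

lemma exists_eproj (U : Submodule k W) (hU : ∀ w ∈ U, O.e w ∈ U) :
    ∃ P : W →ₗ[k] W, (∀ w, P w ∈ U) ∧ (∀ w ∈ U, P w = w) ∧ ∀ w, P (O.e w) = O.e (P w) := by
  obtain ⟨P, h1, h2⟩ := exists_proj U
  refine ⟨O.e ∘ₗ P ∘ₗ O.e + (LinearMap.id - O.e) ∘ₗ P ∘ₗ (LinearMap.id - O.e), ?_, ?_, ?_⟩
  · intro w
    simp only [LinearMap.add_apply, LinearMap.comp_apply, LinearMap.sub_apply, LinearMap.id_apply]
    exact add_mem (hU _ (h1 _)) (sub_mem (h1 _) (hU _ (h1 _)))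
  · intro w hw
    simp only [LinearMap.add_apply, LinearMap.comp_apply, LinearMap.sub_apply, LinearMap.id_apply]
    rw [h2 _ (hU w hw), h2 _ (sub_mem hw (hU w hw)), map_sub, O.he]; abel
  · intro w
    simp only [LinearMap.add_apply, LinearMap.comp_apply, LinearMap.sub_apply, LinearMap.id_apply,
      map_sub, map_add, O.he]
    simp

lemma F_const {a b : ℕ} (hab : a ≤ b) (h : ∀ n, a ≤ n → n < b → O.F (n+1) = O.F n) :
    O.F b = O.F a := by
  induction b, hab using Nat.le_induction with
  | base => rfl
  | succ b hb ih =>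
    rw [h b hb (by omega), ih (fun n h1 h2 => h n h1 (by omega))]

lemma terminal_strata [FiniteDimensional k W] (hloc : O.Loc)
    (hst : ∀ m, ∀ w ∈ O.F m, O.e w ∈ O.F m) {m : ℕ} (hm : O.F (m+1) ≠ O.F m) :
    ∀ n, n ≠ m → n ≠ O.σ m → O.F (n+1) = O.F n := by
  choose P hP1 hP2 hP3 using fun j => O.exists_eproj (O.F j) (hst j)
  let π : ℕ → W →ₗ[k] W := fun j => P (j+1) - P j ∘ₗ P (j+1)
  have π_apply : ∀ j w, π j w = P (j+1) w - P j (P (j+1) w) := fun j w => rfl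
  have πcomm : ∀ j w, π j (O.e w) = O.e (π j w) := by
    intro j w; simp [π_apply, hP3]
  have πlow : ∀ j n, n ≠ j → ∀ w ∈ O.F (n+1), π j w ∈ O.F n := by
    intro j n hn w hw
    rw [π_apply]
    rcases lt_or_gt_of_ne hn with h | h
    · have h1 : w ∈ O.F j := O.mono (show n + 1 ≤ j by omega) hw
      rw [hP2 (j+1) w (O.le_succ j h1), hP2 j w h1, sub_self]
      exact zero_mem _
    · exact O.mono (show j + 1 ≤ n by omega) (sub_mem (hP1 _ _) (O.le_succ j (hP1 _ _)))
  have πone : ∀ j, ∀ w ∈ O.F (j+1), π j w - w ∈ O.F j := by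
    intro j w hw
    rw [π_apply, hP2 (j+1) w hw]
    have := neg_mem (hP1 j w)
    convert this using 1; abel
  obtain ⟨g, hg1, hg2, hg3⟩ : ∃ g : W →ₗ[k] W, (∀ w, g (O.e w) = O.e (g w)) ∧
      (∀ n, (n = m ∨ n = O.σ m) → ∀ w ∈ O.F (n+1), g w - w ∈ O.F n) ∧
      (∀ n, n ≠ m → n ≠ O.σ m → ∀ w ∈ O.F (n+1), g w ∈ O.F n) := by
    by_cases hq : O.σ m = m
    · refine ⟨π m, πcomm m, ?_, ?_⟩
      · rintro n hn
        have : n = m := by rcases hn with h | h <;> omega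
        subst this
        exact πone n
      · intro n hn _
        exact πlow m n hn
    · refine ⟨π m + π (O.σ m), ?_, ?_, ?_⟩
      · intro w; simp [πcomm]
      · rintro n (rfl | rfl) w hw
        · have := add_mem (πone n w hw) (πlow (O.σ n) n (Ne.symm hq) w hw)
          convert this using 1
          simp only [LinearMap.add_apply]; abel
        · have := add_mem (πone _ w hw) (πlow m _ hq w hw)
          convert this using 1
          simp only [LinearMap.add_apply]; abel
      · intro n h1 h2 w hw
        exact add_mem (πlow m n h1 w hw) (πlow _ n h2 w hw)
  have hgf : ∀ n w, w ∈ O.F n → g w ∈ O.F n := by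
    intro n w hw
    cases n with
    | zero => rw [O.F0] at hw ⊢; simp only [Submodule.mem_bot] at hw ⊢; simp [hw]
    | succ n =>
      by_cases h : n = m ∨ n = O.σ m
      · have := add_mem (O.le_succ n (hg2 n h w hw)) hw
        simpa using this
      · push Not at h
        exact O.le_succ n (hg3 n h.1 h.2 w hw)
  have hE : O.IsEndo g := by
    refine ⟨hg1, hgf, ?_⟩
    intro n hn
    by_cases h : n = m ∨ n = O.σ m
    · apply O.compat_one (hg2 n h) (hg2 (O.σ n) _)
      rcases h with rfl | rfl
      · right; rfl
      · left; rw [O.invol]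
    · push Not at h
      apply O.compat_zero (hg3 n h.1 h.2) (hg3 (O.σ n) _ _)
      · intro h'; apply h.2; rw [← h', O.invol]
      · intro h'; apply h.1; rw [← O.invol n, h', O.invol]
  rcases hloc g hE with ⟨r, hr⟩ | hi
  · exfalso
    apply hm
    apply le_antisymm _ (O.le_succ m)
    intro w hw
    have key : ∀ r : ℕ, (g^r) w - w ∈ O.F m := by
      intro r
      induction r with
      | zero => simp
      | succ r ih =>
        rw [pow_succ', Module.End.mul_apply]
        have := add_mem (hgf _ _ ih) (hg2 m (Or.inl rfl) w hw)
        simpa using this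
    have := key r
    rw [hr] at this
    simpa using this
  · intro n h1 h2
    exact O.triv_of_lower hi (hg3 n h1 h2)

lemma rank_null [FiniteDimensional k W] :
    finrank k (LinearMap.range O.e) + finrank k (LinearMap.ker O.e) = finrank k W :=
  LinearMap.finrank_range_add_finrank_ker _

lemma terminal_unmatched [FiniteDimensional k W] [Nontrivial W] (hloc : O.Loc)
    {m : ℕ} (hσ : O.σ m = m)
    (hs : ∀ n, n ≠ m → O.F (n+1) = O.F n) :
    (O.u : ℤ) + |(finrank k (LinearMap.range O.e) : ℤ) - finrank k (LinearMap.ker O.e)| ≤ 2 := by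
  have hlow : ∀ j, j ≤ m → O.F j = ⊥ := by
    intro j hj
    rw [O.F_const (Nat.zero_le j) (fun n _ hn => hs n (by omega)), O.F0]
  have hhigh : ∀ j, m + 1 ≤ j → O.F j = ⊤ := by
    intro j hj
    have h1 := O.F_const (a := m+1) (b := j) hj (fun n hn _ => hs n (by omega))
    have h2 := O.F_const (a := m+1) (b := max O.N (m+1)) (by omega) (fun n hn _ => hs n (by omega))
    rw [h1, ← h2, eq_top_iff, ← O.FN]
    exact O.mono (le_max_left _ _)
  have hend : ∀ g : W →ₗ[k] W, (∀ w, g (O.e w) = O.e (g w)) → O.IsEndo g := by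
    intro g hg
    have hf : ∀ n w, w ∈ O.F n → g w ∈ O.F n := by
      intro n w hw
      rcases le_or_gt n m with h | h
      · rw [hlow n h] at hw ⊢; simp only [Submodule.mem_bot] at hw ⊢; simp [hw]
      · rw [hhigh n h]; trivial
    refine ⟨hg, hf, ?_⟩
    intro n hn
    apply O.compat_triv hf
    exact (hs n (by rintro rfl; exact hn hσ)).le
  have hdim : finrank k W ≤ 1 := by
    obtain ⟨y, hy⟩ := exists_ne (0 : W)
    have fin : ∀ (v : W) (f : W →ₗ[k] k), f v ≠ 0 →
        (∀ w, f (O.e w) • v = f w • O.e v) → finrank k W ≤ 1 := by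
      intro v f hfv hfe
      rcases hloc (f.smulRight v) (hend _ (by intro w; simp [hfe])) with ⟨r, hr⟩ | hi
      · exfalso
        have key : ∀ r : ℕ, ((f.smulRight v)^r) v = (f v)^r • v := by
          intro r
          induction r with
          | zero => simp
          | succ r ih => rw [pow_succ', Module.End.mul_apply, ih]; simp [smul_smul, pow_succ]
        have := key r
        rw [hr] at this
        have h2 : v ≠ 0 := by rintro rfl; simp at hfv
        rcases smul_eq_zero.1 this.symm with h | h
        · exact pow_ne_zero r hfv h
        · exact h2 h
      · have hs := LinearMap.injective_iff_surjective.1 hi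
        apply finrank_le_one v
        intro w
        obtain ⟨w', rfl⟩ := hs w
        exact ⟨f w', rfl⟩
    by_cases h1 : O.e y = 0
    · obtain ⟨f, hf⟩ := Module.Projective.exists_dual_ne_zero k hy
      apply fin y (f ∘ₗ (LinearMap.id - O.e)) (by simpa [h1] using hf)
      intro w; simp [O.he, h1]
    · obtain ⟨f, hf⟩ := Module.Projective.exists_dual_ne_zero k h1
      apply fin (O.e y) (f ∘ₗ O.e) (by simpa [O.he] using hf)
      intro w; simp [O.he]
  have h1 := O.u_le
  have h2 := O.rank_null
  have : |(finrank k (LinearMap.range O.e) : ℤ) - finrank k (LinearMap.ker O.e)| ≤ 1 := by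
    rw [abs_le]; omega
  omega

lemma terminal_matched [FiniteDimensional k W] (hloc : O.Loc)
    (hst : ∀ m, ∀ w ∈ O.F m, O.e w ∈ O.F m) {m q : ℕ} (hmq : m < q) (hσ : O.σ m = q)
    (hs : ∀ n, n ≠ m → n ≠ q → O.F (n+1) = O.F n) :
    (O.u : ℤ) + |(finrank k (LinearMap.range O.e) : ℤ) - finrank k (LinearMap.ker O.e)| ≤ 2 := by
  have hσ' : O.σ q = m := by rw [← hσ, O.invol]
  have hlow : ∀ j, j ≤ m → O.F j = ⊥ := by
    intro j hj
    rw [O.F_const (Nat.zero_le j) (fun n _ hn => hs n (by omega) (by omega)), O.F0]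
  have hmid : ∀ j, m + 1 ≤ j → j ≤ q → O.F j = O.F (m+1) := fun j h1 h2 =>
    O.F_const (a := m+1) (b := j) h1 (fun n hn _ => hs n (by omega) (by omega))
  have hhigh : ∀ j, q + 1 ≤ j → O.F j = ⊤ := by
    intro j hj
    have h1 := O.F_const (a := q+1) (b := j) hj (fun n hn _ => hs n (by omega) (by omega))
    have h2 := O.F_const (a := q+1) (b := max O.N (q+1)) (by omega)
      (fun n hn _ => hs n (by omega) (by omega))
    rw [h1, ← h2, eq_top_iff, ← O.FN]
    exact O.mono (le_max_left _ _)
  have hu : O.u = 0 := by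
    unfold u
    apply Finset.sum_eq_zero
    intro n _
    split_ifs with h
    · apply O.d_eq_zero
      apply hs
      · rintro rfl; omega
      · rintro rfl; omega
    · rfl
  set U := O.F (m+1) with hU
  have hFq : O.F q = U := hmid q (by omega) le_rfl
  obtain ⟨P, hP1, hP2, hP3⟩ := O.exists_eproj U (hst _)
  have t1 : ∀ w, O.θ q w ∈ U := by
    intro w
    have := O.θmem q w (by rw [hhigh _ le_rfl]; trivial)
    rwa [hσ'] at this
  have t2 : ∀ w ∈ U, O.θ q w = 0 := by
    intro w hw
    have := O.θlow q w (by rwa [hFq])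
    rw [hσ', hlow m le_rfl] at this
    simpa using this
  have t3 : ∀ w ∈ U, O.θ q (O.θ m w) = w := by
    intro w hw
    have := O.θinv m w hw
    rw [hσ, hlow m le_rfl] at this
    simpa [sub_eq_zero] using this
  have t4 : ∀ w, O.θ m (O.θ q w) - w ∈ U := by
    intro w
    have := O.θinv q w (by rw [hhigh _ le_rfl]; trivial)
    rwa [hσ', hFq] at this
  let PU : W →ₗ[k] U := P.codRestrict U hP1
  let θU : W →ₗ[k] U := (O.θ q).codRestrict U t1
  let e1 : End k U := O.e.restrict (hst _)
  let e2 : End k U := θU ∘ₗ O.e ∘ₗ O.θ m ∘ₗ U.subtype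
  have PU_coe : ∀ w, (PU w : W) = P w := fun w => rfl
  have θU_coe : ∀ w, (θU w : W) = O.θ q w := fun w => rfl
  have e1_coe : ∀ w : U, (e1 w : W) = O.e w := fun w => rfl
  have e2_coe : ∀ w : U, (e2 w : W) = O.θ q (O.e (O.θ m w)) := fun w => rfl
  have θe : ∀ w, O.θ q (O.e w) = O.θ q (O.e (O.θ m (O.θ q w))) := by
    intro w
    have h := t2 _ (hst _ _ (t4 w))
    rw [map_sub, map_sub, sub_eq_zero] at h
    exact h.symm
  have θe2 : ∀ w, θU (O.e w) = e2 (θU w) := fun w => Subtype.ext (θe w)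
  have Pe : ∀ w, PU (O.e w) = e1 (PU w) := fun w => Subtype.ext (hP3 w)
  have h11 : e1 * e1 = e1 := by ext w; simp [e1_coe, O.he]
  have h22 : e2 * e2 = e2 := by
    ext w
    rw [Module.End.mul_apply, e2_coe, e2_coe, ← θe, O.he, ← e2_coe]
  have hl : ∀ h : End k U, h * e1 = e1 * h → h * e2 = e2 * h →
      IsNilpotent h ∨ Function.Injective h := by
    intro h c1 c2
    let g : W →ₗ[k] W := U.subtype ∘ₗ h ∘ₗ PU + (LinearMap.id - P) ∘ₗ O.θ m ∘ₗ U.subtype ∘ₗ h ∘ₗ θU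
    have g_apply : ∀ w, g w = (h (PU w) : W) + (O.θ m (h (θU w)) - P (O.θ m (h (θU w)))) :=
      fun w => rfl
    have gU : ∀ w : U, g w = h w := by
      intro w
      have a1 : θU w = 0 := Subtype.ext (t2 w w.2)
      have a2 : PU w = w := Subtype.ext (hP2 w w.2)
      rw [g_apply, a1, a2]; simp
    have hgf : ∀ n w, w ∈ O.F n → g w ∈ O.F n := by
      intro n w hw
      rcases le_or_gt n m with h1 | h1
      · rw [hlow n h1] at hw ⊢; simp only [Submodule.mem_bot] at hw ⊢; simp [hw]
      · rcases le_or_gt n q with h2 | h2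
        · rw [hmid n h1 h2] at hw ⊢
          rw [gU ⟨w, hw⟩]; exact (h _).2
        · rw [hhigh n h2]; trivial
    have hcm : O.Compat g m := by
      intro w hw
      rw [hσ, hFq, gU ⟨w, hw⟩, g_apply]
      have a1 : θU (O.θ m w) = ⟨w, hw⟩ := Subtype.ext (t3 w hw)
      rw [a1]
      have := sub_mem (hP1 (O.θ m (h ⟨w, hw⟩))) (h (PU (O.θ m w))).2
      convert this using 1; abel
    have hE : O.IsEndo g := by
      refine ⟨?_, hgf, ?_⟩
      · intro w
        rw [g_apply, g_apply, θe2, Pe]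
        have b1 := LinearMap.congr_fun c1 (PU w)
        have b2 := LinearMap.congr_fun c2 (θU w)
        rw [Module.End.mul_apply, Module.End.mul_apply] at b1 b2
        rw [b1, b2, e1_coe, map_add, e2_coe]
        congr 1
        have b3 := t4 (O.e (O.θ m (h (θU w))))
        have b4 := hP2 _ b3
        rw [map_sub, hP3] at b4
        rw [map_sub, sub_eq_sub_iff_sub_eq_sub, ← b4]
      · intro n hn
        by_cases hnm : n = m
        · rw [hnm]; exact hcm
        by_cases hnq : n = q
        · rw [hnq]; exact O.compat_symm hgf hσ hcm
        exact O.compat_triv hgf (hs n hnm hnq).le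
    rcases hloc g hE with ⟨r, hr⟩ | hi
    · left
      refine ⟨r, ?_⟩
      have key : ∀ r : ℕ, ∀ w : U, ((h^r) w : W) = (g^r) w := by
        intro r
        induction r with
        | zero => simp
        | succ r ih =>
          intro w
          rw [pow_succ, Module.End.mul_apply, ih, ← gU, pow_succ, Module.End.mul_apply]
      ext w
      rw [key, hr]; rfl
    · right
      intro a b hab
      apply Subtype.ext
      apply hi
      rw [gU, gU, hab]
  have main := hlemma e1 e2 h11 h22 hl
  let φ : W ≃ₗ[k] U × U := LinearEquiv.ofLinearMap (PU.prod θU)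
    (U.subtype.coprod ((LinearMap.id - P) ∘ₗ O.θ m ∘ₗ U.subtype)) (by
      apply LinearMap.ext
      rintro ⟨v, v'⟩
      apply Prod.ext
      · apply Subtype.ext
        simp [PU_coe, hP2 v v.2, hP2 _ (hP1 _)]
      · apply Subtype.ext
        simp [θU_coe, t2 v v.2, t2 _ (hP1 _), t3 v' v'.2]) (by
      apply LinearMap.ext
      intro w
      have := hP2 _ (t4 w)
      rw [map_sub] at this
      show P w + (O.θ m (O.θ q w) - P (O.θ m (O.θ q w))) = w
      rw [← sub_eq_zero]
      rw [← sub_eq_zero] at this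
      rw [← neg_eq_zero, ← this]; abel)
  have hrk : finrank k (LinearMap.range O.e) =
      finrank k (LinearMap.range e1) + finrank k (LinearMap.range e2) := by
    have h1 : (LinearMap.range O.e).map (φ : W →ₗ[k] U × U) =
        (LinearMap.range e1).prod (LinearMap.range e2) := by
      rw [← LinearMap.range_prodMap]
      ext x
      constructor
      · rintro ⟨_, ⟨w, rfl⟩, rfl⟩
        exact ⟨φ w, Prod.ext (Pe w).symm (θe2 w).symm⟩
      · rintro ⟨y, rfl⟩
        obtain ⟨w, rfl⟩ := φ.surjective y
        exact ⟨O.e w, ⟨w, rfl⟩, Prod.ext (Pe w) (θe2 w)⟩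
    rw [← LinearEquiv.finrank_map_eq φ, ← finrank_submodule_prod, ← h1]
  have hdim : finrank k W = finrank k U + finrank k U := by
    rw [φ.finrank_eq, finrank_prod]
  have := O.rank_null
  rw [hu]
  rw [abs_le] at main
  have : |(finrank k (LinearMap.range O.e) : ℤ) - finrank k (LinearMap.ker O.e)| ≤ 2 := by
    rw [abs_le]; omega
  simpa using this

lemma terminal [FiniteDimensional k W] (hloc : O.Loc)
    (hst : ∀ m, ∀ w ∈ O.F m, O.e w ∈ O.F m) :
    (O.u : ℤ) + |(finrank k (LinearMap.range O.e) : ℤ) - finrank k (LinearMap.ker O.e)| ≤ 2 := by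
  rcases subsingleton_or_nontrivial W with hW | hW
  · have h1 := O.u_le
    have h2 := O.rank_null
    have h3 : finrank k W = 0 := finrank_zero_of_subsingleton
    have : |(finrank k (LinearMap.range O.e) : ℤ) - finrank k (LinearMap.ker O.e)| ≤ 1 := by
      rw [abs_le]; omega
    omega
  · obtain ⟨m, hm⟩ : ∃ m, O.F (m+1) ≠ O.F m := by
      by_contra hcon
      push Not at hcon
      have := O.F_const (Nat.zero_le O.N) (fun n _ _ => hcon n)
      rw [O.FN, O.F0] at this
      exact top_ne_bot this
    have hs := O.terminal_strata hloc hst hm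
    rcases lt_trichotomy m (O.σ m) with h | h | h
    · exact O.terminal_matched hloc hst h rfl hs
    · exact O.terminal_unmatched hloc h.symm (fun n hn => hs n hn (by omega))
    · exact O.terminal_matched hloc hst h (O.invol m) (fun n h1 h2 => hs n h2 h1)

end Obj
end GelfandRed

namespace GelfandRed

open Module

variable {k W : Type} [Field k] [AddCommGroup W] [Module k W]

theorem theoremI_aux (n : ℕ) : ∀ (W : Type) [AddCommGroup W] [Module k W] [FiniteDimensional k W]
    (O : Obj k W), O.Loc → O.μ < n →
    (O.u : ℤ) + |(finrank k (LinearMap.range O.e) : ℤ) - finrank k (LinearMap.ker O.e)| ≤ 2 := by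
  induction n with
  | zero => intro W _ _ _ O _ h; omega
  | succ n ih =>
    intro W _ _ _ O hloc hμ
    classical
    have useref : ∀ {p : ℕ} {X : Submodule k W}, O.F p < X → X < O.F (p+1) → O.Free p X →
        (O.u : ℤ) + |(finrank k (LinearMap.range O.e) : ℤ) - finrank k (LinearMap.ker O.e)| ≤ 2 := by
      intro p X h1 h2 h3
      obtain ⟨O', he, hu, hμ', hl⟩ := O.exists_refine hloc h1 h2 h3
      have := ih W O' hl (by omega)
      rwa [he, hu] at this
    by_cases hst : ∀ m, ∀ w ∈ O.F m, O.e w ∈ O.F m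
    · exact O.terminal hloc hst
    · have hex : ∃ m, ¬ ∀ w ∈ O.F m, O.e w ∈ O.F m := by push Not at hst ⊢; exact hst
      have hne := Nat.find_spec hex
      have hmin := fun m => Nat.find_min hex (m := m)
      have h0 : Nat.find hex ≠ 0 := by
        intro h
        rw [h] at hne
        apply hne
        intro w hw
        rw [O.F0] at hw ⊢
        simp only [Submodule.mem_bot] at hw ⊢
        simp [hw]
      obtain ⟨p, hp⟩ := Nat.exists_eq_succ_of_ne_zero h0
      rw [hp] at hne
      have hstp : ∀ w ∈ O.F p, O.e w ∈ O.F p := by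
        have := hmin p (by omega)
        push Not at this
        exact this
      have hFne : O.F (p+1) ≠ O.F p := by
        intro h
        apply hne
        rw [Nat.succ_eq_add_one, h]; exact hstp
      let X : ℕ → Submodule k W := fun i => O.F (p+1) ⊓ (O.F (i+1)).comap O.e
      have hX : ∀ i w, w ∈ X i ↔ w ∈ O.F (p+1) ∧ O.e w ∈ O.F (i+1) := fun i w => Iff.rfl
      have hex2 : ∃ i, p ≤ i ∧ ¬ X i ≤ O.F p := by
        refine ⟨max p O.N, le_max_left _ _, ?_⟩
        intro h
        apply hFne
        apply le_antisymm _ (O.le_succ p)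
        intro w hw
        apply h
        rw [hX]
        refine ⟨hw, ?_⟩
        apply O.mono (show O.N ≤ max p O.N + 1 by omega)
        rw [O.FN]; trivial
      obtain ⟨hpi, hXi⟩ := Nat.find_spec hex2
      have hmin2 := fun m => Nat.find_min hex2 (m := m)
      set i := Nat.find hex2 with hi
      have hXge : O.F p ≤ X i := by
        intro w hw
        exact ⟨O.le_succ p hw, O.mono (show p ≤ i + 1 by omega) (hstp w hw)⟩
      have hXle : X i ≤ O.F (p+1) := inf_le_left
      by_cases hXe : X i = O.F (p+1)
      · have ha : ∀ w ∈ O.F (p+1), O.e w ∈ O.F (i+1) := by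
          intro w hw
          rw [← hXe] at hw
          exact hw.2
        have hpi' : p < i := by
          rcases Nat.lt_or_eq_of_le hpi with h | h
          · exact h
          · exfalso; apply hne
            rw [← h] at ha; exact ha
        have hb : ∀ w ∈ O.F (p+1), O.e w ∈ O.F i → w ∈ O.F p := by
          intro w hw hew
          have := hmin2 (i-1) (by omega)
          push Not at this
          apply this (by omega)
          rw [hX]
          exact ⟨hw, by rwa [show i - 1 + 1 = i by omega]⟩
        by_cases hZ : O.F (i+1) ≤ O.F i ⊔ (O.F (p+1)).map O.e
        · obtain ⟨D⟩ := O.exists_del hpi' hstp ha hb hZ hFne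
          by_cases h1 : O.σ p = i
          · exact D.caseA hloc h1
          by_cases h2 : O.σ p = p ∧ O.σ i = i
          · exact D.caseB hloc h2.1 h2.2
          have := ih _ (D.obj h1) (D.obj_loc h1 h2 hloc) (by have := D.obj_μ h1; omega)
          rw [D.obj_u h1 h2, D.obj_s h1] at this
          exact this
        · have hle : O.F i ⊔ (O.F (p+1)).map O.e ≤ O.F (i+1) := by
            apply sup_le (O.le_succ i)
            rintro _ ⟨w, hw, rfl⟩
            exact ha w hw
          apply useref (p := i) (X := O.F i ⊔ (O.F (p+1)).map O.e)
          · apply lt_of_le_of_ne le_sup_left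
            intro h
            apply hFne
            apply le_antisymm _ (O.le_succ p)
            intro w hw
            apply hb w hw
            rw [h]
            exact Submodule.mem_sup_right ⟨w, hw, rfl⟩
          · exact lt_of_le_of_ne hle (fun h => hZ h.ge)
          · exact O.free_second hpi' hstp ha
      · apply useref (p := p) (X := X i)
        · exact lt_of_le_of_ne hXge (fun h => hXi h.ge)
        · exact lt_of_le_of_ne hXle hXe
        · exact O.free_first hpi hstp (hX i)

theorem theoremI [FiniteDimensional k W] (O : Obj k W) (hloc : O.Loc) :
    (O.u : ℤ) + |(finrank k (LinearMap.range O.e) : ℤ) - finrank k (LinearMap.ker O.e)| ≤ 2 :=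
  theoremI_aux (O.μ + 1) W O hloc (Nat.lt_succ_self _)

end GelfandRed

namespace GelfandRed

open Module

variable {k V W : Type} [Field k] [AddCommGroup V] [Module k V] [AddCommGroup W] [Module k W]

lemma exists_section (f : V →ₗ[k] W) :
    ∃ s : W →ₗ[k] V, ∀ w ∈ LinearMap.range f, f (s w) = w := by
  obtain ⟨s, hs⟩ := LinearMap.exists_rightInverse_of_surjective f.rangeRestrict
    (LinearMap.range_rangeRestrict f)
  obtain ⟨P, hP1, hP2⟩ := exists_proj (LinearMap.range f)
  refine ⟨s ∘ₗ P.codRestrict _ hP1, ?_⟩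
  intro w hw
  have := congrArg Subtype.val (LinearMap.congr_fun hs (P.codRestrict _ hP1 w))
  simp only [LinearMap.comp_apply, LinearMap.id_apply, LinearMap.codRestrict_apply,
    hP2 w hw] at this
  exact this

/-- The flag attached to a pair of maps. -/
def flag (A : V →ₗ[k] W) (B : W →ₗ[k] V) : ℕ → Submodule k W
  | 0 => ⊥
  | 1 => LinearMap.range (A ∘ₗ B)
  | 2 => LinearMap.range A
  | 3 => LinearMap.ker B
  | 4 => LinearMap.ker (A ∘ₗ B)
  | _ => ⊤

/-- swap of 0 and 4 -/
def sw (n : ℕ) : ℕ := if n = 0 then 4 else if n = 4 then 0 else n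

/-- The object attached to a pair of maps. -/
def pairObj (A : V →ₗ[k] W) (B : W →ₗ[k] V) (hBA : ∀ v, B (A v) = 0) (e : W →ₗ[k] W)
    (he : ∀ w, e (e w) = e w) (S : W →ₗ[k] W)
    (hS : ∀ w ∈ LinearMap.range (A ∘ₗ B), A (B (S w)) = w) : Obj k W where
  e := e
  F := flag A B
  N := 5
  σ := sw
  θ := fun n => if n = 0 then S else if n = 4 then A ∘ₗ B else LinearMap.id
  he := he
  mono := by
    apply monotone_nat_of_le_succ
    rintro (_ | _ | _ | _ | _ | n)
    · exact bot_le
    · rintro _ ⟨w, rfl⟩; exact ⟨B w, rfl⟩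
    · rintro _ ⟨w, rfl⟩; exact hBA w
    · intro w hw
      have : B w = 0 := hw
      show A (B w) = 0
      rw [this, map_zero]
    · exact le_top
    · exact le_top
  F0 := rfl
  FN := rfl
  invol := by rintro (_ | _ | _ | _ | _ | n) <;> simp [sw]
  θmem := by
    rintro (_ | _ | _ | _ | _ | n) w hw
    · trivial
    · exact hw
    · exact hw
    · exact hw
    · exact ⟨w, rfl⟩
    · simpa [sw] using hw
  θlow := by
    rintro (_ | _ | _ | _ | _ | n) w hw
    · have : w = 0 := hw
      rw [this, map_zero]; exact zero_mem _
    · exact hw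
    · exact hw
    · exact hw
    · have : A (B w) = 0 := hw
      show A (B w) = 0
      exact this
    · simpa [sw] using hw
  θinv := by
    rintro (_ | _ | _ | _ | _ | n) w hw
    · show A (B (S w)) - w = 0
      rw [hS w hw, sub_self]
    · simp [sw]
    · simp [sw]
    · simp [sw]
    · show A (B (S (A (B w)) - w)) = 0
      rw [map_sub, map_sub, hS (A (B w)) ⟨w, rfl⟩]
      exact sub_self _
    · simp [sw]
  θfix := by
    rintro (_ | _ | _ | _ | _ | n) hm <;> simp [sw] at hm ⊢

theorem pair_bound [FiniteDimensional k V] [FiniteDimensional k W]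
    (A : V →ₗ[k] W) (B : W →ₗ[k] V) (hBA : ∀ v, B (A v) = 0) (e : W →ₗ[k] W)
    (he : ∀ w, e (e w) = e w)
    (hloc : ∀ (g1 : V →ₗ[k] V) (g : W →ₗ[k] W), (∀ v, A (g1 v) = g (A v)) →
      (∀ w, B (g w) = g1 (B w)) → (∀ w, g (e w) = e (g w)) →
      (IsNilpotent g1 ∧ IsNilpotent g) ∨ (Function.Injective g1 ∧ Function.Injective g)) :
    |2 * (finrank k V : ℤ) - finrank k W| +
      |(finrank k (LinearMap.range e) : ℤ) - finrank k (LinearMap.ker e)| ≤ 2 := by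
  have hre : finrank k (LinearMap.range e) + finrank k (LinearMap.ker e) = finrank k W :=
    LinearMap.finrank_range_add_finrank_ker _
  by_cases hker : LinearMap.ker A ≤ LinearMap.range B
  · obtain ⟨S, hS⟩ := exists_section (A ∘ₗ B)
    let O := pairObj A B hBA e he S hS
    have hL : O.Loc := by
      intro g hg
      have c4 : ∀ w, A (B (g w)) = g (A (B w)) := by
        intro w
        have : A (B (g w)) - g (A (B w)) = 0 := hg.compat 4 (show sw 4 ≠ 4 by decide) w trivial
        exact sub_eq_zero.1 this
      have cA : ∀ v, g (A v) ∈ LinearMap.range A := fun v => hg.filt 2 (A v) ⟨v, rfl⟩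
      have cB : ∀ w, B w = 0 → B (g w) = 0 := fun w hw => hg.filt 3 w hw
      obtain ⟨Q, hQ1, hQ2⟩ := exists_proj (LinearMap.range B)
      obtain ⟨s, hs⟩ := exists_section B
      obtain ⟨r, hr⟩ := exists_section A
      have := hloc (B ∘ₗ g ∘ₗ s ∘ₗ Q + r ∘ₗ g ∘ₗ A ∘ₗ (LinearMap.id - Q)) g (by
        intro v
        simp only [LinearMap.add_apply, LinearMap.comp_apply, LinearMap.sub_apply,
          LinearMap.id_apply]
        rw [map_add, hr _ (cA _), c4, hs _ (hQ1 v), ← map_add, ← map_add]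
        congr 2; abel) (by
        intro w
        simp only [LinearMap.add_apply, LinearMap.comp_apply, LinearMap.sub_apply,
          LinearMap.id_apply]
        rw [hQ2 _ ⟨w, rfl⟩, sub_self]
        have h1 := cB (s (B w) - w) (by rw [map_sub, hs _ ⟨w, rfl⟩, sub_self])
        rw [map_sub, map_sub, sub_eq_zero] at h1
        rw [h1]; simp) hg.comm
      exact this.imp And.right And.right
    have hT := theoremI O hL
    have hOe : O.e = e := rfl
    rw [hOe] at hT
    have hu : O.u = O.d 1 + O.d 2 + O.d 3 := by
      show ∑ m ∈ Finset.range 5, _ = _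
      simp only [Finset.sum_range_succ, Finset.range_zero, Finset.sum_empty]
      have s0 : O.σ 0 ≠ 0 := show sw 0 ≠ 0 by decide
      have s4 : O.σ 4 ≠ 4 := show sw 4 ≠ 4 by decide
      have s1 : O.σ 1 = 1 := show sw 1 = 1 by decide
      have s2 : O.σ 2 = 2 := show sw 2 = 2 by decide
      have s3 : O.σ 3 = 3 := show sw 3 = 3 by decide
      rw [if_neg s0, if_neg s4, if_pos s1, if_pos s2, if_pos s3]
      omega
    have d1 : O.d 1 = finrank k (LinearMap.range A) - finrank k (LinearMap.range (A ∘ₗ B)) := rfl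
    have d2 : O.d 2 = finrank k (LinearMap.ker B) - finrank k (LinearMap.range A) := rfl
    have d3 : O.d 3 = finrank k (LinearMap.ker (A ∘ₗ B)) - finrank k (LinearMap.ker B) := rfl
    have i1 : finrank k (LinearMap.range (A ∘ₗ B)) ≤ finrank k (LinearMap.range A) :=
      Submodule.finrank_mono (O.mono (show 1 ≤ 2 by omega))
    have i2 : finrank k (LinearMap.range A) ≤ finrank k (LinearMap.ker B) :=
      Submodule.finrank_mono (O.mono (show 2 ≤ 3 by omega))
    have i3 : finrank k (LinearMap.ker B) ≤ finrank k (LinearMap.ker (A ∘ₗ B)) :=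
      Submodule.finrank_mono (O.mono (show 3 ≤ 4 by omega))
    have r1 := LinearMap.finrank_range_add_finrank_ker A
    have r2 := LinearMap.finrank_range_add_finrank_ker B
    have r3 := LinearMap.finrank_range_add_finrank_ker (A ∘ₗ B)
    have r4 : finrank k (LinearMap.range (A ∘ₗ B)) + finrank k (LinearMap.ker A) =
        finrank k (LinearMap.range B) := by
      have h1 := LinearMap.finrank_range_add_finrank_ker (A.domRestrict (LinearMap.range B))
      rw [LinearMap.range_domRestrict, ← LinearMap.range_comp, LinearMap.ker_domRestrict] at h1
      rw [← h1]
      congr 1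
      exact (Submodule.comapSubtypeEquivOfLe hker).finrank_eq.symm
    have : |2 * (finrank k V : ℤ) - finrank k W| ≤ O.u := by
      rw [abs_le]; omega
    omega
  · obtain ⟨v, hv1, hv2⟩ := Set.not_subset.1 hker
    obtain ⟨f, hf1, hf2⟩ := Submodule.exists_dual_map_eq_bot_of_notMem hv2 inferInstance
    have hf3 : ∀ w, f (B w) = 0 := by
      intro w
      have : f (B w) ∈ (LinearMap.range B).map f := ⟨B w, ⟨w, rfl⟩, rfl⟩
      rw [hf2] at this
      simpa using this
    have hv3 : A v = 0 := hv1
    rcases hloc (f.smulRight v) 0 (by intro v; simp [hv3]) (by intro w; simp [hf3]) (by simp) with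
      ⟨⟨r, hr⟩, -⟩ | ⟨h1, h2⟩
    · exfalso
      have key : ∀ r : ℕ, ((f.smulRight v)^r) v = (f v)^r • v := by
        intro r
        induction r with
        | zero => simp
        | succ r ih => rw [pow_succ', Module.End.mul_apply, ih]; simp [smul_smul, pow_succ]
      have := key r
      rw [hr] at this
      have h2 : v ≠ 0 := by rintro rfl; simp at hf1
      rcases smul_eq_zero.1 this.symm with h | h
      · exact pow_ne_zero r hf1 h
      · exact h2 h
    · have hW : Subsingleton W := ⟨fun a b => h2 (by simp)⟩
      have hW0 : finrank k W = 0 := finrank_zero_of_subsingleton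
      have hs := LinearMap.injective_iff_surjective.1 h1
      have hV : finrank k V ≤ 1 := by
        apply finrank_le_one v
        intro w
        obtain ⟨w', rfl⟩ := hs w
        exact ⟨f w', rfl⟩
      have : |2 * (finrank k V : ℤ) - finrank k W| ≤ 2 := by rw [abs_le]; omega
      have : |(finrank k (LinearMap.range e) : ℤ) - finrank k (LinearMap.ker e)| ≤ 0 := by
        rw [abs_le]; omega
      omega

end GelfandRed

namespace GelfandRed
open Module

section GOrd
variable {k : Type} [Field k]

/-- The exponents of the Gelfand order. -/
def vex : Fin 3 → Fin 3 → ℕ := ![![0,1,1],![0,0,1],![0,1,0]]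

lemma sg_mem (i j : Fin 3) (f : PowerSeries k) :
    Matrix.single i j (PowerSeries.X ^ (vex i j) * f) ∈ gelfandOrder k := by
  have hX := X_mem_mIdeal k
  fin_cases i <;> fin_cases j <;>
    refine ⟨?_, ?_, ?_, ?_⟩ <;> simp [Matrix.single, vex] <;>
    exact Ideal.mul_mem_right _ _ hX

/-- Normalised matrix units. -/
def sg (i j : Fin 3) : PowerSeries k →ₗ[k] gelfandOrder k where
  toFun f := ⟨Matrix.single i j (PowerSeries.X ^ (vex i j) * f), sg_mem i j f⟩
  map_add' f g := by
    apply Subtype.ext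
    simp [mul_add, Matrix.single_add]
  map_smul' r f := by
    apply Subtype.ext
    simp [Matrix.smul_single]

lemma sg_val (i j : Fin 3) (f : PowerSeries k) :
    (sg i j f : gelfandOrder k).1 = Matrix.single i j (PowerSeries.X ^ (vex i j) * f) := rfl

lemma sg_mul_ne (i j l m : Fin 3) (h : j ≠ l) (f g : PowerSeries k) :
    sg i j f * sg l m g = 0 := by
  apply Subtype.ext
  simp only [MulMemClass.coe_mul, sg_val]
  rw [Matrix.single_mul_single_of_ne _ _ _ _ h]; rfl

lemma vex_le (i j l : Fin 3) : vex i l ≤ vex i j + vex j l := by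
  revert i j l; decide

lemma sg_mul (i j l : Fin 3) (f g : PowerSeries k) :
    sg i j f * sg j l g = sg i l (PowerSeries.X ^ (vex i j + vex j l - vex i l) * (f * g)) := by
  apply Subtype.ext
  simp only [MulMemClass.coe_mul, sg_val]
  rw [Matrix.single_mul_single_same]
  congr 1
  rw [← mul_assoc (PowerSeries.X ^ _) (PowerSeries.X ^ _), ← pow_add,
    Nat.add_sub_cancel' (vex_le i j l), pow_add]
  ring

lemma exists_coord (x : gelfandOrder k) : ∃ f : Fin 3 → Fin 3 → PowerSeries k,
    ∀ i j, x.1 i j = PowerSeries.X ^ (vex i j) * f i j := by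
  have : ∀ i j, ∃ f : PowerSeries k, x.1 i j = PowerSeries.X ^ (vex i j) * f := by
    obtain ⟨h1, h2, h3, h4⟩ := x.2
    simp only [mIdeal, Ideal.mem_span_singleton] at h1 h2 h3 h4
    intro i j
    change (PowerSeries.X ^ (vex i j)) ∣ x.1 i j
    fin_cases i <;> fin_cases j <;> simp [vex] <;> assumption
  choose f hf using this
  exact ⟨f, hf⟩

lemma exists_sum (x : gelfandOrder k) : ∃ f : Fin 3 → Fin 3 → PowerSeries k,
    x = ∑ i, ∑ j, sg i j (f i j) := by
  obtain ⟨f, hf⟩ := exists_coord x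
  refine ⟨f, ?_⟩
  apply Subtype.ext
  rw [Matrix.matrix_eq_sum_single x.1]
  simp [sg_val, hf]

/-- Central scalars. -/
def rho : PowerSeries k →ₐ[k] gelfandOrder k :=
  AlgHom.codRestrict (Matrix.scalarAlgHom (Fin 3) k) (gelfandOrder k) (by
    intro f
    refine ⟨?_, ?_, ?_, ?_⟩ <;> simp [Matrix.scalar, Matrix.diagonal])

lemma rho_val (f : PowerSeries k) : (rho f : gelfandOrder k).1 = Matrix.diagonal (fun _ => f) := rfl

lemma rho_eq (f : PowerSeries k) : rho f = sg 0 0 f + sg 1 1 f + sg 2 2 f := by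
  apply Subtype.ext
  ext i j : 1
  fin_cases i <;> fin_cases j <;> simp [rho_val, sg_val, vex, Matrix.single, Matrix.scalar, Matrix.diagonal]

lemma rho_mul_sg (i j : Fin 3) (f g : PowerSeries k) : rho f * sg i j g = sg i j (f * g) := by
  rw [rho_eq, add_mul, add_mul]
  fin_cases i
  · rw [sg_mul_ne 1 1 _ _ (by decide), sg_mul_ne 2 2 _ _ (by decide)]
    simp [sg_mul, vex]
  · rw [sg_mul_ne 0 0 _ _ (by decide), sg_mul_ne 2 2 _ _ (by decide)]
    simp [sg_mul, vex]
  · rw [sg_mul_ne 0 0 _ _ (by decide), sg_mul_ne 1 1 _ _ (by decide)]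
    simp [sg_mul, vex]

lemma one_eq : (1 : gelfandOrder k) = sg 0 0 1 + sg 1 1 1 + sg 2 2 1 := by
  rw [← rho_eq, map_one]

end GOrd
end GelfandRed

namespace GelfandRed
open Module

section GMod
variable {k : Type} [Field k]
variable (M : Type) [AddCommGroup M] [Module (↥(gelfandOrder k)) M] [Module k M]
    [IsScalarTower k (↥(gelfandOrder k)) M]

/-- The action of the order. -/
def act : gelfandOrder k →ₐ[k] Module.End k M := Algebra.lsmul k k M

lemma act_apply (x : gelfandOrder k) (m : M) : act M x m = x • m := rfl

/-- Dimensions of the vertex spaces. -/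
def dm (k : Type) [Field k] (M : Type) [AddCommGroup M] [Module (↥(gelfandOrder k)) M] [Module k M]
    [IsScalarTower k (↥(gelfandOrder k)) M] (i : Fin 3) : ℕ :=
  finrank k (LinearMap.range (act (k := k) M (sg i i 1)))

lemma nilp [FiniteDimensional k M] : IsNilpotent (act (k := k) M (rho PowerSeries.X)) := by
  set φ : PowerSeries k →ₐ[k] Module.End k M := (act M).comp rho with hφ
  set T : Module.End k M := act M (rho PowerSeries.X) with hT
  have hTφ : T = φ PowerSeries.X := rfl
  have hp : minpoly k T ≠ 0 := minpoly.ne_zero (Algebra.IsIntegral.isIntegral T)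
  obtain ⟨q, hq, hnd⟩ := Polynomial.exists_eq_pow_rootMultiplicity_mul_and_not_dvd _ hp 0
  set n := (minpoly k T).rootMultiplicity 0
  have hae : ∀ p : Polynomial k, φ (p : PowerSeries k) = Polynomial.aeval T p := by
    intro p
    have : φ.comp (Polynomial.coeToPowerSeries.algHom k) = Polynomial.aeval T := by
      apply Polynomial.algHom_ext
      simp [Polynomial.coeToPowerSeries.algHom_apply, hTφ]
    have := DFunLike.congr_fun this p
    simpa [Polynomial.coeToPowerSeries.algHom_apply] using this
  have hunit : IsUnit (q : PowerSeries k) := by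
    rw [PowerSeries.isUnit_iff_constantCoeff]
    simp only [Polynomial.constantCoeff_coe]
    rw [isUnit_iff_ne_zero]
    intro h0
    apply hnd
    simpa [Polynomial.X_dvd_iff] using h0
  have h0 : Polynomial.aeval T (minpoly k T) = 0 := minpoly.aeval k T
  rw [hq] at h0
  simp only [map_zero, sub_zero, map_mul, map_pow, Polynomial.aeval_X] at h0
  rw [← hae] at h0
  refine ⟨n, ?_⟩
  have hu := hunit.map φ
  exact (hu.mul_left_eq_zero).1 h0

lemma rho_comm (g : Module.End k M) [FiniteDimensional k M]
    (hg : Commute g (act (k := k) M (rho PowerSeries.X))) (f : PowerSeries k) :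
    Commute g (act M (rho f)) := by
  obtain ⟨n, hn⟩ := nilp (k := k) M
  rw [PowerSeries.eq_X_pow_mul_shift_add_trunc n f]
  have hp : ∀ p : Polynomial k, Commute g (act M (rho (p : PowerSeries k))) := by
    intro p
    induction p using Polynomial.induction_on' with
    | add p q hp hq => simpa using hp.add_right hq
    | monomial n a =>
      rw [← Polynomial.C_mul_X_pow_eq_monomial]
      simp only [Polynomial.coe_mul, Polynomial.coe_C, Polynomial.coe_pow, Polynomial.coe_X, map_mul, map_pow]
      refine Commute.mul_right ?_ (hg.pow_right n)
      have : (PowerSeries.C a : PowerSeries k) = algebraMap k _ a := rfl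
      rw [this, AlgHom.commutes, AlgHom.commutes]
      exact (Algebra.commutes a g).symm
  simp only [map_add, map_mul, map_pow, hn, zero_mul, zero_add]
  exact hp _

lemma rhoX_eq : (rho PowerSeries.X : gelfandOrder k) = sg 0 1 1 * sg 1 0 1 + sg 1 0 1 * sg 0 1 1
    + sg 2 0 1 * sg 0 2 1 := by
  rw [rho_eq]; simp [sg_mul, vex]

lemma comm_all (g : Module.End k M) [FiniteDimensional k M]
    (h0 : Commute g (act (k := k) M (sg 0 0 1))) (h1 : Commute g (act (k := k) M (sg 1 1 1)))
    (ha : Commute g (act (k := k) M (sg 1 0 1))) (hb : Commute g (act (k := k) M (sg 0 1 1)))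
    (hc : Commute g (act (k := k) M (sg 2 0 1))) (hd : Commute g (act (k := k) M (sg 0 2 1)))
    (x : gelfandOrder k) : Commute g (act M x) := by
  have hX : Commute g (act (k := k) M (rho PowerSeries.X)) := by
    rw [rhoX_eq]
    simp only [map_add, map_mul]
    exact ((hb.mul_right ha).add_right (ha.mul_right hb)).add_right (hc.mul_right hd)
  have h2 : Commute g (act (k := k) M (sg 2 2 1)) := by
    have : (sg 2 2 1 : gelfandOrder k) = 1 - sg 0 0 1 - sg 1 1 1 := by rw [one_eq]; abel
    rw [this]
    simp only [map_sub, map_one]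
    exact ((Commute.one_right g).sub_right h0).sub_right h1
  have h12 : (sg 1 2 1 : gelfandOrder k) = sg 1 0 1 * sg 0 2 1 := by simp [sg_mul, vex]
  have h21 : (sg 2 1 1 : gelfandOrder k) = sg 2 0 1 * sg 0 1 1 := by simp [sg_mul, vex]
  have hu : ∀ i j, Commute g (act (k := k) M (sg i j 1)) := by
    intro i j
    fin_cases i <;> fin_cases j
    · exact h0
    · exact hb
    · exact hd
    · exact ha
    · exact h1
    · show Commute g (act (k := k) M (sg 1 2 1))
      rw [h12, map_mul]; exact ha.mul_right hd
    · exact hc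
    · show Commute g (act (k := k) M (sg 2 1 1))
      rw [h21, map_mul]; exact hc.mul_right hb
    · exact h2
  obtain ⟨f, rfl⟩ := exists_sum x
  rw [map_sum]
  refine Commute.sum_right _ _ _ fun i _ => ?_
  rw [map_sum]
  refine Commute.sum_right _ _ _ fun j _ => ?_
  have : sg i j (f i j) = rho (f i j) * sg i j 1 := by rw [rho_mul_sg, mul_one]
  rw [this, map_mul]
  exact (rho_comm M g hX _).mul_right (hu i j)

lemma endo_local [FiniteDimensional k M] 
    (hM : ∀ A B : Submodule (↥(gelfandOrder k)) M, IsCompl A B → A = ⊥ ∨ B = ⊥)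
    (g : Module.End k M) (hg : ∀ x, Commute g (act (k := k) M x)) :
    IsNilpotent g ∨ Function.Injective g := by
  let G : M →ₗ[gelfandOrder k] M :=
    { toFun := g, map_add' := map_add g, map_smul' := fun x m => DFunLike.congr_fun (hg x) m }
  have hart : IsArtinian (gelfandOrder k) M := isArtinian_of_tower k inferInstance
  have hnoe : IsNoetherian (gelfandOrder k) M := isNoetherian_of_tower k inferInstance
  have hpow : ∀ n m, (G ^ n) m = (g ^ n) m := by
    intro n
    induction n with
    | zero => intro m; rfl
    | succ n ih => intro m; rw [pow_succ, pow_succ, Module.End.mul_apply, Module.End.mul_apply, ih]; rfl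
  obtain ⟨n, hn0, hn⟩ := ((Filter.eventually_ge_atTop 1).and
    (LinearMap.eventually_isCompl_ker_pow_range_pow G)).exists
  rcases hM _ _ hn with h | h
  · right
    rw [LinearMap.ker_eq_bot] at h
    have : Function.Injective (g ^ n) := by
      intro x y hxy
      exact h (by rw [hpow, hpow]; exact hxy)
    obtain ⟨l, rfl⟩ : ∃ l, n = l + 1 := ⟨n - 1, by omega⟩
    intro x y hxy
    apply this
    rw [pow_succ, Module.End.mul_apply, Module.End.mul_apply, hxy]
  · left
    refine ⟨n, ?_⟩
    rw [LinearMap.range_eq_bot] at h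
    ext m
    rw [← hpow, h]; rfl

end GMod
end GelfandRed

namespace GelfandRed
open Module

section GMod2
variable {k : Type} [Field k]
variable (M : Type) [AddCommGroup M] [Module (↥(gelfandOrder k)) M] [Module k M]
    [IsScalarTower k (↥(gelfandOrder k)) M]

lemma act_mul (x y : gelfandOrder k) (m : M) : act M x (act M y m) = act M (x * y) m := by
  rw [map_mul]; rfl

theorem dim_bound [FiniteDimensional k M]
    (hM : ∀ A B : Submodule (↥(gelfandOrder k)) M, IsCompl A B → A = ⊥ ∨ B = ⊥) :
    |2 * (dm k M 0 : ℤ) - (dm k M 1 + dm k M 2)| + |(dm k M 1 : ℤ) - dm k M 2| ≤ 2 := by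
  set e0 : gelfandOrder k := sg 0 0 1 with he0
  set e1 : gelfandOrder k := sg 1 1 1 with he1
  set e2 : gelfandOrder k := sg 2 2 1 with he2
  set p : gelfandOrder k := sg 1 0 1 + sg 2 0 1 with hp
  set q : gelfandOrder k := sg 0 1 1 - sg 0 2 1 with hq
  have n01 : (0 : Fin 3) ≠ 1 := by decide
  have n02 : (0 : Fin 3) ≠ 2 := by decide
  have n12 : (1 : Fin 3) ≠ 2 := by decide
  have e00 : e0 * e0 = e0 := by simp [he0, sg_mul, vex]
  have e11 : e1 * e1 = e1 := by simp [he1, sg_mul, vex]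
  have e22 : e2 * e2 = e2 := by simp [he2, sg_mul, vex]
  have e01 : e0 * e1 = 0 := sg_mul_ne _ _ _ _ n01 _ _
  have e10 : e1 * e0 = 0 := sg_mul_ne _ _ _ _ n01.symm _ _
  have e12 : e1 * e2 = 0 := sg_mul_ne _ _ _ _ n12 _ _
  have e02 : e0 * e2 = 0 := sg_mul_ne _ _ _ _ n02 _ _
  have e0p : e0 * p = 0 := by
    rw [hp, mul_add, sg_mul_ne _ _ _ _ n01, sg_mul_ne _ _ _ _ n02, add_zero]
  have pe0 : p * e0 = p := by simp [hp, he0, add_mul, sg_mul, vex]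
  have e0q : e0 * q = q := by simp [hq, he0, mul_sub, sg_mul, vex]
  have qe0 : q * e0 = 0 := by
    rw [hq, sub_mul, sg_mul_ne _ _ _ _ n01.symm, sg_mul_ne _ _ _ _ n02.symm, sub_zero]
  have qp : q * p = 0 := by
    rw [hq, hp, mul_add, sub_mul, sub_mul, sg_mul_ne _ _ _ _ n12, sg_mul_ne _ _ _ _ n12.symm]
    simp [sg_mul, vex]
  have ha : (sg 1 0 1 : gelfandOrder k) = e1 * p := by
    rw [hp, mul_add, he1, sg_mul_ne _ _ _ _ n12]; simp [sg_mul, vex]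
  have hc : (sg 2 0 1 : gelfandOrder k) = p - e1 * p := by
    rw [← ha, hp]; abel
  have hb : (sg 0 1 1 : gelfandOrder k) = q * e1 := by
    rw [hq, sub_mul, he1, sg_mul_ne _ _ _ _ n12.symm]; simp [sg_mul, vex]
  have hd : (sg 0 2 1 : gelfandOrder k) = q * e1 - q := by
    rw [← hb, hq]; abel
  have hone : (1 : gelfandOrder k) = e0 + e1 + e2 := one_eq
  clear_value e0 e1 e2 p q
  set V := LinearMap.range (act (k := k) M e0) with hV
  set W := LinearMap.ker (act (k := k) M e0) with hW
  have hVe : ∀ v : V, act M e0 v.1 = v.1 := by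
    rintro ⟨v, m, rfl⟩; simp only [act_mul, e00]
  have hWe : ∀ w : W, act M e0 w.1 = 0 := fun w => w.2
  let A : V →ₗ[k] W := LinearMap.codRestrict W ((act M p).comp V.subtype) (by
    intro v; refine LinearMap.mem_ker.2 ?_; simp [act_mul, e0p])
  let B : W →ₗ[k] V := LinearMap.codRestrict V ((act M q).comp W.subtype) (by
    intro v; refine ⟨act M q v.1, ?_⟩; simp [act_mul, e0q])
  let e : W →ₗ[k] W := LinearMap.codRestrict W ((act M e1).comp W.subtype) (by
    intro v; refine LinearMap.mem_ker.2 ?_; simp [act_mul, e01])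
  have hA : ∀ v, (A v).1 = act M p v.1 := fun _ => rfl
  have hB : ∀ v, (B v).1 = act M q v.1 := fun _ => rfl
  have hee : ∀ v, (e v).1 = act M e1 v.1 := fun _ => rfl
  have key := pair_bound A B (by intro v; ext; simp [hA, hB, act_mul, qp]) e
    (by intro v; ext; simp [hee, act_mul, e11]) (by
    intro g1 g hg1 hg2 hg3
    let P0 : M →ₗ[k] V := LinearMap.codRestrict V (act M e0) (fun m => ⟨m, rfl⟩)
    let P1 : M →ₗ[k] W := LinearMap.codRestrict W (LinearMap.id - act M e0) (by
      intro m; refine LinearMap.mem_ker.2 ?_; simp [act_mul, e00])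
    have hP0 : ∀ m, (P0 m).1 = act M e0 m := fun _ => rfl
    have hP1 : ∀ m, (P1 m).1 = m - act M e0 m := fun _ => rfl
    have P0V : ∀ v : V, P0 v.1 = v := fun v => Subtype.ext (hVe v)
    have P0W : ∀ w : W, P0 w.1 = 0 := fun v => Subtype.ext (hWe v)
    have P1V : ∀ v : V, P1 v.1 = 0 := fun v => Subtype.ext (by rw [hP1, hVe, sub_self]; rfl)
    have P1W : ∀ v : W, P1 v.1 = v := fun v => Subtype.ext (by rw [hP1, hWe, sub_zero])
    let G : Module.End k M := V.subtype.comp (g1.comp P0) + W.subtype.comp (g.comp P1)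
    have hG : ∀ m, G m = (g1 (P0 m)).1 + (g (P1 m)).1 := fun _ => rfl
    have GV : ∀ v : V, G v.1 = (g1 v).1 := by
      intro v; rw [hG, P0V, P1V]; simp
    have GW : ∀ v : W, G v.1 = (g v).1 := by
      intro v; rw [hG, P0W, P1W]; simp
    have split : ∀ m : M, m = (P0 m).1 + (P1 m).1 := by
      intro m; rw [hP0, hP1]; abel
    have comm : ∀ x : gelfandOrder k, (∀ v : V, G (act M x v.1) = act M x (G v.1)) →
        (∀ v : W, G (act M x v.1) = act M x (G v.1)) → Commute G (act M x) := by
      intro x h1 h2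
      ext m
      change G (act M x m) = act M x (G m)
      rw [split m]
      simp only [map_add, h1, h2]
    have c0 : Commute G (act M e0) := by
      apply comm
      · intro v; rw [hVe, GV, hVe]
      · intro w; rw [hWe, GW, hWe, map_zero]
    have c1 : Commute G (act M e1) := by
      apply comm
      · intro v
        rw [GV, ← hVe v, ← hVe (g1 v), act_mul, act_mul, e10]; simp
      · intro w
        rw [← hee, GW, GW, ← hee, hg3]
    have cp : Commute G (act M p) := by
      apply comm
      · intro v
        rw [GV, ← hA, GW, ← hA, hg1]
      · intro w
        rw [GW, ← pe0, ← act_mul, hWe, ← act_mul, hWe]; simp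
    have cq : Commute G (act M q) := by
      apply comm
      · intro v
        rw [GV, ← hVe v, ← hVe (g1 v), act_mul, act_mul, qe0]; simp
      · intro w
        rw [GW, ← hB, GV, ← hB, hg2]
    have call := comm_all M G (he0 ▸ c0) (he1 ▸ c1) (by rw [ha, map_mul]; exact c1.mul_right cp)
      (by rw [hb, map_mul]; exact cq.mul_right c1)
      (by rw [hc, map_sub, map_mul]; exact cp.sub_right (c1.mul_right cp))
      (by rw [hd, map_sub, map_mul]; exact (cq.mul_right c1).sub_right cq)
    rcases endo_local M hM G call with ⟨n, hn⟩ | h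
    · left
      have h1 : ∀ n (v : V), (G ^ n) v.1 = ((g1 ^ n) v).1 := by
        intro n
        induction n with
        | zero => intro v; rfl
        | succ n ih => intro v; rw [pow_succ, pow_succ, Module.End.mul_apply, GV, ih]; rfl
      have h2 : ∀ n (v : W), (G ^ n) v.1 = ((g ^ n) v).1 := by
        intro n
        induction n with
        | zero => intro v; rfl
        | succ n ih => intro v; rw [pow_succ, pow_succ, Module.End.mul_apply, GW, ih]; rfl
      refine ⟨⟨n, ?_⟩, ⟨n, ?_⟩⟩
      · ext v; rw [← h1, hn]; rfl
      · ext v; rw [← h2, hn]; rfl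
    · right
      refine ⟨fun x y hxy => ?_, fun x y hxy => ?_⟩
      · apply Subtype.ext; apply h; rw [GV, GV, hxy]
      · apply Subtype.ext; apply h; rw [GW, GW, hxy])
  have hd0 : finrank k V = dm k M 0 := by rw [hV, dm, he0]
  have h1e : finrank k (LinearMap.range e) = dm k M 1 := by
    rw [dm, ← he1]
    have : (LinearMap.range e).map W.subtype = LinearMap.range (act M e1) := by
      ext m
      constructor
      · rintro ⟨_, ⟨w, rfl⟩, rfl⟩
        exact ⟨w.1, rfl⟩
      · rintro ⟨m, rfl⟩
        have hm : act M e1 m ∈ W := by rw [hW, LinearMap.mem_ker]; simp [act_mul, e01]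
        refine ⟨⟨_, hm⟩, ⟨⟨_, hm⟩, ?_⟩, rfl⟩
        ext; simp [hee, act_mul, e11]
    rw [← this]
    exact (Submodule.equivMapOfInjective W.subtype W.injective_subtype _).finrank_eq
  have h2e : finrank k (LinearMap.ker e) = dm k M 2 := by
    rw [dm, ← he2]
    have : (LinearMap.ker e).map W.subtype = LinearMap.range (act M e2) := by
      ext m
      constructor
      · rintro ⟨w, hw, rfl⟩
        refine ⟨w.1, ?_⟩
        have : e2 = 1 - e0 - e1 := by rw [hone]; abel
        rw [this]
        have hw' : act M e1 w.1 = 0 := congrArg Subtype.val hw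
        simp [hWe, hw']
      · rintro ⟨m, rfl⟩
        have hm : act M e2 m ∈ W := by rw [hW, LinearMap.mem_ker]; simp [act_mul, e02]
        refine ⟨⟨_, hm⟩, ?_, rfl⟩
        change e _ = 0
        ext; simp [hee, act_mul, e12]
    rw [← this]
    exact (Submodule.equivMapOfInjective W.subtype W.injective_subtype _).finrank_eq
  have hW2 : finrank k W = dm k M 1 + dm k M 2 := by
    rw [← h1e, ← h2e, LinearMap.finrank_range_add_finrank_ker]
  rw [hd0, h1e, h2e, hW2] at key
  push_cast at key
  exact key

theorem num_bound (x0 x1 x2 y0 y1 y2 : ℤ) (hx : |2 * x0 - (x1 + x2)| + |x1 - x2| ≤ 2)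
    (hy : |2 * y0 - (y1 + y2)| + |y1 - y2| ≤ 2) :
    |(x0 - x1) * (y0 - y1) + (x0 - x2) * (y0 - y2)| ≤ 2 := by
  have aux : ∀ a b c : ℤ, |2 * a - (b + c)| + |b - c| ≤ 2 → |a - b| ≤ 1 ∧ |a - c| ≤ 1 := by
    intro a b c h
    constructor
    · rw [abs_le]; constructor <;> (have := neg_abs_le (2 * a - (b+c)); have := le_abs_self (2 * a - (b+c)); have := neg_abs_le (b - c); have := le_abs_self (b - c); omega)
    · rw [abs_le]; constructor <;> (have := neg_abs_le (2 * a - (b+c)); have := le_abs_self (2 * a - (b+c)); have := neg_abs_le (b - c); have := le_abs_self (b - c); omega)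
  obtain ⟨h1, h2⟩ := aux _ _ _ hx
  obtain ⟨h3, h4⟩ := aux _ _ _ hy
  refine (abs_add_le _ _).trans ?_
  rw [abs_mul, abs_mul]
  have := mul_le_mul h1 h3 (abs_nonneg _) (by norm_num)
  have := mul_le_mul h2 h4 (abs_nonneg _) (by norm_num)
  omega

end GMod2
end GelfandRed

namespace GelfandRed
open Module TensorProduct

section Rows
variable {k : Type} [Field k]
variable {V V' : Type} [AddCommGroup V] [Module k V] [AddCommGroup V'] [Module k V']

def xm (V : Type) [AddCommGroup V] [Module k V] (n : ℕ) :
    PowerSeries k ⊗[k] V →ₗ[k] PowerSeries k ⊗[k] V :=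
  LinearMap.rTensor V (LinearMap.mulLeft k (PowerSeries.X ^ n))

/-- Coefficientwise action on `R ⊗ V`. -/
def lt (g : V →ₗ[k] V') : PowerSeries k ⊗[k] V →ₗ[k] PowerSeries k ⊗[k] V' :=
  LinearMap.lTensor (PowerSeries k) g

lemma xm_tmul (n : ℕ) (f : PowerSeries k) (v : V) : xm V n (f ⊗ₜ[k] v) = (PowerSeries.X ^ n * f) ⊗ₜ[k] v := rfl
lemma lt_tmul (g : V →ₗ[k] V') (f : PowerSeries k) (v : V) : lt g (f ⊗ₜ[k] v) = f ⊗ₜ[k] (g v) := rfl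

lemma xm_zero (z : PowerSeries k ⊗[k] V) : xm V 0 z = z := by
  induction z with
  | zero => simp
  | add x y hx hy => rw [map_add, hx, hy]
  | tmul f v => simp [xm_tmul]

lemma xm_xm (m n : ℕ) (z : PowerSeries k ⊗[k] V) : xm V m (xm V n z) = xm V (m + n) z := by
  induction z with
  | zero => simp
  | add x y hx hy => simp only [map_add, hx, hy]
  | tmul f v => simp [xm_tmul, pow_add, mul_assoc]

lemma lt_xm (g : V →ₗ[k] V') (n : ℕ) (z : PowerSeries k ⊗[k] V) : lt g (xm V n z) = xm V' n (lt g z) := by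
  induction z with
  | zero => simp
  | add x y hx hy => simp only [map_add, hx, hy]
  | tmul f v => simp [xm_tmul, lt_tmul]

lemma lt_lt {V'' : Type} [AddCommGroup V''] [Module k V''] (g : V →ₗ[k] V') (h : V' →ₗ[k] V'')
    (z : PowerSeries k ⊗[k] V) : lt h (lt g z) = lt (h.comp g) z := by
  induction z with
  | zero => simp
  | add x y hx hy => simp only [map_add, hx, hy]
  | tmul f v => simp [lt_tmul]

lemma xm_inj (n : ℕ) : Function.Injective (xm (k := k) V n) := by
  apply Module.Flat.rTensor_preserves_injective_linearMap
  intro f g h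
  exact mul_left_cancel₀ (pow_ne_zero n PowerSeries.X_ne_zero) h

lemma xT_inj (T : V →ₗ[k] V) (n : ℕ) (hT : T ^ n = 0) (z : PowerSeries k ⊗[k] V)
    (h : xm V 1 z = lt T z) : z = 0 := by
  have key : ∀ m, xm V m z = lt (T ^ m) z := by
    intro m
    induction m with
    | zero => rw [xm_zero, pow_zero, lt, Module.End.one_eq_id, LinearMap.lTensor_id]; rfl
    | succ m ih =>
      rw [add_comm, ← xm_xm, ih, ← lt_xm, h, lt_lt, add_comm, pow_succ]; rfl
  apply xm_inj n
  rw [key n, hT, map_zero]; simp [lt]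

lemma xT_decomp (T : V →ₗ[k] V) (n : ℕ) (hT : T ^ n = 0) (z : PowerSeries k ⊗[k] V) :
    ∃ v q, z = (1 : PowerSeries k) ⊗ₜ[k] v + (xm V 1 q - lt T q) := by
  induction z with
  | zero => exact ⟨0, 0, by simp⟩
  | add x y hx hy =>
    obtain ⟨v, q, hx⟩ := hx
    obtain ⟨v', q', hy⟩ := hy
    refine ⟨v + v', q + q', ?_⟩
    rw [hx, hy]; simp only [map_add, TensorProduct.tmul_add]; abel
  | tmul f v =>
    have main : ∀ m (w : V), (T ^ m) w = 0 → ∀ f : PowerSeries k, ∃ v q, f ⊗ₜ[k] w =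
        (1 : PowerSeries k) ⊗ₜ[k] v + (xm V 1 q - lt T q) := by
      intro m
      induction m with
      | zero =>
        intro w hw f
        refine ⟨0, 0, ?_⟩
        have : w = 0 := hw
        simp [this]
      | succ m ih =>
        intro w hw f
        obtain ⟨g, hg⟩ : ∃ g, f = PowerSeries.X * g + PowerSeries.C (PowerSeries.constantCoeff f) :=
          ⟨_, PowerSeries.eq_X_mul_shift_add_const f⟩
        obtain ⟨v, q, h⟩ := ih (T w) (by rw [pow_succ] at hw; exact hw) g
        refine ⟨v + PowerSeries.constantCoeff f • w, g ⊗ₜ w + q, ?_⟩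
        have hC : (PowerSeries.C (PowerSeries.constantCoeff f) : PowerSeries k) =
          PowerSeries.constantCoeff f • (1 : PowerSeries k) := by
          rw [PowerSeries.smul_eq_C_mul, mul_one]
        conv_lhs => rw [hg]
        rw [TensorProduct.add_tmul, hC, TensorProduct.smul_tmul, TensorProduct.tmul_add, map_add, map_add, xm_tmul, pow_one,
          lt_tmul, h]
        abel
    exact main n v (by rw [hT]; rfl) f

end Rows
end GelfandRed

namespace GelfandRed
open Module TensorProduct

section Proj
variable {k : Type} [Field k]

/-- The indecomposable projective `Λ e_i`. -/
def PI (k : Type) [Field k] (i : Fin 3) : Submodule (gelfandOrder k) (gelfandOrder k) where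
  carrier := {x | x * sg i i 1 = x}
  add_mem' := by
    intro x y hx hy
    simp only [Set.mem_ofPred_eq] at *
    rw [add_mul, hx, hy]
  zero_mem' := by simp
  smul_mem' := by
    intro c x hx
    simp only [Set.mem_ofPred_eq] at *
    rw [smul_eq_mul, mul_assoc, hx]

/-- The projective as a type. -/
def PJ (k : Type) [Field k] (i : Fin 3) : Type := PI k i

instance (i : Fin 3) : AddCommGroup (PJ k i) := inferInstanceAs (AddCommGroup (PI k i))
instance (i : Fin 3) : Module (gelfandOrder k) (PJ k i) :=
  inferInstanceAs (Module (gelfandOrder k) (PI k i))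
instance (i : Fin 3) : Module k (PJ k i) := Module.compHom _ (algebraMap k (gelfandOrder k))
instance (i : Fin 3) : IsScalarTower k (gelfandOrder k) (PJ k i) :=
  IsScalarTower.of_algebraMap_smul (fun _ _ => rfl)
instance (i : Fin 3) : SMulCommClass (gelfandOrder k) k (PJ k i) :=
  IsScalarTower.to_smulCommClass'

def rm (i j : Fin 3) (f : PowerSeries k) : PJ k i →ₗ[gelfandOrder k] PJ k j where
  toFun x := ⟨x.1 * sg i j f, by
    show _ * _ = _
    rw [mul_assoc, sg_mul]; simp [vex]
    congr 2
    fin_cases j <;> simp⟩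
  map_add' x y := Subtype.ext (add_mul x.1 y.1 _)
  map_smul' c x := Subtype.ext (mul_assoc c x.1 _)

lemma rm_val (i j : Fin 3) (f : PowerSeries k) (x : PJ k i) : (rm i j f x).1 = x.1 * sg i j f := rfl

instance PJ_projective (i : Fin 3) : Module.Projective (gelfandOrder k) (PJ k i) := by
  refine Module.Projective.of_split (M := gelfandOrder k) (PI k i).subtype
    (LinearMap.codRestrict (PI k i) (LinearMap.toSpanSingleton (gelfandOrder k) (gelfandOrder k) (sg i i 1)) ?_) ?_
  · intro c
    show _ * _ = _
    simp only [LinearMap.toSpanSingleton_apply, smul_eq_mul]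
    rw [mul_assoc, sg_mul]
    fin_cases i <;> simp [vex]
  · apply LinearMap.ext
    intro x
    exact Subtype.ext x.2

/-- Rows of the projectives. -/
def SI (j i : Fin 3) : PowerSeries k →ₗ[k] PJ k i where
  toFun f := ⟨sg j i f, by
    show _ * _ = _
    rw [sg_mul]
    fin_cases i <;> simp [vex]⟩
  map_add' x y := Subtype.ext (map_add _ _ _)
  map_smul' x y := Subtype.ext (by
    change sg j i (x • y) = (algebraMap k (gelfandOrder k) x) * sg j i y
    rw [map_smul, Algebra.smul_def])

lemma SI_val (j i : Fin 3) (f : PowerSeries k) : (SI j i f).1 = sg j i f := rfl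

lemma SI_inj (j i : Fin 3) : Function.Injective (SI (k := k) j i) := by
  intro f g h
  have h := congrArg Subtype.val (congrArg Subtype.val h)
  rw [SI_val, SI_val, sg_val, sg_val] at h
  have h := congrFun (congrFun h j) i
  simp only [Matrix.single_apply_same] at h
  exact mul_left_cancel₀ (pow_ne_zero _ PowerSeries.X_ne_zero) h

lemma exists_row (i j : Fin 3) (x : PJ k i) : ∃ f, (sg j j 1 : gelfandOrder k) • x = SI j i f := by
  obtain ⟨f, hf⟩ := exists_coord x.1
  refine ⟨f j i, ?_⟩
  apply Subtype.ext
  have hx : x.1 * sg i i 1 = x.1 := x.2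
  rw [SI_val]
  change sg j j 1 * x.1 = _
  rw [← hx]
  apply Subtype.ext
  simp only [MulMemClass.coe_mul, sg_val]
  ext a b : 1
  have hv : ∀ l, vex l l = 0 := by decide
  simp only [hv, pow_zero, mul_one, ← hf]
  rw [← mul_assoc, Matrix.single_mul_mul_single]
  simp

end Proj
end GelfandRed

namespace GelfandRed
open Module TensorProduct

section Cplx
variable {k : Type} [Field k]
variable {V V' : Type} [AddCommGroup V] [Module k V] [AddCommGroup V'] [Module k V']

def LT (i : Fin 3) (g : V →ₗ[k] V') : (PJ k i ⊗[k] V) →ₗ[gelfandOrder k] (PJ k i ⊗[k] V') :=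
  TensorProduct.AlgebraTensorModule.map LinearMap.id g

/-- Right multiplication on the first factor. -/
def RT (i j : Fin 3) (V : Type) [AddCommGroup V] [Module k V] :
    (PJ k i ⊗[k] V) →ₗ[gelfandOrder k] (PJ k j ⊗[k] V) :=
  TensorProduct.AlgebraTensorModule.map (rm i j 1) LinearMap.id

/-- Rows. -/
def SG (j i : Fin 3) (V : Type) [AddCommGroup V] [Module k V] :
    (PowerSeries k ⊗[k] V) →ₗ[k] (PJ k i ⊗[k] V) := LinearMap.rTensor V (SI j i)

lemma LT_tmul (i : Fin 3) (g : V →ₗ[k] V') (x : PJ k i) (v : V) : LT i g (x ⊗ₜ[k] v) = x ⊗ₜ[k] g v := rfl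
lemma RT_tmul (i j : Fin 3) (x : PJ k i) (v : V) : RT i j V (x ⊗ₜ[k] v) = (rm i j 1 x) ⊗ₜ[k] v := rfl
lemma SG_tmul (i j : Fin 3) (x : PowerSeries k) (v : V) : SG j i V (x ⊗ₜ[k] v) = (SI j i x) ⊗ₜ[k] v := rfl

lemma SG_inj (j i : Fin 3) : Function.Injective (SG (k := k) j i V) :=
  Module.Flat.rTensor_preserves_injective_linearMap _ (SI_inj j i)

lemma LT_SG (i j : Fin 3) (g : V →ₗ[k] V') (z : PowerSeries k ⊗[k] V) :
    LT i g (SG j i V z) = SG j i V' (lt g z) := by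
  induction z with
  | zero => simp
  | add x y hx hy => simp only [map_add, hx, hy]
  | tmul f v => rw [SG_tmul, LT_tmul, lt_tmul, SG_tmul]

lemma RT_SG (i j l : Fin 3) (z : PowerSeries k ⊗[k] V) :
    RT i l V (SG j i V z) = SG j l V (xm V (vex j i + vex i l - vex j l) z) := by
  induction z with
  | zero => simp
  | add x y hx hy => simp only [map_add, hx, hy]
  | tmul f v =>
    rw [SG_tmul, RT_tmul, xm_tmul, SG_tmul]
    congr 1
    apply Subtype.ext
    rw [rm_val, SI_val, SI_val, sg_mul, mul_one]

lemma LT_LT {V'' : Type} [AddCommGroup V''] [Module k V''] (i : Fin 3) (g : V →ₗ[k] V') (h : V' →ₗ[k] V'')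
    (z : PJ k i ⊗[k] V) : LT i h (LT i g z) = LT i (h.comp g) z := by
  induction z with
  | zero => simp
  | add x y hx hy => simp only [map_add, hx, hy]
  | tmul f v => rw [LT_tmul, LT_tmul, LT_tmul, LinearMap.comp_apply]

lemma LT_RT (i j : Fin 3) (g : V →ₗ[k] V')
    (z : PJ k i ⊗[k] V) : LT j g (RT i j V z) = RT i j V' (LT i g z) := by
  induction z with
  | zero => simp
  | add x y hx hy => simp only [map_add, hx, hy]
  | tmul f v => rw [LT_tmul, RT_tmul, RT_tmul, LT_tmul]

lemma row_rep (j i : Fin 3) (z : PJ k i ⊗[k] V) :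
    ∃ f, (sg j j 1 : gelfandOrder k) • z = SG j i V f := by
  induction z with
  | zero => exact ⟨0, by simp⟩
  | add x y hx hy =>
    obtain ⟨f, hf⟩ := hx
    obtain ⟨g, hg⟩ := hy
    exact ⟨f + g, by rw [smul_add, hf, hg, map_add]⟩
  | tmul x v =>
    obtain ⟨f, hf⟩ := exists_row i j x
    exact ⟨f ⊗ₜ v, by rw [TensorProduct.smul_tmul', hf, SG_tmul]⟩

lemma RTRT (z : PJ k 0 ⊗[k] V) : RT 1 0 V (RT 0 1 V z) = RT 2 0 V (RT 0 2 V z) := by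
  induction z with
  | zero => simp
  | add x y hx hy => simp only [map_add, hx, hy]
  | tmul f v =>
    simp only [RT_tmul]
    congr 1
    apply Subtype.ext
    simp only [rm_val, mul_assoc, sg_mul]
    simp [vex]

/-- Reduction to rows. -/
lemma by_rows {A B C : Type} [AddCommGroup A] [Module (gelfandOrder k) A]
    [AddCommGroup B] [Module (gelfandOrder k) B] [AddCommGroup C] [Module (gelfandOrder k) C]
    (f : A →ₗ[gelfandOrder k] B) (g : B →ₗ[gelfandOrder k] C)
    (h : ∀ j z, g ((sg j j 1 : gelfandOrder k) • z) = 0 → ∃ y, f y = (sg j j 1 : gelfandOrder k) • z)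
    (z : B) (hz : g z = 0) : ∃ y, f y = z := by
  have h' : ∀ j, ∃ y, f y = (sg j j 1 : gelfandOrder k) • z := by
    intro j
    apply h
    rw [map_smul, hz, smul_zero]
  choose y hy using h'
  refine ⟨y 0 + y 1 + y 2, ?_⟩
  rw [map_add, map_add, hy, hy, hy, ← add_smul, ← add_smul, ← one_eq, one_smul]


end Cplx
end GelfandRed

namespace GelfandRed
open Module TensorProduct

section Cplx2
variable {k : Type} [Field k]
variable {V V' : Type} [AddCommGroup V] [Module k V] [AddCommGroup V'] [Module k V']

variable {V0 V1 V2 : Type} [AddCommGroup V0] [Module k V0] [AddCommGroup V1] [Module k V1]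
  [AddCommGroup V2] [Module k V2]
  (a : V0 →ₗ[k] V1) (b : V1 →ₗ[k] V0) (c : V0 →ₗ[k] V2) (d : V2 →ₗ[k] V0)

/-- Degree zero. -/
abbrev C0 (k : Type) [Field k] (V0 V1 V2 : Type) [AddCommGroup V0] [Module k V0] [AddCommGroup V1] [Module k V1]
  [AddCommGroup V2] [Module k V2] : Type := (PJ k 0 ⊗[k] V0) × ((PJ k 1 ⊗[k] V1) × (PJ k 2 ⊗[k] V2))

/-- Degree one: components for the arrows b, a, d, c. -/
abbrev C1 (k : Type) [Field k] (V0 V1 V2 : Type) [AddCommGroup V0] [Module k V0] [AddCommGroup V1] [Module k V1]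
  [AddCommGroup V2] [Module k V2] : Type :=
  ((PJ k 0 ⊗[k] V1) × (PJ k 1 ⊗[k] V0)) × ((PJ k 0 ⊗[k] V2) × (PJ k 2 ⊗[k] V0))

/-- First differential. -/
def D1 : C1 k V0 V1 V2 →ₗ[gelfandOrder k] C0 k V0 V1 V2 where
  toFun x := (RT 1 0 V0 x.1.2 - LT 0 b x.1.1 + RT 2 0 V0 x.2.2 - LT 0 d x.2.1,
    (RT 0 1 V1 x.1.1 - LT 1 a x.1.2, RT 0 2 V2 x.2.1 - LT 2 c x.2.2))
  map_add' x y := by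
    simp only [Prod.fst_add, Prod.snd_add, map_add, Prod.mk_add_mk]
    refine Prod.ext ?_ (Prod.ext ?_ ?_) <;> simp only <;> abel
  map_smul' r x := by
    simp only [Prod.smul_fst, Prod.smul_snd, map_smul, RingHom.id_apply, Prod.smul_mk, smul_sub, smul_add]

/-- Second differential. -/
def D2 : (PJ k 0 ⊗[k] V0) →ₗ[gelfandOrder k] C1 k V0 V1 V2 where
  toFun y := ((LT 0 a y, RT 0 1 V0 y), (- LT 0 c y, - RT 0 2 V0 y))
  map_add' x y := by
    simp only [map_add, Prod.mk_add_mk, neg_add]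
  map_smul' r x := by
    simp only [map_smul, RingHom.id_apply, Prod.smul_mk, smul_neg]

lemma D1_apply (x : C1 k V0 V1 V2) : D1 a b c d x = (RT 1 0 V0 x.1.2 - LT 0 b x.1.1 + RT 2 0 V0 x.2.2 - LT 0 d x.2.1,
    (RT 0 1 V1 x.1.1 - LT 1 a x.1.2, RT 0 2 V2 x.2.1 - LT 2 c x.2.2)) := rfl

lemma D2_apply (y : PJ k 0 ⊗[k] V0) : D2 a c y = ((LT 0 a y, RT 0 1 V0 y), (- LT 0 c y, - RT 0 2 V0 y)) := rfl

lemma D1_D2 (h : b.comp a = d.comp c) (y : PJ k 0 ⊗[k] V0) : D1 a b c d (D2 a c y) = 0 := by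
  rw [D2_apply, D1_apply]
  refine Prod.ext ?_ (Prod.ext ?_ ?_)
  · simp only [map_neg, LT_LT, RTRT, h]; simp; abel
  · simp only [LT_RT]; simp
  · simp only [map_neg, LT_RT]; simp

lemma SG_eq (i j : Fin 3) {x y : PowerSeries k ⊗[k] V} (h : SG j i V x = SG j i V y) : x = y := SG_inj j i h

lemma lt_sub_comp (g : V →ₗ[k] V') (x y : PowerSeries k ⊗[k] V) : lt g (x - y) = lt g x - lt g y := map_sub _ _ _

lemma exact1 (h : b.comp a = d.comp c) (n : ℕ) (hT0 : (b.comp a : V0 →ₗ[k] V0) ^ n = 0)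
    (hT1 : (a.comp b : V1 →ₗ[k] V1) ^ n = 0) (hT2 : (c.comp d : V2 →ₗ[k] V2) ^ n = 0)
    (z : C1 k V0 V1 V2) (hz : D1 a b c d z = 0) : ∃ y, D2 a c y = z := by
  refine by_rows _ _ ?_ z hz
  clear hz z
  rintro j ⟨⟨zb, za⟩, ⟨zd, zc⟩⟩ hz
  simp only [Prod.smul_mk] at hz ⊢
  obtain ⟨xb, hb⟩ := row_rep j 0 zb
  obtain ⟨xa, ha⟩ := row_rep j 1 za
  obtain ⟨xd, hd⟩ := row_rep j 0 zd
  obtain ⟨xc, hc⟩ := row_rep j 2 zc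
  rw [hb, ha, hd, hc] at hz ⊢
  rw [D1_apply] at hz
  simp only [LT_SG, RT_SG, ← map_sub, ← map_add] at hz
  obtain ⟨h0, hz'⟩ := Prod.ext_iff.1 hz
  obtain ⟨h1, h2⟩ := Prod.ext_iff.1 hz'
  clear hz hz'
  simp only [Prod.fst_zero, Prod.snd_zero] at h0 h1 h2
  replace h0 := SG_eq _ _ (h0.trans (map_zero (SG j 0 V0)).symm)
  replace h1 := SG_eq _ _ (h1.trans (map_zero (SG j 1 V1)).symm)
  replace h2 := SG_eq _ _ (h2.trans (map_zero (SG j 2 V2)).symm)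
  clear ha hb hc hd za zb zc zd
  have hcomp : ∀ z, lt b (lt a z) = lt d (lt c z) := by
    intro z; rw [lt_lt, lt_lt, h]
  fin_cases j
  · simp [vex, xm_zero] at h0 h1 h2
    rw [sub_eq_zero] at h1 h2
    subst h1; subst h2
    have : xa + xc = 0 := by
      refine xT_inj (b.comp a) n hT0 _ ?_
      rw [← lt_lt, ← sub_eq_zero, ← h0]
      simp only [map_add, hcomp]; abel
    obtain rfl : xc = - xa := by rw [← sub_eq_zero, sub_neg_eq_add, add_comm]; exact this
    refine ⟨SG 0 0 V0 xa, ?_⟩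
    rw [D2_apply]
    simp [LT_SG, RT_SG, vex, xm_zero]
  · simp [vex, xm_zero] at h0 h1 h2
    rw [sub_eq_zero] at h2
    subst h2
    have hxa : xa = lt b xb - xm V0 1 xc + lt d (lt c xc) := by
      rw [← sub_eq_zero, ← h0]; abel
    have : xb + lt a xc = 0 := by
      refine xT_inj (a.comp b) n hT1 _ ?_
      rw [← lt_lt, ← sub_eq_zero, ← h1, hxa]
      simp only [map_add, map_sub, hcomp, lt_xm]; abel
    obtain rfl : xb = - lt a xc := eq_neg_of_add_eq_zero_left this
    obtain rfl : xa = - xm V0 1 xc := by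
      rw [hxa, map_neg, hcomp]; abel
    refine ⟨SG 1 0 V0 (-xc), ?_⟩
    rw [D2_apply]
    simp [LT_SG, RT_SG, vex, xm_zero]
  · simp [vex, xm_zero] at h0 h1 h2
    rw [sub_eq_zero] at h1
    subst h1
    have hxc : xc = lt d xd - xm V0 1 xa + lt b (lt a xa) := by
      rw [← sub_eq_zero, ← h0]; abel
    have : xd + lt c xa = 0 := by
      refine xT_inj (c.comp d) n hT2 _ ?_
      rw [← lt_lt, ← sub_eq_zero, ← h2, hxc]
      simp only [map_add, map_sub, hcomp, lt_xm]; abel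
    obtain rfl : xd = - lt c xa := eq_neg_of_add_eq_zero_left this
    obtain rfl : xc = - xm V0 1 xa := by
      rw [hxc, map_neg, hcomp]; abel
    refine ⟨SG 2 0 V0 xa, ?_⟩
    rw [D2_apply]
    simp [LT_SG, RT_SG, vex, xm_zero]

lemma exact2 (y : PJ k 0 ⊗[k] V0) (hy : D2 a c y = 0) : y = 0 := by
  obtain ⟨w, hw⟩ := by_rows (0 : (PJ k 0 ⊗[k] V0) →ₗ[gelfandOrder k] (PJ k 0 ⊗[k] V0)) (D2 a c) (by
    intro j z hz
    refine ⟨0, ?_⟩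
    obtain ⟨x, hx⟩ := row_rep j 0 z
    rw [hx] at hz ⊢
    rw [D2_apply] at hz
    obtain ⟨h1, h2⟩ := Prod.ext_iff.1 hz
    replace h1 := (Prod.ext_iff.1 h1).2
    simp only [Prod.fst_zero, Prod.snd_zero, RT_SG] at h1
    replace h1 := SG_eq _ _ (h1.trans (map_zero (SG j 1 V0)).symm)
    have : x = 0 := xm_inj _ (h1.trans (map_zero _).symm)
    simp [this]) y hy
  rw [← hw]; rfl

lemma exact0 {M : Type} [AddCommGroup M] [Module (gelfandOrder k) M]
    (n : ℕ) (hT0 : (b.comp a : V0 →ₗ[k] V0) ^ n = 0)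
    (hT1 : (a.comp b : V1 →ₗ[k] V1) ^ n = 0) (hT2 : (c.comp d : V2 →ₗ[k] V2) ^ n = 0)
    (ε : C0 k V0 V1 V2 →ₗ[gelfandOrder k] M) (hε : ∀ x, ε (D1 a b c d x) = 0)
    (he0 : ∀ v, ε ((SI 0 0 1) ⊗ₜ v, (0, 0)) = 0 → v = 0)
    (he1 : ∀ v, ε (0, ((SI 1 1 1) ⊗ₜ v, 0)) = 0 → v = 0)
    (he2 : ∀ v, ε (0, (0, (SI 2 2 1) ⊗ₜ v)) = 0 → v = 0)
    (z : C0 k V0 V1 V2) (hz : ε z = 0) : ∃ y, D1 a b c d y = z := by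
  refine by_rows _ _ ?_ z hz
  clear hz z
  rintro j ⟨z0, ⟨z1, z2⟩⟩ hz
  simp only [Prod.smul_mk] at hz ⊢
  obtain ⟨f0, h0⟩ := row_rep j 0 z0
  obtain ⟨f1, h1⟩ := row_rep j 1 z1
  obtain ⟨f2, h2⟩ := row_rep j 2 z2
  rw [h0, h1, h2] at hz ⊢
  clear h0 h1 h2 z0 z1 z2
  fin_cases j
  · obtain ⟨v, q, hv⟩ := xT_decomp (b.comp a) n hT0 (f0 + lt b f1 + lt d f2)
    have key : D1 a b c d ((SG 0 0 V1 (f1 + lt a q), SG 0 1 V0 q), (SG 0 0 V2 f2, 0)) +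
        ((SI 0 0 1) ⊗ₜ v, (0, 0)) = (SG 0 0 V0 f0, SG 0 1 V1 f1, SG 0 2 V2 f2) := by
      rw [D1_apply]
      refine Prod.ext ?_ (Prod.ext ?_ ?_)
      · simp only [Prod.fst_add, LT_SG, RT_SG, ← SG_tmul, map_zero, add_zero, ← map_sub, ← map_add]
        congr 1
        have : f0 = (1 : PowerSeries k) ⊗ₜ[k] v + (xm V0 1 q - lt (b.comp a) q) - lt b f1 - lt d f2 := by
          rw [← hv]; abel
        rw [this, ← lt_lt]; simp [vex]; abel
      · simp [LT_SG, RT_SG, vex, xm_zero]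
      · simp [LT_SG, RT_SG, vex, xm_zero]
    have hv0 : v = 0 := by
      apply he0
      have := congrArg ε key
      rw [map_add, hε, zero_add] at this
      rw [this]; exact hz
    refine ⟨((SG 0 0 V1 (f1 + lt a q), SG 0 1 V0 q), (SG 0 0 V2 f2, 0)), ?_⟩
    rw [hv0, TensorProduct.tmul_zero] at key
    exact (add_zero _).symm.trans key
  · obtain ⟨v, q, hv⟩ := xT_decomp (a.comp b) n hT1 (f1 + lt a (f0 + lt d f2))
    have key : D1 a b c d ((SG 1 0 V1 q, SG 1 1 V0 (f0 + lt d f2 + lt b q)), (SG 1 0 V2 f2, 0)) +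
        (0, ((SI 1 1 1) ⊗ₜ v, 0)) = (SG 1 0 V0 f0, SG 1 1 V1 f1, SG 1 2 V2 f2) := by
      rw [D1_apply]
      refine Prod.ext ?_ (Prod.ext ?_ ?_)
      · simp [LT_SG, RT_SG, vex, xm_zero]
      · simp only [Prod.fst_add, Prod.snd_add, LT_SG, RT_SG, ← SG_tmul, map_zero, add_zero, ← map_sub, ← map_add]
        congr 1
        have : f1 = (1 : PowerSeries k) ⊗ₜ[k] v + (xm V1 1 q - lt (a.comp b) q) - lt a (f0 + lt d f2) := by
          rw [← hv]; abel
        rw [this, ← lt_lt]; simp [vex]; abel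
      · simp [LT_SG, RT_SG, vex, xm_zero]
    have hv0 : v = 0 := by
      apply he1
      have := congrArg ε key
      rw [map_add, hε, zero_add] at this
      rw [this]; exact hz
    refine ⟨((SG 1 0 V1 q, SG 1 1 V0 (f0 + lt d f2 + lt b q)), (SG 1 0 V2 f2, 0)), ?_⟩
    rw [hv0, TensorProduct.tmul_zero] at key
    exact (add_zero _).symm.trans key
  · obtain ⟨v, q, hv⟩ := xT_decomp (c.comp d) n hT2 (f2 + lt c (f0 + lt b f1))
    have key : D1 a b c d ((SG 2 0 V1 f1, 0), (SG 2 0 V2 q, SG 2 2 V0 (f0 + lt b f1 + lt d q))) +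
        (0, (0, (SI 2 2 1) ⊗ₜ v)) = (SG 2 0 V0 f0, SG 2 1 V1 f1, SG 2 2 V2 f2) := by
      rw [D1_apply]
      refine Prod.ext ?_ (Prod.ext ?_ ?_)
      · simp [LT_SG, RT_SG, vex, xm_zero]; abel
      · simp [LT_SG, RT_SG, vex, xm_zero]
      · simp only [Prod.fst_add, Prod.snd_add, LT_SG, RT_SG, ← SG_tmul, map_zero, add_zero, ← map_sub, ← map_add]
        congr 1
        have : f2 = (1 : PowerSeries k) ⊗ₜ[k] v + (xm V2 1 q - lt (c.comp d) q) - lt c (f0 + lt b f1) := by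
          rw [← hv]; abel
        rw [this, ← lt_lt]; simp [vex]; abel
    have hv0 : v = 0 := by
      apply he2
      have := congrArg ε key
      rw [map_add, hε, zero_add] at this
      rw [this]; exact hz
    refine ⟨((SG 2 0 V1 f1, 0), (SG 2 0 V2 q, SG 2 2 V0 (f0 + lt b f1 + lt d q))), ?_⟩
    rw [hv0, TensorProduct.tmul_zero] at key
    exact (add_zero _).symm.trans key

end Cplx2
end GelfandRed

namespace GelfandRed
open Module TensorProduct

section Conc
variable {k : Type} [Field k]
variable (M : Type) [AddCommGroup M] [Module (↥(gelfandOrder k)) M] [Module k M]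
    [IsScalarTower k (↥(gelfandOrder k)) M]

/-- Vertex spaces. -/
abbrev VS (k : Type) [Field k] (M : Type) [AddCommGroup M] [Module (↥(gelfandOrder k)) M] [Module k M]
    [IsScalarTower k (↥(gelfandOrder k)) M] (i : Fin 3) : Submodule k M :=
  LinearMap.range (act (k := k) M (sg i i 1))

lemma sg_left (i j : Fin 3) (f : PowerSeries k) : sg i i 1 * sg i j f = sg i j f := by
  rw [sg_mul]; fin_cases i <;> simp [vex]

lemma sg_right (i j : Fin 3) (f : PowerSeries k) : sg i j f * sg j j 1 = sg i j f := by
  rw [sg_mul]; fin_cases j <;> simp [vex]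

lemma VS_fix (i : Fin 3) (v : VS k M i) : (sg i i 1 : gelfandOrder k) • (v : M) = v := by
  obtain ⟨v, m, rfl⟩ := v
  simp only [act_apply, ← mul_smul, sg_left]

/-- Arrow `i → j` acting by the `(j,i)` matrix unit. -/
def arr (j i : Fin 3) : VS k M i →ₗ[k] VS k M j :=
  LinearMap.codRestrict _ ((act (k := k) M (sg j i 1)).comp (VS k M i).subtype) (by
    intro v
    refine ⟨(sg j i 1 : gelfandOrder k) • (v : M), ?_⟩
    simp only [act_apply, ← mul_smul, sg_left, LinearMap.comp_apply, Submodule.subtype_apply])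

lemma arr_val (j i : Fin 3) (v : VS k M i) : (arr M j i v : M) = (sg j i 1 : gelfandOrder k) • (v : M) := rfl

lemma rho_sgv (i : Fin 3) (x : gelfandOrder k) (hx : x = rho PowerSeries.X * sg i i 1) (v : VS k M i) :
    x • (v : M) = act (k := k) M (rho PowerSeries.X) v := by
  rw [act_apply, hx, mul_smul, VS_fix]

lemma r0 : sg 0 1 1 * sg 1 0 1 = (rho PowerSeries.X : gelfandOrder k) * sg 0 0 1 := by
  rw [rhoX_eq, add_mul, add_mul, mul_assoc, mul_assoc, mul_assoc, sg_right,
    sg_mul_ne 0 1 0 0 (by decide), sg_mul_ne 0 2 0 0 (by decide)]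
  simp
lemma r0' : sg 0 2 1 * sg 2 0 1 = (rho PowerSeries.X : gelfandOrder k) * sg 0 0 1 := by
  rw [← r0, sg_mul, sg_mul]; simp [vex]
lemma r1 : sg 1 0 1 * sg 0 1 1 = (rho PowerSeries.X : gelfandOrder k) * sg 1 1 1 := by
  rw [rhoX_eq, add_mul, add_mul, mul_assoc, mul_assoc, mul_assoc, sg_right,
    sg_mul_ne 1 0 1 1 (by decide), sg_mul_ne 0 2 1 1 (by decide)]
  simp
lemma r2 : sg 2 0 1 * sg 0 2 1 = (rho PowerSeries.X : gelfandOrder k) * sg 2 2 1 := by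
  rw [rhoX_eq, add_mul, add_mul, mul_assoc, mul_assoc, mul_assoc, sg_right,
    sg_mul_ne 1 0 2 2 (by decide), sg_mul_ne 0 1 2 2 (by decide)]
  simp

lemma pow_of (i : Fin 3) (T : VS k M i →ₗ[k] VS k M i) (hT : ∀ v, (T v : M) = act (k := k) M (rho PowerSeries.X) v)
    (n : ℕ) (hn : (act (k := k) M (rho PowerSeries.X)) ^ n = 0) : T ^ n = 0 := by
  have h : ∀ n v, ((T ^ n) v : M) = ((act (k := k) M (rho PowerSeries.X)) ^ n) v := by
    intro n
    induction n with
    | zero => intro v; rfl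
    | succ n ih => intro v; rw [pow_succ, pow_succ, Module.End.mul_apply, Module.End.mul_apply, ih, hT]
  ext v
  rw [h, hn]; rfl

/-- Evaluation `Λ e_i ⊗ V → M`. -/
def ev (i : Fin 3) : (PJ k i ⊗[k] VS k M i) →ₗ[gelfandOrder k] M :=
  TensorProduct.AlgebraTensorModule.lift
    { toFun := fun x =>
        { toFun := fun v => x.1 • (v : M)
          map_add' := fun v w => by simp
          map_smul' := fun r v => by
            simp only [Submodule.coe_smul, RingHom.id_apply]
            rw [smul_comm] }
      map_add' := fun x y => by
        ext v; exact add_smul x.1 y.1 (v : M)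
      map_smul' := fun r x => by
        ext v; exact mul_smul r x.1 (v : M) }

lemma ev_tmul (i : Fin 3) (x : PJ k i) (v : VS k M i) : ev M i (x ⊗ₜ[k] v) = x.1 • (v : M) := rfl

/-- The augmentation. -/
def eps : C0 k (VS k M 0) (VS k M 1) (VS k M 2) →ₗ[gelfandOrder k] M :=
  (ev M 0).coprod ((ev M 1).coprod (ev M 2))

lemma eps_apply (x : C0 k (VS k M 0) (VS k M 1) (VS k M 2)) :
    eps M x = ev M 0 x.1 + (ev M 1 x.2.1 + ev M 2 x.2.2) := rfl

lemma ev_comm (i j : Fin 3) (z : PJ k i ⊗[k] VS k M j) :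
    ev M j (RT i j (VS k M j) z) = ev M i (LT i (arr M i j) z) := by
  induction z with
  | zero => simp
  | add x y hx hy => simp only [map_add, hx, hy]
  | tmul x v => rw [RT_tmul, LT_tmul, ev_tmul, ev_tmul, rm_val, arr_val, mul_smul]

lemma eps_D1 (x) : eps (k := k) M (D1 (arr M 1 0) (arr M 0 1) (arr M 2 0) (arr M 0 2) x) = 0 := by
  rw [D1_apply, eps_apply]
  simp only [map_add, map_sub, ev_comm]
  abel

lemma eps_surj : Function.Surjective (eps (k := k) M) := by
  intro m
  refine ⟨((SI 0 0 1) ⊗ₜ ⟨_, m, rfl⟩, ((SI 1 1 1) ⊗ₜ ⟨_, m, rfl⟩, (SI 2 2 1) ⊗ₜ ⟨_, m, rfl⟩)), ?_⟩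
  rw [eps_apply]
  simp only [ev_tmul, SI_val, act_apply, ← mul_smul, sg_left]
  rw [← add_smul, ← add_smul, ← add_assoc, ← one_eq, one_smul]

/-- The full exactness package. -/
lemma package [FiniteDimensional k M] :
    (∀ y, D1 (arr M 1 0) (arr (k := k) M 0 1) (arr M 2 0) (arr M 0 2) (D2 (arr M 1 0) (arr M 2 0) y) = 0) ∧
    (∀ z, D1 (arr M 1 0) (arr (k := k) M 0 1) (arr M 2 0) (arr M 0 2) z = 0 → ∃ y, D2 (arr M 1 0) (arr M 2 0) y = z) ∧
    (∀ z, eps (k := k) M z = 0 → ∃ y, D1 (arr M 1 0) (arr (k := k) M 0 1) (arr M 2 0) (arr M 0 2) y = z) := by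
  obtain ⟨n, hn⟩ := nilp (k := k) M
  have h0 : ∀ v, ((((arr (k := k) M 0 1).comp (arr M 1 0)) v : VS k M 0) : M) = act (k := k) M (rho PowerSeries.X) v := by
    intro v
    rw [LinearMap.comp_apply, arr_val, arr_val, ← mul_smul, rho_sgv M 0 _ r0]
  have h0' : ∀ v, ((((arr (k := k) M 0 2).comp (arr M 2 0)) v : VS k M 0) : M) = act (k := k) M (rho PowerSeries.X) v := by
    intro v
    rw [LinearMap.comp_apply, arr_val, arr_val, ← mul_smul, rho_sgv M 0 _ r0']
  have h1 : ∀ v, ((((arr (k := k) M 1 0).comp (arr M 0 1)) v : VS k M 1) : M) = act (k := k) M (rho PowerSeries.X) v := by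
    intro v
    rw [LinearMap.comp_apply, arr_val, arr_val, ← mul_smul, rho_sgv M 1 _ r1]
  have h2 : ∀ v, ((((arr (k := k) M 2 0).comp (arr M 0 2)) v : VS k M 2) : M) = act (k := k) M (rho PowerSeries.X) v := by
    intro v
    rw [LinearMap.comp_apply, arr_val, arr_val, ← mul_smul, rho_sgv M 2 _ r2]
  have hcomm : (arr (k := k) M 0 1).comp (arr M 1 0) = (arr M 0 2).comp (arr M 2 0) := by
    ext v
    rw [h0, h0']
  have p0 := pow_of M 0 _ h0 n hn
  have p1 := pow_of M 1 _ h1 n hn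
  have p2 := pow_of M 2 _ h2 n hn
  refine ⟨D1_D2 _ _ _ _ hcomm, exact1 _ _ _ _ hcomm n p0 p1 p2, ?_⟩
  refine exact0 _ _ _ _ n p0 p1 p2 (eps M) (eps_D1 M) ?_ ?_ ?_
  · intro v hv
    rw [eps_apply] at hv
    simp only [ev_tmul, SI_val, map_zero, add_zero, VS_fix] at hv
    exact Subtype.ext hv
  · intro v hv
    rw [eps_apply] at hv
    simp only [ev_tmul, SI_val, map_zero, add_zero, zero_add, VS_fix] at hv
    exact Subtype.ext hv
  · intro v hv
    rw [eps_apply] at hv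
    simp only [ev_tmul, SI_val, map_zero, add_zero, zero_add, VS_fix] at hv
    exact Subtype.ext hv

variable (N : Type) [AddCommGroup N] [Module (↥(gelfandOrder k)) N] [Module k N]
    [IsScalarTower k (↥(gelfandOrder k)) N]
variable (V : Type) [AddCommGroup V] [Module k V]

instance smc : SMulCommClass (gelfandOrder k) k N := IsScalarTower.to_smulCommClass'

def homEquiv (i : Fin 3) : ((PJ k i ⊗[k] V) →ₗ[gelfandOrder k] N) ≃ₗ[k] (V →ₗ[k] VS k N i) where
  toFun φ :=
    { toFun := fun v => ⟨φ ((SI i i 1) ⊗ₜ v), φ ((SI i i 1) ⊗ₜ v), by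
        rw [act_apply, ← map_smul, TensorProduct.smul_tmul']
        congr 2
        exact Subtype.ext (sg_left i i 1)⟩
      map_add' := fun v w => Subtype.ext (by
        simp only [TensorProduct.tmul_add, map_add]; rfl)
      map_smul' := fun r v => Subtype.ext (by
        simp only [RingHom.id_apply, Submodule.coe_smul]
        rw [← algebraMap_smul (gelfandOrder k) r (φ _), ← map_smul, algebraMap_smul, TensorProduct.tmul_smul]) }
  map_add' φ ψ := rfl
  map_smul' r φ := rfl
  invFun g := (ev N i).comp (LT i g)
  left_inv φ := by
    apply LinearMap.ext
    intro z
    induction z with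
    | zero => simp
    | add x y hx hy => simp only [map_add, hx, hy]
    | tmul x v =>
      rw [LinearMap.comp_apply, LT_tmul, ev_tmul]
      change x.1 • φ _ = _
      rw [← map_smul, TensorProduct.smul_tmul']
      congr 2
      exact Subtype.ext x.2
  right_inv g := by
    ext v
    change ((ev N i).comp (LT i g)) ((SI i i 1) ⊗ₜ[k] v) = _
    rw [LinearMap.comp_apply]
    rw [LT_tmul, ev_tmul, SI_val, VS_fix]

lemma hom_finrank [FiniteDimensional k N] [FiniteDimensional k V] (i : Fin 3) :
    finrank k ((PJ k i ⊗[k] V) →ₗ[gelfandOrder k] N) = finrank k V * dm k N i := by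
  rw [(homEquiv N V i).finrank_eq, Module.finrank_linearMap]; rfl

instance hom_fin [FiniteDimensional k N] [FiniteDimensional k V] (i : Fin 3) :
    FiniteDimensional k ((PJ k i ⊗[k] V) →ₗ[gelfandOrder k] N) :=
  (homEquiv N V i).symm.finiteDimensional

lemma prod_hom (A B : Type) [AddCommGroup A] [AddCommGroup B] [Module (gelfandOrder k) A] [Module (gelfandOrder k) B]
    [FiniteDimensional k (A →ₗ[gelfandOrder k] N)] [FiniteDimensional k (B →ₗ[gelfandOrder k] N)] :
    FiniteDimensional k (A × B →ₗ[gelfandOrder k] N) ∧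
    finrank k (A × B →ₗ[gelfandOrder k] N) = finrank k (A →ₗ[gelfandOrder k] N) + finrank k (B →ₗ[gelfandOrder k] N) := by
  have e : ((A →ₗ[gelfandOrder k] N) × (B →ₗ[gelfandOrder k] N)) ≃ₗ[k] (A × B →ₗ[gelfandOrder k] N) :=
    LinearMap.coprodEquiv k
  exact ⟨e.finiteDimensional, by rw [← e.finrank_eq, Module.finrank_prod]⟩

end Conc
end GelfandRed

namespace GelfandRed
open Module

section ExtG
open CategoryTheory CategoryTheory.Limits
variable {L : Type} [Ring L]
variable {A0 A1 A2 M : Type} [AddCommGroup A0] [AddCommGroup A1] [AddCommGroup A2] [AddCommGroup M]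
  [Module L A0] [Module L A1] [Module L A2] [Module L M]

/-- Objects of the resolution. -/
def rX (L A0 A1 A2 : Type) [Ring L] [AddCommGroup A0] [AddCommGroup A1] [AddCommGroup A2]
  [Module L A0] [Module L A1] [Module L A2] : ℕ → ModuleCat.{0} L
  | 0 => ModuleCat.of L A0
  | 1 => ModuleCat.of L A1
  | 2 => ModuleCat.of L A2
  | _ + 3 => ModuleCat.of L PUnit

/-- Differentials. -/
def rd (f : A1 →ₗ[L] A0) (g : A2 →ₗ[L] A1) : ∀ n, rX L A0 A1 A2 (n + 1) ⟶ rX L A0 A1 A2 n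
  | 0 => ModuleCat.ofHom f
  | 1 => ModuleCat.ofHom g
  | _ + 2 => 0

/-- The complex. -/
def rC (f : A1 →ₗ[L] A0) (g : A2 →ₗ[L] A1) (h : ∀ y, f (g y) = 0) : ChainComplex (ModuleCat.{0} L) ℕ :=
  ChainComplex.of (rX L A0 A1 A2) (rd f g) (by
    rintro (_ | n)
    · ext y; exact h y
    · exact zero_comp)

variable (f : A1 →ₗ[L] A0) (g : A2 →ₗ[L] A1) (h : ∀ y, f (g y) = 0)

lemma rC_X (n : ℕ) : (rC f g h).X n = rX L A0 A1 A2 n := rfl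
lemma rC_d (n : ℕ) : (rC f g h).d (n + 1) n = rd f g n := ChainComplex.of_d _ _ _

lemma rC_proj [Module.Projective L A0] [Module.Projective L A1] [Module.Projective L A2] (n : ℕ) :
    CategoryTheory.Projective ((rC f g h).X n) := by
  rcases n with (_ | _ | _ | n)
  · exact ModuleCat.projective_of_categoryTheory_projective (P := ModuleCat.of L A0)
  · exact ModuleCat.projective_of_categoryTheory_projective (P := ModuleCat.of L A1)
  · exact ModuleCat.projective_of_categoryTheory_projective (P := ModuleCat.of L A2)
  · exact ModuleCat.projective_of_categoryTheory_projective (P := ModuleCat.of L PUnit)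

/-- Augmentation. -/
def rpi (e : A0 →ₗ[L] M) (h0 : ∀ y, e (f y) = 0) :
    rC f g h ⟶ (ChainComplex.single₀ (ModuleCat.{0} L)).obj (ModuleCat.of L M) :=
  (ChainComplex.toSingle₀Equiv _ _).symm ⟨ModuleCat.ofHom e, by
    rw [rC_d]; ext y; exact h0 y⟩

lemma rC_exact_succ (h1 : ∀ z, f z = 0 → ∃ y, g y = z) (h2 : ∀ y, g y = 0 → y = 0) (n : ℕ) :
    (rC f g h).ExactAt (n + 1) := by
  rw [HomologicalComplex.exactAt_iff' _ (n + 2) (n + 1) n (by simp) (by simp), ShortComplex.moduleCat_exact_iff]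
  intro x hx
  change ((rC f g h).d (n+1) n) x = 0 at hx
  change ∃ y, ((rC f g h).d (n+1+1) (n+1)) y = x
  rw [rC_d] at hx ⊢
  rcases n with (_ | _ | n)
  · exact h1 x hx
  · exact ⟨0, (map_zero _).trans (h2 x hx).symm⟩
  · exact ⟨0, Subsingleton.elim (α := PUnit) _ _⟩

/-- The projective resolution. -/
def rP [Module.Projective L A0] [Module.Projective L A1] [Module.Projective L A2]
    (e : A0 →ₗ[L] M) (h0 : ∀ y, e (f y) = 0) (he : Function.Surjective e)
    (h0' : ∀ z, e z = 0 → ∃ y, f y = z)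
    (h1 : ∀ z, f z = 0 → ∃ y, g y = z) (h2 : ∀ y, g y = 0 → y = 0) :
    ProjectiveResolution (ModuleCat.of L M) where
  complex := rC f g h
  projective := rC_proj f g h
  π := rpi f g h e h0
  quasiIso := ⟨fun n => by
    cases n
    · rw [ChainComplex.quasiIsoAt₀_iff, ShortComplex.quasiIso_iff_of_zeros']
      · refine (ShortComplex.exact_and_epi_g_iff_of_iso (S₂ := ShortComplex.mk (ModuleCat.ofHom f) (ModuleCat.ofHom e) (by ext y; exact h0 y)) ?_).2
          ⟨?_, ?_⟩
        · refine ShortComplex.isoMk (Iso.refl _) (Iso.refl _) (Iso.refl _) ?_ ?_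
          · exact (Category.id_comp _).trans ((rC_d f g h 0).symm.trans (Category.comp_id _).symm)
          · have hh : (rpi f g h e h0).f 0 = ModuleCat.ofHom e :=
              ChainComplex.toSingle₀Equiv_symm_apply_f_zero _ _
            exact (Category.id_comp _).trans (hh.symm.trans (Category.comp_id _).symm)
        · rw [ShortComplex.moduleCat_exact_iff]
          exact h0'
        · exact (ModuleCat.epi_iff_surjective _).2 he
      all_goals rfl
    · rw [quasiIsoAt_iff_exactAt']
      · exact rC_exact_succ f g h h1 h2 _
      · apply ChainComplex.exactAt_succ_single_obj⟩

variable {k : Type} [Field k]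

lemma sc_finrank (S : ShortComplex (ModuleCat.{0} k)) [FiniteDimensional k S.X₂] :
    finrank k S.homology + finrank k (LinearMap.range S.f.hom) = finrank k (LinearMap.ker S.g.hom) := by
  rw [S.moduleCatHomologyIso.toLinearEquiv.finrank_eq]
  have := Submodule.finrank_quotient_add_finrank (LinearMap.range S.moduleCatToCycles)
  rw [← this]
  congr 1
  have : LinearMap.range S.f.hom = (LinearMap.range S.moduleCatToCycles).map (LinearMap.ker S.g.hom).subtype := by
    rw [← LinearMap.range_comp]; rfl
  rw [this, Submodule.finrank_map_subtype_eq]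

lemma euler_cx (K : CochainComplex (ModuleCat.{0} k) ℕ) [FiniteDimensional k (K.X 0)]
    [FiniteDimensional k (K.X 1)] [FiniteDimensional k (K.X 2)] (h3 : K.d 2 3 = 0) :
    (finrank k (K.homology 0) : ℤ) - finrank k (K.homology 1) + finrank k (K.homology 2) =
    finrank k (K.X 0) - finrank k (K.X 1) + finrank k (K.X 2) := by
  have key : ∀ i j l (hi : (ComplexShape.up ℕ).prev j = i) (hl : (ComplexShape.up ℕ).next j = l)
      [FiniteDimensional k (K.X j)],
      finrank k (K.homology j) + finrank k (LinearMap.range (K.d i j).hom) = finrank k (LinearMap.ker (K.d j l).hom) := by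
    intro i j l hi hl _
    have : FiniteDimensional k (K.sc' i j l).X₂ := inferInstanceAs (FiniteDimensional k (K.X j))
    refine Eq.trans ?_ (sc_finrank (K.sc' i j l))
    refine congrArg (· + _) ?_
    exact (ShortComplex.homologyMapIso (K.isoSc' i j l hi hl)).toLinearEquiv.finrank_eq
  have k0 := key 0 0 1 (by simp) (by simp)
  have k1 := key 0 1 2 (by simp) (by simp)
  have k2 := key 1 2 3 (by simp) (by simp)
  have e0 : K.d 0 0 = 0 := K.shape _ _ (by simp)
  rw [e0] at k0
  rw [h3] at k2
  have r0 := LinearMap.finrank_range_add_finrank_ker (K.d 0 1).hom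
  have r1 := LinearMap.finrank_range_add_finrank_ker (K.d 1 2).hom
  have z0 : finrank k (LinearMap.range (0 : K.X 0 ⟶ K.X 0).hom) = 0 := by
    simp
  have z3 : finrank k (LinearMap.ker (0 : K.X 2 ⟶ K.X 3).hom) = finrank k (K.X 2) := by
    have : LinearMap.ker (0 : K.X 2 ⟶ K.X 3).hom = ⊤ := LinearMap.ker_zero
    rw [this, finrank_top]
  omega

section
variable [Algebra k L] (N : Type) [AddCommGroup N] [Module L N] [Module k N] [IsScalarTower k L N]
  [SMulCommClass L k N]

/-- Hom spaces in the category. -/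
def catHom (A : Type) [AddCommGroup A] [Module L A] :
    (((linearYoneda k (ModuleCat.{0} L)).obj (ModuleCat.of L N)).obj (Opposite.op (ModuleCat.of L A))) ≃ₗ[k] (A →ₗ[L] N) where
  toFun φ := ModuleCat.Hom.hom (show (ModuleCat.of L A ⟶ ModuleCat.of L N) from φ)
  invFun ψ := (ModuleCat.ofHom ψ : (ModuleCat.of L A ⟶ ModuleCat.of L N))
  left_inv _ := rfl
  right_inv _ := rfl
  map_add' _ _ := rfl
  map_smul' r φ := by
    ext a
    exact algebraMap_smul L r ((ModuleCat.Hom.hom (show (ModuleCat.of L A ⟶ ModuleCat.of L N) from φ)) a)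

lemma ext_euler (h : ∀ y, f (g y) = 0) [Module.Projective L A0] [Module.Projective L A1] [Module.Projective L A2]
    (e : A0 →ₗ[L] M) (h0 : ∀ y, e (f y) = 0) (he : Function.Surjective e)
    (h0' : ∀ z, e z = 0 → ∃ y, f y = z)
    (h1 : ∀ z, f z = 0 → ∃ y, g y = z) (h2 : ∀ y, g y = 0 → y = 0)
    [FiniteDimensional k (A0 →ₗ[L] N)] [FiniteDimensional k (A1 →ₗ[L] N)] [FiniteDimensional k (A2 →ₗ[L] N)] :
    (Module.finrank k ↥(((Ext k (ModuleCat.{0} L) 0).obj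
          (Opposite.op (ModuleCat.of L M))).obj (ModuleCat.of L N)) : ℤ)
      - (Module.finrank k ↥(((Ext k (ModuleCat.{0} L) 1).obj
          (Opposite.op (ModuleCat.of L M))).obj (ModuleCat.of L N)) : ℤ)
      + (Module.finrank k ↥(((Ext k (ModuleCat.{0} L) 2).obj
          (Opposite.op (ModuleCat.of L M))).obj (ModuleCat.of L N)) : ℤ) =
    finrank k (A0 →ₗ[L] N) - finrank k (A1 →ₗ[L] N) + finrank k (A2 →ₗ[L] N) := by
  let P := rP f g h e h0 he h0' h1 h2
  rw [(P.isoExt (R := k) 0 (ModuleCat.of L N)).toLinearEquiv.finrank_eq,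
    (P.isoExt (R := k) 1 (ModuleCat.of L N)).toLinearEquiv.finrank_eq,
    (P.isoExt (R := k) 2 (ModuleCat.of L N)).toLinearEquiv.finrank_eq]
  let K := P.complex.linearYonedaObj k (ModuleCat.of L N)
  have e0 : (K.X 0) ≃ₗ[k] (A0 →ₗ[L] N) := catHom N A0
  have e1 : (K.X 1) ≃ₗ[k] (A1 →ₗ[L] N) := catHom N A1
  have e2 : (K.X 2) ≃ₗ[k] (A2 →ₗ[L] N) := catHom N A2
  have e3 : (K.X 3) ≃ₗ[k] (PUnit →ₗ[L] N) := catHom N PUnit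
  have f0 : FiniteDimensional k (K.X 0) := e0.symm.finiteDimensional
  have f1 : FiniteDimensional k (K.X 1) := e1.symm.finiteDimensional
  have f2 : FiniteDimensional k (K.X 2) := e2.symm.finiteDimensional
  have h3 : K.d 2 3 = 0 := by
    ext x
    apply e3.injective
    ext a
    rw [Subsingleton.elim a 0, map_zero, map_zero]
  have := euler_cx K h3
  rw [e0.finrank_eq, e1.finrank_eq, e2.finrank_eq] at this
  exact this
end
end ExtG
end GelfandRed

namespace GelfandRed
open Module TensorProduct

section Fin
variable {k : Type} [Field k]

lemma proj_tensor (i : Fin 3) (V : Type) [AddCommGroup V] [Module k V] :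
    Module.Projective (gelfandOrder k) (PJ k i ⊗[k] V) := inferInstance

variable (M : Type) [AddCommGroup M] [Module (↥(gelfandOrder k)) M] [Module k M]
    [IsScalarTower k (↥(gelfandOrder k)) M] [FiniteDimensional k M]
    (N : Type) [AddCommGroup N] [Module (↥(gelfandOrder k)) N] [Module k N]
    [IsScalarTower k (↥(gelfandOrder k)) N] [FiniteDimensional k N]

open CategoryTheory in
lemma euler_formula :
    (Module.finrank k ↥(((Ext k (ModuleCat (↥(gelfandOrder k))) 0).obj
          (Opposite.op (ModuleCat.of (↥(gelfandOrder k)) M))).obj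
          (ModuleCat.of (↥(gelfandOrder k)) N)) : ℤ)
      - (Module.finrank k ↥(((Ext k (ModuleCat (↥(gelfandOrder k))) 1).obj
          (Opposite.op (ModuleCat.of (↥(gelfandOrder k)) M))).obj
          (ModuleCat.of (↥(gelfandOrder k)) N)) : ℤ)
      + (Module.finrank k ↥(((Ext k (ModuleCat (↥(gelfandOrder k))) 2).obj
          (Opposite.op (ModuleCat.of (↥(gelfandOrder k)) M))).obj
          (ModuleCat.of (↥(gelfandOrder k)) N)) : ℤ)
    = ((dm k M 0 : ℤ) - dm k M 1) * ((dm k N 0 : ℤ) - dm k N 1) +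
      ((dm k M 0 : ℤ) - dm k M 2) * ((dm k N 0 : ℤ) - dm k N 2) := by
  obtain ⟨hc, h1, h0'⟩ := package (k := k) M
  have p0 := proj_tensor (k := k) 0 (VS k M 0)
  have p01 := proj_tensor (k := k) 0 (VS k M 1)
  have p02 := proj_tensor (k := k) 0 (VS k M 2)
  have p10 := proj_tensor (k := k) 1 (VS k M 0)
  have p11 := proj_tensor (k := k) 1 (VS k M 1)
  have p20 := proj_tensor (k := k) 2 (VS k M 0)
  have p22 := proj_tensor (k := k) 2 (VS k M 2)
  obtain ⟨fA, rA⟩ := prod_hom (k := k) N (PJ k 1 ⊗[k] VS k M 1) (PJ k 2 ⊗[k] VS k M 2)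
  obtain ⟨fB, rB⟩ := prod_hom (k := k) N (PJ k 0 ⊗[k] VS k M 0) ((PJ k 1 ⊗[k] VS k M 1) × (PJ k 2 ⊗[k] VS k M 2))
  obtain ⟨fC, rC⟩ := prod_hom (k := k) N (PJ k 0 ⊗[k] VS k M 1) (PJ k 1 ⊗[k] VS k M 0)
  obtain ⟨fD, rD⟩ := prod_hom (k := k) N (PJ k 0 ⊗[k] VS k M 2) (PJ k 2 ⊗[k] VS k M 0)
  obtain ⟨fE, rE⟩ := prod_hom (k := k) N ((PJ k 0 ⊗[k] VS k M 1) × (PJ k 1 ⊗[k] VS k M 0))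
    ((PJ k 0 ⊗[k] VS k M 2) × (PJ k 2 ⊗[k] VS k M 0))
  rw [ext_euler (k := k) (D1 (arr M 1 0) (arr (k := k) M 0 1) (arr M 2 0) (arr M 0 2))
    (D2 (arr M 1 0) (arr M 2 0)) N hc (eps M) (eps_D1 M) (eps_surj M) h0' h1 (exact2 _ _),
    rB, rA, rE, rC, rD]
  simp only [hom_finrank]
  have hd : ∀ i, finrank k (VS k M i) = dm k M i := fun _ => rfl
  simp only [hd]
  push_cast
  ring

end Fin
end GelfandRed

open CategoryTheory in
/-- Over an algebraically closed field `k`, for nonzero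
finite-dimensional indecomposable left `Λ`-modules `M`, `N`, the Euler characteristic
satisfies `|Σ_{i=0}^{2} (−1)^i dim_k Ext^i_Λ(M,N)| ≤ 2`. -/
theorem euler_characteristic_of_indecomposables_bounded [IsAlgClosed k]
    (M : Type) [AddCommGroup M] [Module (↥(gelfandOrder k)) M] [Module k M]
    [IsScalarTower k (↥(gelfandOrder k)) M] [FiniteDimensional k M]
    (N : Type) [AddCommGroup N] [Module (↥(gelfandOrder k)) N] [Module k N]
    [IsScalarTower k (↥(gelfandOrder k)) N] [FiniteDimensional k N]
    (hM0 : Nontrivial M) (hN0 : Nontrivial N)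
    (hM : ∀ A B : Submodule (↥(gelfandOrder k)) M, IsCompl A B → A = ⊥ ∨ B = ⊥)
    (hN : ∀ A B : Submodule (↥(gelfandOrder k)) N, IsCompl A B → A = ⊥ ∨ B = ⊥) :
    |(Module.finrank k ↥(((Ext k (ModuleCat (↥(gelfandOrder k))) 0).obj
          (Opposite.op (ModuleCat.of (↥(gelfandOrder k)) M))).obj
          (ModuleCat.of (↥(gelfandOrder k)) N)) : ℤ)
      - (Module.finrank k ↥(((Ext k (ModuleCat (↥(gelfandOrder k))) 1).obj
          (Opposite.op (ModuleCat.of (↥(gelfandOrder k)) M))).obj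
          (ModuleCat.of (↥(gelfandOrder k)) N)) : ℤ)
      + (Module.finrank k ↥(((Ext k (ModuleCat (↥(gelfandOrder k))) 2).obj
          (Opposite.op (ModuleCat.of (↥(gelfandOrder k)) M))).obj
          (ModuleCat.of (↥(gelfandOrder k)) N)) : ℤ)| ≤ 2 := by
  rw [GelfandRed.euler_formula]
  exact GelfandRed.num_bound _ _ _ _ _ _ (GelfandRed.dim_bound M hM) (GelfandRed.dim_bound N hN)
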